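/- Let P be a simple polygon and let Π be a connected curve contained in P that intersects every nonredundant cut of P. Then Π is a visibility path for P, i.e., every point of P is visible from at least one point of Π. -/

import Mathlib

open Set

noncomputable section

/-- The Euclidean plane. -/
abbrev E2 := EuclideanSpace ℝ (Fin 2)

/-- A simple polygon in the plane, given by its cyclic sequence of vertices.
Adjacent edges meet exactly at their common vertex, and non-adjacent edges
are disjoint, so the boundary is a simple closed polygonal curve. -/
structure SimplePolygon where
  n : ℕ
  three_le : 3 ≤ n
  vtx : ZMod n → E2
  inj : Function.Injective vtx
  adj_edges : ∀ i : ZMod n,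
    segment ℝ (vtx i) (vtx (i + 1)) ∩ segment ℝ (vtx (i + 1)) (vtx (i + 2)) = {vtx (i + 1)}
  nonadj_edges : ∀ i j : ZMod n, i ≠ j → i + 1 ≠ j → j + 1 ≠ i →
    segment ℝ (vtx i) (vtx (i + 1)) ∩ segment ℝ (vtx j) (vtx (j + 1)) = ∅

namespace SimplePolygon

variable (P : SimplePolygon)

/-- The boundary `∂P`: the union of the edges. -/
def boundary : Set E2 := ⋃ i : ZMod P.n, segment ℝ (P.vtx i) (P.vtx (i + 1))

/-- The compact region bounded by `∂P`: the boundary together with all points of the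
bounded connected components of its complement. -/
def region : Set E2 :=
  P.boundary ∪ {x | x ∉ P.boundary ∧ Bornology.IsBounded (connectedComponentIn P.boundaryᶜ x)}

/-- `x` sees `y` (in `P`) if the closed segment `[x,y]` is contained in `P`. -/
def Visible (x y : E2) : Prop := segment ℝ x y ⊆ P.region

/-- The vertex `vtx i` is reflex: its internal angle is strictly larger than `π`, i.e.
near the vertex the midpoint of two points at equal small parameter along the two
incident edges lies outside the region. -/
def IsReflex (i : ZMod P.n) : Prop :=
  ∃ ε₀ > (0 : ℝ), ∀ ε ∈ Set.Ioo (0 : ℝ) ε₀,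
    midpoint ℝ (P.vtx i + ε • (P.vtx (i - 1) - P.vtx i))
               (P.vtx i + ε • (P.vtx (i + 1) - P.vtx i)) ∉ P.region

/-- `P` is star-shaped if a single point of `P` sees all of `P`. -/
def IsStarShaped : Prop := ∃ x ∈ P.region, ∀ y ∈ P.region, P.Visible x y

/-- A visibility path: a connected curve inside `P` from which every point of `P`
is visible. -/
def IsVisibilityPath (Pth : Set E2) : Prop :=
  IsConnected Pth ∧ Pth ⊆ P.region ∧ ∀ x ∈ P.region, ∃ p ∈ Pth, P.Visible x p

/-- The pocket, inside `P`, determined by a cut segment `s` on the side of the point `u`: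
the closure of the connected component of `P \ s` containing `u`, together with `s`. -/
def pocketOfSeg (s : Set E2) (u : E2) : Set E2 :=
  closure (connectedComponentIn (P.region \ s) u) ∪ s

end SimplePolygon

/-- A cut of a simple polygon `P`: for a reflex vertex `v = vtx i` with adjacent
vertex `u = vtx j`, the segment from `v` to the closest point `w` of `∂P` hit by
the ray from `v` in the direction from `u` to `v`. -/
structure SimplePolygon.Cut (P : SimplePolygon) where
  i : ZMod P.n
  j : ZMod P.n
  adj : j = i + 1 ∨ j = i - 1
  reflex : P.IsReflex i
  t : ℝ
  t_pos : 0 < t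
  hits : P.vtx i + t • (P.vtx i - P.vtx j) ∈ P.boundary
  first_hit : ∀ s ∈ Set.Ioo (0 : ℝ) t, P.vtx i + s • (P.vtx i - P.vtx j) ∉ P.boundary
  inside : segment ℝ (P.vtx i) (P.vtx i + t • (P.vtx i - P.vtx j)) ⊆ P.region

namespace SimplePolygon.Cut

variable {P : SimplePolygon} (C : P.Cut)

/-- The reflex vertex generating the cut. -/
def v : E2 := P.vtx C.i

/-- The adjacent vertex `u`; the edge `u v` is the generator of the cut. -/
def u : E2 := P.vtx C.j

/-- The other endpoint of the cut, on `∂P`. -/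
def w : E2 := P.vtx C.i + C.t • (P.vtx C.i - P.vtx C.j)

/-- The cut as a segment. -/
def seg : Set E2 := segment ℝ C.v C.w

/-- `Pocket(C)`: the part of `P` cut off by `C` that contains the generator vertex `u`. -/
def pocket : Set E2 := P.pocketOfSeg C.seg C.u

/-- A cut is redundant if the pocket of some cut is strictly contained in its pocket. -/
def Redundant : Prop := ∃ C' : P.Cut, C'.pocket ⊂ C.pocket

/-- A nonredundant (essential) cut. -/
def Nonredundant : Prop := ¬ C.Redundant

/-- `x` is a vertex of the polygon `Pocket(C)`: either the endpoint `w` of the cut, or a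
vertex of `P` belonging to the pocket. -/
def PocketVertex (x : E2) : Prop :=
  x = C.w ∨ ∃ k : ZMod P.n, P.vtx k = x ∧ x ∈ C.pocket

end SimplePolygon.Cut

/-- Length of a polygonal path given by its list of vertices. -/
def polyLength (l : List E2) : ℝ := ((l.zip l.tail).map fun p => dist p.1 p.2).sum

namespace SimplePolygon

variable (P : SimplePolygon)

/-- A polygonal path inside `P`: a nonempty list of points with each consecutive
segment contained in `P`. -/
def IsPolyPathIn (l : List E2) : Prop :=
  l ≠ [] ∧ List.Chain' (fun a b => segment ℝ a b ⊆ P.region) l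

/-- `l` is a shortest Euclidean (polygonal) path inside `P` from `x` to the set `S`. -/
def IsGeodesicTo (x : E2) (S : Set E2) (l : List E2) : Prop :=
  P.IsPolyPathIn l ∧ l.head? = some x ∧ (∃ y ∈ S, l.getLast? = some y) ∧
  ∀ m : List E2, P.IsPolyPathIn m → m.head? = some x →
    (∃ y ∈ S, m.getLast? = some y) → polyLength l ≤ polyLength m

/-- The subpolygon `Q` of `P` obtained by cutting `P` along all nonredundant cuts:
the closure of `P` minus the union of the pockets of all nonredundant cuts. -/
def core : Set E2 :=
  closure (P.region \ ⋃ C : {C : P.Cut // C.Nonredundant}, (C : P.Cut).pocket)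

end SimplePolygon

/-- The planar cross product. -/
def cross2 (a b : E2) : ℝ := a 0 * b 1 - a 1 * b 0

/-- A polygonal chain all of whose turns have the sign `s` (a convex chain bending
consistently to one side). -/
def ConvexChain (s : ℝ) (l : List E2) : Prop :=
  ∀ p q r : E2, [p, q, r] <:+: l → 0 ≤ s * cross2 (q - p) (r - q)

open Filter Topology

/-! ### Oriented area forms on the plane -/

/-- The planar cross product scaled by `σ`; the sign of `σ` chooses the orientation. -/
def area (σ : ℝ) (a b : E2) : ℝ := σ * (a 0 * b 1 - a 1 * b 0)

section area

variable {σ : ℝ}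

theorem area_add_right (a b c : E2) : area σ a (b + c) = area σ a b + area σ a c := by
  simp [area]; ring

theorem area_sub_right (a b c : E2) : area σ a (b - c) = area σ a b - area σ a c := by
  simp [area]; ring

theorem area_smul_right (t : ℝ) (a b : E2) : area σ a (t • b) = t * area σ a b := by
  simp [area]; ring

theorem area_neg_right (a b : E2) : area σ a (-b) = -area σ a b := by
  simp [area]; ring

theorem area_add_left (a b c : E2) : area σ (a + b) c = area σ a c + area σ b c := by
  simp [area]; ring

theorem area_sub_left (a b c : E2) : area σ (a - b) c = area σ a c - area σ b c := by
  simp [area]; ring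

theorem area_smul_left (t : ℝ) (a b : E2) : area σ (t • a) b = t * area σ a b := by
  simp [area]; ring

theorem area_neg_left (a b : E2) : area σ (-a) b = -area σ a b := by
  simp [area]; ring

theorem area_self (a : E2) : area σ a a = 0 := by
  simp [area]; ring_nf; simp

theorem area_swap (a b : E2) : area σ a b = -area σ b a := by
  simp [area]; ring

theorem continuous_area_right (a z : E2) : Continuous fun y : E2 => area σ a (y - z) := by
  simp only [area, PiLp.sub_apply]; fun_prop

theorem continuous_area_left (a z : E2) : Continuous fun y : E2 => area σ (y - z) a := by
  simp only [area, PiLp.sub_apply]; fun_prop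

theorem ext_E2 {a b : E2} (h0 : a 0 = b 0) (h1 : a 1 = b 1) : a = b := by
  ext i; fin_cases i
  · exact h0
  · exact h1

theorem coord_ne_zero {a : E2} (ha : a ≠ 0) : 0 < a 0 ^ 2 + a 1 ^ 2 := by
  by_contra h
  apply ha
  have h0 : a 0 = 0 := by nlinarith [sq_nonneg (a 0), sq_nonneg (a 1)]
  have h1 : a 1 = 0 := by nlinarith [sq_nonneg (a 0), sq_nonneg (a 1)]
  exact ext_E2 (by simpa using h0) (by simpa using h1)

theorem exists_smul_of_area_eq_zero (hσ : σ ≠ 0) {a b : E2} (ha : a ≠ 0) (h : area σ a b = 0) :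
    ∃ k : ℝ, b = k • a := by
  have hp := coord_ne_zero ha
  have h' : a 0 * b 1 - a 1 * b 0 = 0 := by
    simpa [area, hσ] using h
  refine ⟨(a 0 * b 0 + a 1 * b 1) / (a 0 ^ 2 + a 1 ^ 2), ext_E2 ?_ ?_⟩
  · simp; field_simp; linear_combination (-a 1) * h'
  · simp; field_simp; linear_combination (a 0) * h'

theorem area_decomp {a b : E2} (h : area σ a b ≠ 0) (y : E2) :
    y = (area σ y b / area σ a b) • a + (area σ a y / area σ a b) • b := by
  have h' : area σ y b • a + area σ a y • b = area σ a b • y := by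
    apply ext_E2 <;> simp [area] <;> ring
  rw [div_eq_inv_mul, div_eq_inv_mul, mul_smul, mul_smul, ← smul_add, h', smul_smul,
    inv_mul_cancel₀ h, one_smul]

theorem convex_area_right_pos (a z : E2) : Convex ℝ {y : E2 | 0 < area σ a (y - z)} := by
  intro y hy y' hy' s t hs ht hst
  have e : area σ a (s • y + t • y' - z) = s * area σ a (y - z) + t * area σ a (y' - z) := by
    obtain rfl : t = 1 - s := by linarith
    simp [area]; ring
  simp only [mem_ofPred_eq] at *
  rw [e]
  rcases hs.eq_or_lt with rfl | hs
  · have : t = 1 := by linarith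
    simpa [this] using hy'
  · nlinarith [mul_pos hs hy, mul_nonneg ht hy'.le]

theorem convex_area_left_pos (a z : E2) : Convex ℝ {y : E2 | 0 < area σ (y - z) a} := by
  have h := convex_area_right_pos (σ := σ) (-a) z
  convert h using 3 with y
  rw [area_neg_left, ← area_swap]

theorem convex_area_right_neg (a z : E2) : Convex ℝ {y : E2 | area σ a (y - z) < 0} := by
  have h := convex_area_right_pos (σ := σ) (-a) z
  convert h using 3 with y
  rw [area_neg_left, neg_pos]

theorem convex_area_left_neg (a z : E2) : Convex ℝ {y : E2 | area σ (y - z) a < 0} := by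
  have h := convex_area_left_pos (σ := σ) (-a) z
  convert h using 3 with y
  rw [area_neg_right, neg_pos]

end area

/-! ### The angle subtended by a segment -/

/-- The complex number `p - y`. -/
def toward (p y : E2) : ℂ := ⟨p 0 - y 0, p 1 - y 1⟩

theorem toward_ne_zero {p y : E2} (h : y ≠ p) : toward p y ≠ 0 := by
  intro h0
  apply h
  have h1 := congrArg Complex.re h0
  have h2 := congrArg Complex.im h0
  simp [toward] at h1 h2
  exact ext_E2 (by linarith) (by linarith)

theorem continuous_toward (p : E2) : Continuous (toward p) := by
  have : toward p = fun y : E2 => ((p 0 - y 0 : ℝ) : ℂ) + ((p 1 - y 1 : ℝ) : ℂ) * Complex.I := by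
    funext y; apply Complex.ext <;> simp [toward]
  rw [this]; fun_prop

/-- The signed angle under which the segment from `a` to `b` is seen from `y`. -/
def subtend (a b y : E2) : ℝ := Complex.arg (toward b y * (starRingEnd ℂ) (toward a y))

theorem re_toward (a b y : E2) : (toward b y * (starRingEnd ℂ) (toward a y)).re =
    (a 0 - y 0) * (b 0 - y 0) + (a 1 - y 1) * (b 1 - y 1) := by
  simp [toward]; ring

theorem im_toward (a b y : E2) : (toward b y * (starRingEnd ℂ) (toward a y)).im =
    area 1 (b - a) (y - a) := by
  simp [toward, area]; ring

theorem mem_segment_of_toward {a b y : E2}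
    (h : toward b y * (starRingEnd ℂ) (toward a y) ∉ Complex.slitPlane) : y ∈ segment ℝ a b := by
  rw [Complex.mem_slitPlane_iff, not_or, not_lt, not_not, re_toward, im_toward] at h
  obtain ⟨h1, h2⟩ := h
  by_cases hab : b - a = 0
  · have hb : b = a := sub_eq_zero.1 hab
    subst hb
    by_cases hy : y = b
    · subst hy; exact left_mem_segment ℝ _ _
    · have := coord_ne_zero (sub_ne_zero.2 hy)
      simp at this
      nlinarith
  · obtain ⟨k, hk⟩ := exists_smul_of_area_eq_zero one_ne_zero hab h2
    have hp := coord_ne_zero hab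
    have hy : y = a + k • (b - a) := by rw [← hk]; simp
    have e0 : y 0 = a 0 + k * (b 0 - a 0) := by rw [hy]; simp
    have e1 : y 1 = a 1 + k * (b 1 - a 1) := by rw [hy]; simp
    rw [e0, e1] at h1
    simp at hp
    have hk1 : k * (k - 1) ≤ 0 := by
      by_contra hc
      push Not at hc
      nlinarith [mul_pos hc hp]
    rw [segment_eq_image']
    refine ⟨k, ⟨?_, ?_⟩, hy.symm⟩
    · nlinarith
    · nlinarith

theorem continuousAt_subtend {a b y : E2} (h : y ∉ segment ℝ a b) :
    ContinuousAt (subtend a b) y := by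
  have hs : toward b y * (starRingEnd ℂ) (toward a y) ∈ Complex.slitPlane := by
    by_contra hc; exact h (mem_segment_of_toward hc)
  have hc : ContinuousAt (fun y => toward b y * (starRingEnd ℂ) (toward a y)) y :=
    ((continuous_toward b).mul (Complex.continuous_conj.comp (continuous_toward a))).continuousAt
  exact ContinuousAt.comp (f := fun y => toward b y * (starRingEnd ℂ) (toward a y))
    (Complex.continuousAt_arg hs) hc

theorem subtend_swap {a b y : E2} (h : y ∉ segment ℝ a b) : subtend b a y = -subtend a b y := by
  have hs : toward b y * (starRingEnd ℂ) (toward a y) ∈ Complex.slitPlane := by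
    by_contra hc; exact h (mem_segment_of_toward hc)
  have e : toward a y * (starRingEnd ℂ) (toward b y) =
      (starRingEnd ℂ) (toward b y * (starRingEnd ℂ) (toward a y)) := by
    simp [mul_comm]
  rw [subtend, e, Complex.arg_conj, if_neg (Complex.mem_slitPlane_iff_arg.1 hs).1, subtend]

/-- The unit vector pointing from `y` to `p`, as a complex number. -/
def unitToward (p y : E2) : ℂ := toward p y / ‖toward p y‖

theorem unitToward_ne_zero {p y : E2} (h : y ≠ p) : unitToward p y ≠ 0 := by
  have := toward_ne_zero h
  simp [unitToward, this]

theorem exp_subtend {a b y : E2} (ha : y ≠ a) (hb : y ≠ b) :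
    Complex.exp (subtend a b y * Complex.I) = unitToward b y / unitToward a y := by
  have ha' := toward_ne_zero ha
  have hb' := toward_ne_zero hb
  have h := Complex.norm_mul_exp_arg_mul_I (toward b y * (starRingEnd ℂ) (toward a y))
  have na : (‖toward a y‖ : ℂ) ≠ 0 := by simpa using ha'
  have nb : (‖toward b y‖ : ℂ) ≠ 0 := by simpa using hb'
  have hn : toward a y * (starRingEnd ℂ) (toward a y) = (‖toward a y‖ : ℂ) ^ 2 := by
    rw [Complex.mul_conj, Complex.normSq_eq_norm_sq]; push_cast; rfl
  rw [norm_mul, RCLike.norm_conj, Complex.ofReal_mul] at h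
  rw [subtend, unitToward, unitToward]
  field_simp
  have : (‖toward b y‖ : ℂ) * ‖toward a y‖ * (Complex.exp
      ((toward b y * (starRingEnd ℂ) (toward a y)).arg * Complex.I) * toward a y) =
      toward b y * ‖toward a y‖ ^ 2 := by
    rw [← mul_assoc, h, ← hn]; ring
  have h3 : (‖toward a y‖ : ℂ) * (‖toward b y‖ * (Complex.exp
      ((toward b y * (starRingEnd ℂ) (toward a y)).arg * Complex.I) * toward a y)) =
      ‖toward a y‖ * (toward b y * ‖toward a y‖) := by
    linear_combination this
  have h4 := mul_left_cancel₀ na h3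
  linear_combination h4

/-- The total angle under which the first `j` edges of the chain `q` are seen from `y`. -/
def chainAngle (q : ℕ → E2) (j : ℕ) (y : E2) : ℝ :=
  ∑ k ∈ Finset.range j, subtend (q k) (q (k + 1)) y

theorem exp_chainAngle {q : ℕ → E2} {j : ℕ} {y : E2} (h : ∀ k ≤ j, y ≠ q k) :
    Complex.exp (chainAngle q j y * Complex.I) = unitToward (q j) y / unitToward (q 0) y := by
  induction j with
  | zero => simp [chainAngle, div_self (unitToward_ne_zero (h 0 le_rfl))]
  | succ j ih =>
    have ih := ih fun k hk => h k (by omega)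
    have := unitToward_ne_zero (h j (by omega))
    have e : chainAngle q (j + 1) y = chainAngle q j y + subtend (q j) (q (j + 1)) y := by
      simp [chainAngle, Finset.sum_range_succ]
    rw [e, Complex.ofReal_add, add_mul, Complex.exp_add, ih,
      exp_subtend (h j (by omega)) (h (j + 1) le_rfl)]
    field_simp

theorem continuousAt_chainAngle {q : ℕ → E2} {j : ℕ} {y : E2}
    (h : ∀ k < j, y ∉ segment ℝ (q k) (q (k + 1))) : ContinuousAt (chainAngle q j) y := by
  have e : chainAngle q j = fun y => ∑ k ∈ Finset.range j, subtend (q k) (q (k + 1)) y := rfl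
  rw [e]
  apply tendsto_finsetSum
  intro k hk
  exact continuousAt_subtend (h k (Finset.mem_range.1 hk))

theorem exists_int_of_exp_eq_one {t : ℝ} (h : Complex.exp (t * Complex.I) = 1) :
    ∃ n : ℤ, t = n * (2 * Real.pi) := by
  obtain ⟨n, hn⟩ := Complex.exp_eq_one_iff.1 h
  refine ⟨n, ?_⟩
  have := congrArg Complex.im hn
  simpa using this

/-- Two multiples of `2π` at distance less than `6` agree. -/
theorem eq_of_abs_sub_lt {s t : ℝ} (hs : Complex.exp (s * Complex.I) = 1)
    (ht : Complex.exp (t * Complex.I) = 1) (h : |s - t| < 6) : s = t := by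
  obtain ⟨m, rfl⟩ := exists_int_of_exp_eq_one hs
  obtain ⟨n, rfl⟩ := exists_int_of_exp_eq_one ht
  have hpi := Real.pi_gt_three
  rw [← sub_mul, abs_mul, abs_of_pos (by positivity : (0 : ℝ) < 2 * Real.pi)] at h
  have h1 : |(m : ℝ) - n| < 1 := by
    by_contra hc
    push Not at hc
    nlinarith
  have h2 : |m - n| < 1 := by exact_mod_cast h1
  have h3 : m = n := by
    rw [Int.abs_lt_one_iff] at h2; omega
  rw [h3]

theorem subtend_jump {a b m : E2} (hm : m ∈ openSegment ℝ a b) (hab : a ≠ b) {η : ℝ} (hη : 0 < η) :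
    ∀ᶠ y in 𝓝 m, (0 < area 1 (b - a) (y - a) → |subtend a b y - Real.pi| < η) ∧
      (area 1 (b - a) (y - a) < 0 → |subtend a b y + Real.pi| < η) := by
  set Z : E2 → ℂ := fun y => toward b y * (starRingEnd ℂ) (toward a y) with hZ
  have hc : Continuous Z :=
    (continuous_toward b).mul (Complex.continuous_conj.comp (continuous_toward a))
  rw [openSegment_eq_image'] at hm
  obtain ⟨t, ⟨ht0, ht1⟩, rfl⟩ := hm
  have hp := coord_ne_zero (sub_ne_zero.2 hab.symm)
  set m := a + t • (b - a) with hmdef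
  have hre : (Z m).re < 0 := by
    simp only [hZ, re_toward, hmdef]
    simp at hp ⊢
    nlinarith [mul_pos (mul_pos ht0 (sub_pos.2 ht1)) hp]
  have him : (Z m).im = 0 := by
    simp only [hZ, im_toward, hmdef]
    simp [area_smul_right, area_self]
  have h1 := (Complex.tendsto_arg_nhdsWithin_im_nonneg_of_re_neg_of_im_zero hre him)
  have h2 := (Complex.tendsto_arg_nhdsWithin_im_neg_of_re_neg_of_im_zero hre him)
  have e1 := h1.eventually (Metric.ball_mem_nhds _ hη)
  have e2 := h2.eventually (Metric.ball_mem_nhds _ hη)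
  rw [eventually_nhdsWithin_iff] at e1 e2
  filter_upwards [hc.continuousAt.eventually e1, hc.continuousAt.eventually e2] with y y1 y2
  constructor
  · intro h
    have := y1 (show 0 ≤ (Z y).im by rw [hZ]; simp only [im_toward]; exact h.le)
    rwa [Real.dist_eq] at this
  · intro h
    have := y2 (show (Z y).im < 0 by rw [hZ]; simp only [im_toward]; exact h)
    rw [Real.dist_eq, sub_neg_eq_add] at this
    exact this

/-- The angle of a segment lying in an open half-plane bounded by a line through `y` is the
difference of the arguments of its endpoints. -/
theorem subtend_of_halfPlane {a b y w : E2} (ha : 0 < w 0 * (a 0 - y 0) + w 1 * (a 1 - y 1))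
    (hb : 0 < w 0 * (b 0 - y 0) + w 1 * (b 1 - y 1)) :
    subtend a b y = Complex.arg (toward b y * ⟨w 0, -w 1⟩) -
      Complex.arg (toward a y * ⟨w 0, -w 1⟩) := by
  set A := toward a y * ⟨w 0, -w 1⟩ with hA
  set B := toward b y * ⟨w 0, -w 1⟩ with hB
  have hAr : 0 < A.re := by simp [hA, toward]; linarith
  have hBr : 0 < B.re := by simp [hB, toward]; linarith
  have hA0 : A ≠ 0 := by rintro h0; simp [h0] at hAr
  have hB0 : B ≠ 0 := by rintro h0; simp [h0] at hBr
  have hAa := Complex.abs_arg_lt_pi_div_two_iff.2 (Or.inl hAr)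
  have hBa := Complex.abs_arg_lt_pi_div_two_iff.2 (Or.inl hBr)
  rw [abs_lt] at hAa hBa
  have hw : 0 < w 0 ^ 2 + w 1 ^ 2 := by
    by_contra hc
    have h0 : w 0 = 0 := by nlinarith [sq_nonneg (w 0), sq_nonneg (w 1)]
    have h1 : w 1 = 0 := by nlinarith [sq_nonneg (w 0), sq_nonneg (w 1)]
    simp [h0, h1] at ha
  have hAc : ((starRingEnd ℂ) A).arg = -A.arg := by
    rw [Complex.arg_conj, if_neg]; linarith [Real.pi_pos]
  have e : B * (starRingEnd ℂ) A =
      ((w 0 ^ 2 + w 1 ^ 2 : ℝ) : ℂ) * (toward b y * (starRingEnd ℂ) (toward a y)) := by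
    apply Complex.ext <;> simp [hA, hB, toward, pow_two] <;> ring
  rw [subtend, ← Complex.arg_real_mul _ hw, ← e, Complex.arg_mul hB0 (by simpa using hA0), hAc]
  · ring
  · rw [hAc]; constructor <;> linarith [Real.pi_pos]

/-- A continuous function with values in the multiples of `2π` is constant on preconnected sets. -/
theorem IsPreconnected.eq_of_exp_eq_one {T : Set E2} (hT : IsPreconnected T) {g : E2 → ℝ}
    (hg : ContinuousOn g T) (h1 : ∀ y ∈ T, Complex.exp (g y * Complex.I) = 1) {y y' : E2}
    (hy : y ∈ T) (hy' : y' ∈ T) : g y = g y' := by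
  have key : ∀ y ∈ T, ∀ y' ∈ T, ¬ g y < g y' := by
    intro y hy y' hy' hlt
    have h6 : g y + 6 ≤ g y' := by
      by_contra hc
      have := eq_of_abs_sub_lt (h1 y hy) (h1 y' hy') (by rw [abs_lt]; constructor <;> linarith)
      linarith
    obtain ⟨z, hz, hzg⟩ := hT.intermediate_value hy hy' hg
      (show g y + 1 ∈ Icc (g y) (g y') from ⟨by linarith, by linarith⟩)
    have := eq_of_abs_sub_lt (h1 y hy) (h1 z hz) (by rw [hzg, abs_lt]; constructor <;> linarith)
    linarith
  rcases lt_trichotomy (g y) (g y') with h | h | h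
  · exact (key y hy y' hy' h).elim
  · exact h
  · exact (key y' hy' y hy h).elim

namespace SimplePolygon

variable (P : SimplePolygon)

/-! ### Edges and boundary -/

instance : NeZero P.n := ⟨by have := P.three_le; omega⟩

/-- The edge from `vtx i` to `vtx (i + 1)`. -/
def edge (i : ZMod P.n) : Set E2 := segment ℝ (P.vtx i) (P.vtx (i + 1))

variable {P}

theorem vtx_ne_succ (i : ZMod P.n) : P.vtx i ≠ P.vtx (i + 1) := by
  intro h
  have h1 := P.inj h
  have h2 : (1 : ZMod P.n) = 0 := by simpa using h1
  have : Fact (1 < P.n) := ⟨by have := P.three_le; omega⟩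
  exact one_ne_zero h2

theorem mem_boundary {z : E2} : z ∈ P.boundary ↔ ∃ i, z ∈ P.edge i := by
  simp [boundary, edge]

theorem vtx_mem_edge (i : ZMod P.n) : P.vtx i ∈ P.edge i := left_mem_segment ℝ _ _

theorem vtx_succ_mem_edge (i : ZMod P.n) : P.vtx (i + 1) ∈ P.edge i := right_mem_segment ℝ _ _

theorem vtx_mem_boundary (i : ZMod P.n) : P.vtx i ∈ P.boundary :=
  mem_boundary.2 ⟨i, vtx_mem_edge i⟩

theorem eq_vtx_of_mem_edge {i j : ZMod P.n} (hij : i ≠ j) {z : E2} (hi : z ∈ P.edge i)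
    (hj : z ∈ P.edge j) : (j = i + 1 ∧ z = P.vtx j) ∨ (i = j + 1 ∧ z = P.vtx i) := by
  by_cases h1 : i + 1 = j
  · left
    subst h1
    have h := P.adj_edges i
    have : z ∈ segment ℝ (P.vtx i) (P.vtx (i + 1)) ∩
        segment ℝ (P.vtx (i + 1)) (P.vtx (i + 2)) := by
      refine ⟨hi, ?_⟩
      have e : i + 2 = i + 1 + 1 := by ring
      rw [e]; exact hj
    rw [h] at this
    exact ⟨rfl, this⟩
  · by_cases h2 : j + 1 = i
    · right
      subst h2
      have h := P.adj_edges j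
      have : z ∈ segment ℝ (P.vtx j) (P.vtx (j + 1)) ∩
          segment ℝ (P.vtx (j + 1)) (P.vtx (j + 2)) := by
        refine ⟨hj, ?_⟩
        have e : j + 2 = j + 1 + 1 := by ring
        rw [e]; exact hi
      rw [h] at this
      exact ⟨rfl, this⟩
    · have h := P.nonadj_edges i j hij h1 h2
      have : z ∈ (∅ : Set E2) := h ▸ ⟨hi, hj⟩
      exact this.elim

theorem isClosed_edge (i : ZMod P.n) : IsClosed (P.edge i) := by
  rw [edge, segment_eq_image]
  exact (isCompact_Icc.image (by fun_prop)).isClosed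

theorem isCompact_edge (i : ZMod P.n) : IsCompact (P.edge i) := by
  rw [edge, segment_eq_image]
  exact isCompact_Icc.image (by fun_prop)

theorem isCompact_boundary : IsCompact P.boundary :=
  isCompact_iUnion fun i => isCompact_edge i

theorem isClosed_boundary : IsClosed P.boundary := isCompact_boundary.isClosed

theorem isPreconnected_boundary : IsPreconnected P.boundary := by
  have e : P.boundary = ⋃ k : ℕ, P.edge (k : ZMod P.n) := by
    ext z
    rw [mem_boundary, mem_iUnion]
    constructor
    · rintro ⟨i, hi⟩
      obtain ⟨k, rfl⟩ := ZMod.natCast_zmod_surjective i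
      exact ⟨k, hi⟩
    · rintro ⟨k, hk⟩; exact ⟨_, hk⟩
  rw [e]
  apply IsPreconnected.iUnion_of_chain
  · intro k; exact (convex_segment _ _).isPreconnected
  · intro k
    refine ⟨P.vtx ((k : ZMod P.n) + 1), vtx_succ_mem_edge _, ?_⟩
    have := vtx_mem_edge (P := P) ((k : ZMod P.n) + 1)
    simpa [Nat.succ_eq_add_one] using this

/-! ### Winding number -/

variable (P) in
/-- The total angle under which the boundary is seen from `y`. -/
def wind (y : E2) : ℝ := ∑ k : ZMod P.n, subtend (P.vtx k) (P.vtx (k + 1)) y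

theorem ne_vtx_of_notMem {y : E2} (hy : y ∉ P.boundary) (k : ZMod P.n) : y ≠ P.vtx k := by
  rintro rfl; exact hy (vtx_mem_boundary k)

theorem exp_wind {y : E2} (hy : y ∉ P.boundary) : Complex.exp (P.wind y * Complex.I) = 1 := by
  rw [wind, Complex.ofReal_sum, Finset.sum_mul, Complex.exp_sum]
  rw [Finset.prod_congr rfl fun k _ => exp_subtend (ne_vtx_of_notMem hy k) (ne_vtx_of_notMem hy _),
    Finset.prod_div_distrib]
  have e : ∏ k : ZMod P.n, unitToward (P.vtx (k + 1)) y = ∏ k, unitToward (P.vtx k) y :=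
    Equiv.prod_comp (Equiv.addRight (1 : ZMod P.n)) fun k => unitToward (P.vtx k) y
  rw [e, div_self]
  exact Finset.prod_ne_zero_iff.2 fun k _ => unitToward_ne_zero (ne_vtx_of_notMem hy k)

theorem continuousAt_wind {y : E2} (hy : y ∉ P.boundary) : ContinuousAt P.wind y := by
  have e : P.wind = fun y => ∑ k : ZMod P.n, subtend (P.vtx k) (P.vtx (k + 1)) y := rfl
  rw [e]
  apply tendsto_finsetSum
  intro k _
  exact continuousAt_subtend fun h => hy (mem_boundary.2 ⟨k, h⟩)

theorem wind_eq {T : Set E2} (hT : IsPreconnected T) (h : T ⊆ P.boundaryᶜ) {y y' : E2}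
    (hy : y ∈ T) (hy' : y' ∈ T) : P.wind y = P.wind y' :=
  hT.eq_of_exp_eq_one (fun _ hz => (continuousAt_wind (h hz)).continuousWithinAt)
    (fun _ hz => exp_wind (h hz)) hy hy'

theorem exists_far (P : SimplePolygon) :
    ∃ ρ : ℝ, 0 < ρ ∧ ∀ y : E2, ρ < ‖y‖ → y ∉ P.boundary ∧ P.wind y = 0 := by
  obtain ⟨ρ, hρ, hB⟩ := isCompact_boundary (P := P).isBounded.exists_pos_norm_le
  refine ⟨ρ, hρ, fun y hy => ⟨fun h => by linarith [hB y h], ?_⟩⟩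
  have key : ∀ k, 0 < (-y) 0 * (P.vtx k 0 - y 0) + (-y) 1 * (P.vtx k 1 - y 1) := by
    intro k
    have h1 := hB _ (vtx_mem_boundary k)
    have h2 : ‖P.vtx k‖ ^ 2 < ‖y‖ ^ 2 := by
      apply pow_lt_pow_left₀ (by linarith) (norm_nonneg _); norm_num
    rw [EuclideanSpace.real_norm_sq_eq, EuclideanSpace.real_norm_sq_eq] at h2
    simp [Fin.sum_univ_two] at h2 ⊢
    nlinarith [sq_nonneg (P.vtx k 0 - y 0), sq_nonneg (P.vtx k 1 - y 1)]
  rw [wind, Finset.sum_congr rfl fun k _ => subtend_of_halfPlane (key k) (key (k + 1)),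
    Finset.sum_sub_distrib, sub_eq_zero]
  exact Equiv.sum_comp (Equiv.addRight (1 : ZMod P.n)) fun k =>
    Complex.arg (toward (P.vtx k) y * ⟨(-y) 0, -(-y) 1⟩)

theorem wind_eq_zero_of_unbounded {T : Set E2} (hT : IsPreconnected T) (h : T ⊆ P.boundaryᶜ)
    (hb : ¬ Bornology.IsBounded T) {y : E2} (hy : y ∈ T) : P.wind y = 0 := by
  obtain ⟨ρ, -, hρ⟩ := exists_far P
  have : ∃ z ∈ T, ρ < ‖z‖ := by
    by_contra hc
    push Not at hc
    exact hb (isBounded_iff_forall_norm_le.2 ⟨ρ, hc⟩)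
  obtain ⟨z, hz, hzρ⟩ := this
  rw [wind_eq hT h hy hz, (hρ z hzρ).2]

theorem ne_endpoint_of_mem_openSegment {a b m : E2} (hab : a ≠ b) (hm : m ∈ openSegment ℝ a b) :
    m ≠ a ∧ m ≠ b := by
  constructor
  · rintro rfl
    exact hab (left_mem_openSegment_iff.1 hm)
  · rintro rfl
    exact hab (right_mem_openSegment_iff.1 hm)

theorem notMem_edge_of_mem_openSegment {k i : ZMod P.n} {m : E2}
    (hm : m ∈ openSegment ℝ (P.vtx k) (P.vtx (k + 1))) (hik : i ≠ k) : m ∉ P.edge i := by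
  intro hi
  have hne := ne_endpoint_of_mem_openSegment (vtx_ne_succ k) hm
  rcases eq_vtx_of_mem_edge hik hi (openSegment_subset_segment _ _ _ hm) with ⟨-, h⟩ | ⟨h1, h⟩
  · exact hne.1 h
  · rw [h1] at h; exact hne.2 h

/-- The winding number differs on the two sides of an edge. -/
theorem wind_jump {k : ZMod P.n} {m : E2} (hm : m ∈ openSegment ℝ (P.vtx k) (P.vtx (k + 1))) :
    ∃ U ∈ 𝓝 m, ∀ y ∈ U, ∀ y' ∈ U, 0 < area 1 (P.vtx (k + 1) - P.vtx k) (y - P.vtx k) →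
      area 1 (P.vtx (k + 1) - P.vtx k) (y' - P.vtx k) < 0 → P.wind y ≠ P.wind y' := by
  set rest : E2 → ℝ := fun y =>
    ∑ i ∈ Finset.univ.erase k, subtend (P.vtx i) (P.vtx (i + 1)) y with hrest
  have hsum : ∀ y, P.wind y = subtend (P.vtx k) (P.vtx (k + 1)) y + rest y := fun y =>
    (Finset.add_sum_erase _ _ (Finset.mem_univ k)).symm
  have hcont : ContinuousAt rest m := by
    apply tendsto_finsetSum
    intro i hi
    exact continuousAt_subtend (notMem_edge_of_mem_openSegment hm (Finset.ne_of_mem_erase hi))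
  have h1 := subtend_jump hm (vtx_ne_succ k) one_pos
  have h2 := hcont.eventually (Metric.ball_mem_nhds _ one_pos)
  refine ⟨_, h1.and h2, ?_⟩
  rintro y ⟨y1, y2⟩ y' ⟨y1', y2'⟩ hy hy' heq
  have a1 := y1.1 hy
  have a2 := y1'.2 hy'
  rw [Real.dist_eq, abs_lt] at y2 y2'
  rw [abs_lt] at a1 a2
  rw [hsum, hsum] at heq
  linarith [Real.pi_gt_three]

end SimplePolygon

theorem segment_eq_union {p q b : E2} (hb : b ∈ segment ℝ p q) :
    segment ℝ p q = segment ℝ p b ∪ segment ℝ b q := by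
  apply Subset.antisymm
  · intro z hz
    rcases eq_or_ne z b with rfl | hzb
    · exact Or.inl (right_mem_segment ℝ _ _)
    rw [segment_eq_image'] at hz hb
    obtain ⟨s, ⟨s0, s1⟩, rfl⟩ := hz
    obtain ⟨t, ⟨t0, t1⟩, rfl⟩ := hb
    simp only at hzb ⊢
    have hst : s ≠ t := by rintro rfl; exact hzb rfl
    rcases lt_or_gt_of_ne hst with h | h
    · left
      rw [segment_eq_image']
      have tp : 0 < t := by linarith
      refine ⟨s / t, ⟨by positivity, div_le_one_of_le₀ h.le t0⟩, ?_⟩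
      simp only [add_sub_cancel_left, smul_smul, div_mul_cancel₀ _ tp.ne']
    · right
      rw [segment_eq_image']
      have tp : 0 < 1 - t := by linarith
      refine ⟨(s - t) / (1 - t), ⟨div_nonneg (by linarith) tp.le,
        div_le_one_of_le₀ (by linarith) tp.le⟩, ?_⟩
      have e2 : q - (p + t • (q - p)) = (1 - t) • (q - p) := by
        rw [sub_smul, one_smul]; abel
      simp only [e2, smul_smul, div_mul_cancel₀ _ tp.ne']
      rw [sub_smul]; abel
  · exact union_subset
      ((convex_segment _ _).segment_subset (left_mem_segment ℝ _ _) hb)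
      ((convex_segment _ _).segment_subset hb (right_mem_segment ℝ _ _))

/-! ### Sectors -/

/-- Two vectors, on distinct rays from the origin, spanning a sector of angle at most `π`
for the orientation `σ`. -/
structure Corner (σ : ℝ) (a b : E2) : Prop where
  orient : σ ≠ 0
  left_ne : a ≠ 0
  right_ne : b ≠ 0
  not_ray : ∀ k : ℝ, 0 < k → b ≠ k • a
  nonneg : 0 ≤ area σ a b

/-- The open sector at `z` between `a` and `b`. -/
def sector (σ : ℝ) (z a b : E2) : Set E2 := {y | 0 < area σ (y - z) b ∧ 0 < area σ a (y - z)}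

/-- The open complementary sector at `z`. -/
def cosector (σ : ℝ) (z a b : E2) : Set E2 := {y | area σ (y - z) b < 0 ∨ area σ a (y - z) < 0}

theorem convex_sector (σ : ℝ) (z a b : E2) : Convex ℝ (sector σ z a b) :=
  (convex_area_left_pos b z).inter (convex_area_right_pos a z)

namespace Corner

variable {σ : ℝ} {a b : E2}

theorem opposite (h : Corner σ a b) (h0 : area σ a b = 0) : ∃ k : ℝ, 0 < k ∧ b = -(k • a) := by
  obtain ⟨k, hk⟩ := exists_smul_of_area_eq_zero h.orient h.left_ne h0
  have hk0 : k ≠ 0 := by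
    rintro rfl
    exact h.right_ne (by simpa using hk)
  have : ¬ 0 < k := fun hp => h.not_ray k hp hk
  refine ⟨-k, by have := lt_of_le_of_ne (not_lt.1 this) hk0; linarith, by rw [hk]; simp⟩

theorem exists_dir (h : Corner σ a b) : ∃ w : E2, 0 < area σ w b ∧ 0 < area σ a w := by
  rcases h.nonneg.lt_or_eq with hc | hc
  · refine ⟨a + b, ?_, ?_⟩
    · rw [area_add_left, area_self]; linarith
    · rw [area_add_right, area_self]; linarith
  · obtain ⟨k, hk, rfl⟩ := h.opposite hc.symm
    have hw : ∃ w : E2, 0 < area σ a w := by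
      refine ⟨σ • !₂[-a 1, a 0], ?_⟩
      have h1 := coord_ne_zero h.left_ne
      have h2 : 0 < σ ^ 2 := by have := h.orient; positivity
      have : area σ a (σ • !₂[-a 1, a 0]) = σ ^ 2 * (a 0 ^ 2 + a 1 ^ 2) := by
        simp [area]; ring
      rw [this]; positivity
    obtain ⟨w, hw⟩ := hw
    refine ⟨w, ?_, hw⟩
    rw [area_neg_right, area_smul_right, area_swap]
    have := mul_pos hk hw
    linarith

theorem notMem_iff (h : Corner σ a b) (z y : E2) :
    (y ∉ sector σ z a b ∧ y ∉ cosector σ z a b) ↔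
      ((∃ t : ℝ, 0 ≤ t ∧ y = z + t • a) ∨ ∃ t : ℝ, 0 ≤ t ∧ y = z + t • b) := by
  constructor
  · rintro ⟨h1, h2⟩
    simp only [sector, cosector, Set.mem_ofPred_eq, not_and_or, not_or, not_lt] at h1 h2
    obtain ⟨h2, h3⟩ := h2
    rcases h.nonneg.lt_or_eq with hc | hc
    · have hd := area_decomp hc.ne' (y - z)
      rcases h1 with h1 | h1
      · right
        have e : area σ (y - z) b = 0 := le_antisymm h1 h2
        refine ⟨area σ a (y - z) / area σ a b, by positivity, ?_⟩
        rw [e, zero_div, zero_smul, zero_add] at hd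
        rw [← hd]; abel
      · left
        have e : area σ a (y - z) = 0 := le_antisymm h1 h3
        refine ⟨area σ (y - z) b / area σ a b, by positivity, ?_⟩
        rw [e, zero_div, zero_smul, add_zero] at hd
        rw [← hd]; abel
    · obtain ⟨k, hk, rfl⟩ := h.opposite hc.symm
      rw [area_neg_right, area_smul_right, area_swap] at h1
      have e : area σ a (y - z) = 0 := by
        rcases h1 with h1 | h1
        · nlinarith
        · linarith
      obtain ⟨t, ht⟩ := exists_smul_of_area_eq_zero h.orient h.left_ne e
      rcases le_total 0 t with h0 | h0
      · left; exact ⟨t, h0, by rw [← ht]; abel⟩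
      · right
        refine ⟨-t / k, div_nonneg (by linarith) hk.le, ?_⟩
        rw [smul_neg, smul_smul, div_mul_cancel₀ _ hk.ne', neg_smul, neg_neg, ← ht]; abel
  · rintro (⟨t, ht, rfl⟩ | ⟨t, ht, rfl⟩)
    · have := mul_nonneg ht h.nonneg
      simp only [sector, cosector, Set.mem_ofPred_eq, add_sub_cancel_left, area_smul_left,
        area_smul_right, area_self, mul_zero, lt_self_iff_false, and_false, or_false]
      exact ⟨fun h => h, by linarith⟩
    · have := mul_nonneg ht h.nonneg
      simp only [sector, cosector, Set.mem_ofPred_eq, add_sub_cancel_left, area_smul_left,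
        area_smul_right, area_self, mul_zero, lt_self_iff_false, false_and, false_or]
      exact ⟨fun h => h, by linarith⟩

theorem add_mem_sector {z y w : E2} (h1 : y ∉ cosector σ z a b)
    (hw1 : 0 < area σ w b) (hw2 : 0 < area σ a w) {ε : ℝ} (hε : 0 < ε) :
    y + ε • w ∈ sector σ z a b := by
  simp only [cosector, sector, Set.mem_ofPred_eq, not_or, not_lt] at h1 ⊢
  have e : y + ε • w - z = (y - z) + ε • w := by abel
  rw [e, area_add_left, area_add_right, area_smul_left, area_smul_right]
  have := mul_pos hε hw1
  have := mul_pos hε hw2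
  constructor <;> linarith

theorem sub_mem_cosector {z y w : E2} (h1 : y ∉ sector σ z a b)
    (hw1 : 0 < area σ w b) (hw2 : 0 < area σ a w) {ε : ℝ} (hε : 0 < ε) :
    y - ε • w ∈ cosector σ z a b := by
  simp only [cosector, sector, Set.mem_ofPred_eq, not_and_or, not_lt] at h1 ⊢
  have e : y - ε • w - z = (y - z) - ε • w := by abel
  rw [e, area_sub_left, area_sub_right, area_smul_left, area_smul_right]
  have := mul_pos hε hw1
  have := mul_pos hε hw2
  rcases h1 with h1 | h1
  · left; linarith
  · right; linarith

theorem self_notMem_sector (z : E2) : z ∉ sector σ z a b := by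
  simp [sector, area]

theorem self_notMem_cosector (z : E2) : z ∉ cosector σ z a b := by
  simp [cosector, area]

theorem tendsto_line (y w : E2) : Tendsto (fun ε : ℝ => y + ε • w) (𝓝[>] 0) (𝓝 y) := by
  have : Continuous fun ε : ℝ => y + ε • w := by fun_prop
  have h := this.tendsto 0
  simp only [zero_smul, add_zero] at h
  exact h.mono_left nhdsWithin_le_nhds

theorem isPreconnected_cosector_inter (h : Corner σ a b) {z : E2} {r : ℝ} (hr : 0 < r) :
    IsPreconnected (cosector σ z a b ∩ Metric.ball z r) := by
  obtain ⟨w, hw1, hw2⟩ := h.exists_dir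
  have e : cosector σ z a b ∩ Metric.ball z r =
      ({y | area σ (y - z) b < 0} ∩ Metric.ball z r) ∪
        ({y | area σ a (y - z) < 0} ∩ Metric.ball z r) := by
    rw [← union_inter_distrib_right]; rfl
  have ht := tendsto_line z (-w)
  have hev : ∀ᶠ ε : ℝ in 𝓝[>] 0, 0 < ε ∧ z + ε • (-w) ∈ Metric.ball z r :=
    (eventually_mem_nhdsWithin).and (ht.eventually (Metric.ball_mem_nhds z hr))
  obtain ⟨ε, hε, hb⟩ := hev.exists
  rw [e]
  refine IsPreconnected.union (z + ε • (-w)) ⟨?_, hb⟩ ⟨?_, hb⟩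
    ((convex_area_left_neg b z).inter (convex_ball z r)).isPreconnected
    ((convex_area_right_neg a z).inter (convex_ball z r)).isPreconnected
  · have := mul_pos hε hw1
    simp only [Set.mem_ofPred_eq, add_sub_cancel_left, area_smul_left, area_neg_left]
    linarith
  · have := mul_pos hε hw2
    simp only [Set.mem_ofPred_eq, add_sub_cancel_left, area_smul_right, area_neg_right]
    linarith

theorem isPreconnected_sector_inter {z : E2} (r : ℝ) :
    IsPreconnected (sector σ z a b ∩ Metric.ball z r) :=
  ((convex_sector σ z a b).inter (convex_ball z r)).isPreconnected

theorem mem_closure_sector_inter (h : Corner σ a b) {z y : E2} {r : ℝ} (hy : y ∈ Metric.ball z r)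
    (h1 : y ∉ cosector σ z a b) :
    y ∈ closure (sector σ z a b ∩ Metric.ball z r) := by
  obtain ⟨w, hw1, hw2⟩ := h.exists_dir
  refine mem_closure_of_tendsto (tendsto_line y w) ?_
  filter_upwards [self_mem_nhdsWithin,
    (tendsto_line y w).eventually (Metric.isOpen_ball.mem_nhds hy)] with ε hε hb
  exact ⟨add_mem_sector h1 hw1 hw2 hε, hb⟩

theorem mem_closure_cosector_inter (h : Corner σ a b) {z y : E2} {r : ℝ}
    (hy : y ∈ Metric.ball z r) (h1 : y ∉ sector σ z a b) :
    y ∈ closure (cosector σ z a b ∩ Metric.ball z r) := by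
  obtain ⟨w, hw1, hw2⟩ := h.exists_dir
  refine mem_closure_of_tendsto (tendsto_line y (-w)) ?_
  filter_upwards [self_mem_nhdsWithin,
    (tendsto_line y (-w)).eventually (Metric.isOpen_ball.mem_nhds hy)] with ε hε hb
  refine ⟨?_, hb⟩
  rw [smul_neg, ← sub_eq_add_neg]
  exact sub_mem_cosector h1 hw1 hw2 hε

end Corner

namespace SimplePolygon

variable {P : SimplePolygon}

/-! ### Local structure of the boundary -/

/-- Near `z` the boundary consists of the two segments from `z` to `z + a` and to `z + b`, and
the winding number jumps across each of them. -/
structure Arms (P : SimplePolygon) (z a b : E2) : Prop where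
  left_ne : a ≠ 0
  right_ne : b ≠ 0
  not_ray : ∀ k : ℝ, 0 < k → b ≠ k • a
  near : ∀ᶠ y in 𝓝 z, y ∈ P.boundary ↔ y ∈ segment ℝ z (z + a) ∨ y ∈ segment ℝ z (z + b)
  jump_left : ∀ ε ∈ Ioo (0 : ℝ) 1, ∃ U ∈ 𝓝 (z + ε • a), ∀ y ∈ U, ∀ y' ∈ U,
    0 < area 1 a (y - z) → area 1 a (y' - z) < 0 → P.wind y ≠ P.wind y'
  jump_right : ∀ ε ∈ Ioo (0 : ℝ) 1, ∃ U ∈ 𝓝 (z + ε • b), ∀ y ∈ U, ∀ y' ∈ U,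
    0 < area 1 b (y - z) → area 1 b (y' - z) < 0 → P.wind y ≠ P.wind y'

theorem Arms.swap {z a b : E2} (h : P.Arms z a b) : P.Arms z b a where
  left_ne := h.right_ne
  right_ne := h.left_ne
  not_ray k hk he := by
    apply h.not_ray k⁻¹ (inv_pos.2 hk)
    rw [he, smul_smul, inv_mul_cancel₀ hk.ne', one_smul]
  near := by
    filter_upwards [h.near] with y hy
    rw [hy, or_comm]
  jump_left := h.jump_right
  jump_right := h.jump_left

theorem Arms.corner {z a b : E2} (h : P.Arms z a b) {σ : ℝ} (hσ : σ ≠ 0) (h0 : 0 ≤ area σ a b) :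
    Corner σ a b := ⟨hσ, h.left_ne, h.right_ne, h.not_ray, h0⟩

theorem eventually_notMem_edges {z : E2} {s : Set (ZMod P.n)} (h : ∀ k ∈ s, z ∉ P.edge k) :
    ∀ᶠ y in 𝓝 z, ∀ k ∈ s, y ∉ P.edge k := by
  have : ∀ k : ZMod P.n, ∀ᶠ y in 𝓝 z, k ∈ s → y ∉ P.edge k := by
    intro k
    by_cases hk : k ∈ s
    · filter_upwards [(isClosed_edge k).isOpen_compl.mem_nhds (h k hk)] with y hy _
      exact hy
    · exact Eventually.of_forall fun y hy => absurd hy hk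
  have h2 := eventually_all.2 this
  filter_upwards [h2] with y hy k hk using hy k hk

theorem jump_of_edge {k : ZMod P.n} {z a : E2} (hz : z ∈ P.edge k) (ha : a ≠ 0)
    (he : z + a = P.vtx k ∨ z + a = P.vtx (k + 1)) :
    ∀ ε ∈ Ioo (0 : ℝ) 1, ∃ U ∈ 𝓝 (z + ε • a), ∀ y ∈ U, ∀ y' ∈ U,
      0 < area 1 a (y - z) → area 1 a (y' - z) < 0 → P.wind y ≠ P.wind y' := by
  intro ε hε
  rw [edge, segment_eq_image'] at hz
  obtain ⟨t, ⟨ht0, ht1⟩, rfl⟩ := hz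
  simp only at he ha ⊢
  set d := P.vtx (k + 1) - P.vtx k with hd
  have hs : ∃ s : ℝ, a = s • d ∧ 0 < t + ε * s ∧ t + ε * s < 1 := by
    rcases he with he | he
    · have e : a = (-t) • d := by
        rw [add_assoc, add_eq_left] at he
        rw [neg_smul]; exact eq_neg_of_add_eq_zero_right he
      have : t ≠ 0 := by rintro rfl; simp at e; exact ha e
      have : 0 < t := lt_of_le_of_ne ht0 this.symm
      refine ⟨-t, e, ?_, ?_⟩ <;> nlinarith [hε.1, hε.2]
    · have e : a = (1 - t) • d := by
        have h1 : t • d + a = d := by rw [hd, eq_sub_iff_add_eq, add_comm, ← add_assoc, he]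
        rw [sub_smul, one_smul]; exact eq_sub_of_add_eq' h1
      have : t ≠ 1 := by rintro rfl; simp at e; exact ha e
      have : t < 1 := lt_of_le_of_ne ht1 this
      refine ⟨1 - t, e, ?_, ?_⟩ <;> nlinarith [hε.1, hε.2]
  obtain ⟨s, rfl, h0, h1⟩ := hs
  have hm : P.vtx k + t • d + ε • s • d ∈ openSegment ℝ (P.vtx k) (P.vtx (k + 1)) := by
    rw [openSegment_eq_image']
    refine ⟨t + ε * s, ⟨h0, h1⟩, ?_⟩
    simp only [add_smul, mul_smul, ← hd]; abel
  obtain ⟨U, hU, hj⟩ := wind_jump hm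
  have hs0 : s ≠ 0 := by rintro rfl; simp at ha
  have key : ∀ y, area 1 (s • d) (y - (P.vtx k + t • d)) = s * area 1 d (y - P.vtx k) := by
    intro y
    have e : y - (P.vtx k + t • d) = (y - P.vtx k) - t • d := by abel
    rw [e, area_smul_left, area_sub_right, area_smul_right, area_self]; ring
  refine ⟨U, hU, fun y hy y' hy' h1 h2 => ?_⟩
  rw [key] at h1 h2
  rcases lt_or_gt_of_ne hs0 with hs | hs
  · exact (hj y' hy' y hy (by nlinarith) (by nlinarith)).symm
  · exact hj y hy y' hy' (by nlinarith) (by nlinarith)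

theorem arms_vtx (i : ZMod P.n) :
    P.Arms (P.vtx i) (P.vtx (i + 1) - P.vtx i) (P.vtx (i - 1) - P.vtx i) := by
  have hi : i - 1 + 1 = i := by ring
  have hne : P.vtx (i - 1) ≠ P.vtx i := by have := vtx_ne_succ (i - 1); rwa [hi] at this
  have hz : P.vtx i ∈ P.edge (i - 1) := by have := vtx_succ_mem_edge (i - 1); rwa [hi] at this
  have ea : P.vtx i + (P.vtx (i + 1) - P.vtx i) = P.vtx (i + 1) := by abel
  have eb : P.vtx i + (P.vtx (i - 1) - P.vtx i) = P.vtx (i - 1) := by abel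
  have ha : P.vtx (i + 1) - P.vtx i ≠ 0 := sub_ne_zero.2 (vtx_ne_succ i).symm
  have hb : P.vtx (i - 1) - P.vtx i ≠ 0 := sub_ne_zero.2 hne
  refine ⟨ha, hb, ?_, ?_, jump_of_edge (vtx_mem_edge i) ha (Or.inr ea),
    jump_of_edge hz hb (Or.inl eb)⟩
  · intro k hk he
    have hadj := P.adj_edges (i - 1)
    have e2 : i - 1 + 2 = i + 1 := by ring
    rw [hi, e2] at hadj
    set s := min 1 k
    have hs : 0 < s := lt_min one_pos hk
    have hmem : P.vtx i + s • (P.vtx (i + 1) - P.vtx i) ∈ ({P.vtx i} : Set E2) := by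
      rw [← hadj]
      constructor
      · rw [segment_symm, segment_eq_image']
        refine ⟨s / k, ⟨by positivity, div_le_one_of_le₀ (min_le_right _ _) hk.le⟩, ?_⟩
        simp only [he, smul_smul, div_mul_cancel₀ _ hk.ne']
      · rw [segment_eq_image']
        exact ⟨s, ⟨hs.le, min_le_left _ _⟩, rfl⟩
    simp only [mem_singleton_iff, add_eq_left, smul_eq_zero, hs.ne', false_or] at hmem
    exact ha hmem
  · have h1 : ∀ k ∈ ({i, i - 1}ᶜ : Set (ZMod P.n)), P.vtx i ∉ P.edge k := by
      intro k hk h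
      simp only [mem_compl_iff, mem_insert_iff, mem_singleton_iff, not_or] at hk
      rcases eq_vtx_of_mem_edge (Ne.symm hk.1) (vtx_mem_edge i) h with ⟨h2, h3⟩ | ⟨h2, -⟩
      · exact hk.1 (P.inj h3.symm)
      · exact hk.2 (by rw [h2]; ring)
    filter_upwards [eventually_notMem_edges h1] with y hy
    rw [mem_boundary, ea, eb]
    constructor
    · rintro ⟨k, hk⟩
      by_cases h2 : k = i
      · left; rw [h2] at hk; exact hk
      · by_cases h3 : k = i - 1
        · right; rw [h3, edge, hi] at hk; rwa [segment_symm]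
        · exact absurd hk (hy k (by simp [h2, h3]))
    · rintro (h | h)
      · exact ⟨i, h⟩
      · refine ⟨i - 1, ?_⟩
        rw [edge, hi, segment_symm]; exact h

theorem arms_edge {k : ZMod P.n} {z : E2} (hz : z ∈ openSegment ℝ (P.vtx k) (P.vtx (k + 1))) :
    P.Arms z (P.vtx (k + 1) - z) (P.vtx k - z) := by
  have hne := ne_endpoint_of_mem_openSegment (vtx_ne_succ k) hz
  have hzk : z ∈ P.edge k := openSegment_subset_segment _ _ _ hz
  have ea : z + (P.vtx (k + 1) - z) = P.vtx (k + 1) := by abel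
  have eb : z + (P.vtx k - z) = P.vtx k := by abel
  have ha : P.vtx (k + 1) - z ≠ 0 := sub_ne_zero.2 hne.2.symm
  have hb : P.vtx k - z ≠ 0 := sub_ne_zero.2 hne.1.symm
  refine ⟨ha, hb, ?_, ?_, jump_of_edge hzk ha (Or.inr ea), jump_of_edge hzk hb (Or.inl eb)⟩
  · intro c hc he
    rw [openSegment_eq_image'] at hz
    obtain ⟨t, ⟨h0, h1⟩, rfl⟩ := hz
    simp only at he hb
    have : (t + c * (1 - t)) • (P.vtx (k + 1) - P.vtx k) = 0 := by
      have e1 : P.vtx k - (P.vtx k + t • (P.vtx (k + 1) - P.vtx k)) =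
        -(t • (P.vtx (k + 1) - P.vtx k)) := by abel
      have e2 : P.vtx (k + 1) - (P.vtx k + t • (P.vtx (k + 1) - P.vtx k)) =
        (1 - t) • (P.vtx (k + 1) - P.vtx k) := by rw [sub_smul, one_smul]; abel
      rw [e1, e2] at he
      rw [add_smul, mul_smul, ← he]; abel
    have h2 : 0 < t + c * (1 - t) := by nlinarith
    rcases smul_eq_zero.1 this with h | h
    · exact h2.ne' h
    · exact vtx_ne_succ k (sub_eq_zero.1 h).symm
  · have h1 : ∀ j ∈ ({k}ᶜ : Set (ZMod P.n)), z ∉ P.edge j := fun j hj =>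
      notMem_edge_of_mem_openSegment hz hj
    filter_upwards [eventually_notMem_edges h1] with y hy
    have hu : y ∈ P.edge k ↔ y ∈ segment ℝ z (P.vtx (k + 1)) ∨ y ∈ segment ℝ z (P.vtx k) := by
      have hc := segment_eq_union hzk
      rw [edge, hc, mem_union, segment_symm ℝ (P.vtx k) z, or_comm]
    rw [mem_boundary, ea, eb, ← hu]
    constructor
    · rintro ⟨j, hj⟩
      by_cases h2 : j = k
      · rwa [h2] at hj
      · exact absurd hj (hy j h2)
    · exact fun h => ⟨k, h⟩

theorem exists_arms {z : E2} (hz : z ∈ P.boundary) (σ : ℝ) :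
    ∃ a b, P.Arms z a b ∧ 0 ≤ area σ a b := by
  have h : ∃ a b, P.Arms z a b := by
    obtain ⟨k, hk⟩ := mem_boundary.1 hz
    by_cases h1 : z = P.vtx k
    · subst h1; exact ⟨_, _, arms_vtx k⟩
    by_cases h2 : z = P.vtx (k + 1)
    · subst h2; exact ⟨_, _, arms_vtx (k + 1)⟩
    exact ⟨_, _, arms_edge (mem_openSegment_of_ne_left_right (Ne.symm h1) (Ne.symm h2) hk)⟩
  obtain ⟨a, b, h⟩ := h
  rcases le_total 0 (area σ a b) with h0 | h0
  · exact ⟨a, b, h, h0⟩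
  · exact ⟨b, a, h.swap, by rw [area_swap]; linarith⟩

theorem mem_segment_of_ray {z a : E2} {t : ℝ} (ht : 0 ≤ t) (hd : dist (z + t • a) z < ‖a‖) :
    z + t • a ∈ segment ℝ z (z + a) := by
  rw [dist_eq_norm, add_sub_cancel_left, norm_smul, Real.norm_of_nonneg ht] at hd
  rw [segment_eq_image']
  refine ⟨t, ⟨ht, ?_⟩, by simp⟩
  by_contra h
  push Not at h
  nlinarith [norm_nonneg a]

/-- Near a boundary point, the boundary is exactly what the two open sectors leave out. -/
theorem Arms.mem_boundary_iff {z a b : E2} (h : P.Arms z a b) {σ : ℝ} (hc : Corner σ a b) :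
    ∃ r > 0, ∀ y ∈ Metric.ball z r,
      (y ∈ P.boundary ↔ y ∉ sector σ z a b ∧ y ∉ cosector σ z a b) := by
  obtain ⟨r, hr, hn⟩ := Metric.eventually_nhds_iff_ball.1 h.near
  refine ⟨min r (min ‖a‖ ‖b‖), lt_min hr
    (lt_min (norm_pos_iff.2 h.left_ne) (norm_pos_iff.2 h.right_ne)), fun y hy => ?_⟩
  rw [Metric.mem_ball, lt_min_iff, lt_min_iff] at hy
  rw [hn y hy.1, hc.notMem_iff]
  constructor
  · rintro (h | h) <;> rw [segment_eq_image'] at h <;> obtain ⟨t, ht, rfl⟩ := h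
    · left; exact ⟨t, ht.1, by simp⟩
    · right; exact ⟨t, ht.1, by simp⟩
  · rintro (⟨t, ht, rfl⟩ | ⟨t, ht, rfl⟩)
    · left; exact mem_segment_of_ray ht hy.2.1
    · right; exact mem_segment_of_ray ht hy.2.2

end SimplePolygon

/-- A preconnected set on which membership in `A` is locally constant lies in `A` or avoids it. -/
theorem IsPreconnected.subset_or_disjoint_of_locally_const {X : Type*} [TopologicalSpace X]
    {T A : Set X} (hT : IsPreconnected T) (h : ∀ z ∈ T, ∀ᶠ y in 𝓝 z, y ∈ T → (y ∈ A ↔ z ∈ A)) :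
    T ⊆ A ∨ Disjoint T A := by
  classical
  have hc : ContinuousOn (fun z => decide (z ∈ A)) T := by
    intro z hz
    have : (fun z => decide (z ∈ A)) =ᶠ[𝓝[T] z] fun _ => decide (z ∈ A) := by
      filter_upwards [mem_nhdsWithin_of_mem_nhds (h z hz), self_mem_nhdsWithin] with y hy hyT
      simp [hy hyT]
    exact (continuousWithinAt_const).congr_of_eventuallyEq this rfl
  by_cases hne : ∃ z ∈ T, z ∈ A
  · left
    obtain ⟨z, hz, hzA⟩ := hne
    intro y hy
    have := hT.constant hc hy hz
    simpa [hzA] using this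
  · right
    rw [Set.disjoint_left]
    exact fun z hz hzA => hne ⟨z, hz, hzA⟩

namespace SimplePolygon

variable {P : SimplePolygon}

/-! ### The inside of the polygon -/

variable (P) in
/-- The region without its boundary. -/
def inner : Set E2 := P.region \ P.boundary

theorem subset_component {T : Set E2} (hT : IsPreconnected T) (h : T ⊆ P.boundaryᶜ) {y y0 : E2}
    (hy : y ∈ T) (hy0 : y ∈ connectedComponentIn P.boundaryᶜ y0) :
    T ⊆ connectedComponentIn P.boundaryᶜ y0 := by
  rw [connectedComponentIn_eq hy0]
  exact hT.subset_connectedComponentIn hy h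

theorem component_contains_sector {z a b y0 : E2} {σ r : ℝ} (hc : Corner σ a b) (hr : 0 < r)
    (hb : ∀ y ∈ Metric.ball z r,
      (y ∈ P.boundary ↔ y ∉ sector σ z a b ∧ y ∉ cosector σ z a b))
    (hz : z ∈ closure (connectedComponentIn P.boundaryᶜ y0)) :
    sector σ z a b ∩ Metric.ball z r ⊆ connectedComponentIn P.boundaryᶜ y0 ∨
      cosector σ z a b ∩ Metric.ball z r ⊆ connectedComponentIn P.boundaryᶜ y0 := by
  obtain ⟨y, hy, hyr⟩ := mem_closure_iff.1 hz _ Metric.isOpen_ball (Metric.mem_ball_self hr)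
  have hyb : y ∉ P.boundary := connectedComponentIn_subset _ _ hyr
  rw [hb y hy, not_and_or, not_not, not_not] at hyb
  rcases hyb with h | h
  · left
    exact subset_component (Corner.isPreconnected_sector_inter r)
      (fun x hx hxb => ((hb x hx.2).1 hxb).1 hx.1) ⟨h, hy⟩ hyr
  · right
    exact subset_component (hc.isPreconnected_cosector_inter hr)
      (fun x hx hxb => ((hb x hx.2).1 hxb).2 hx.1) ⟨h, hy⟩ hyr

/-- The last point of a closed set on a segment starting in that set. -/
theorem exists_last_mem {F : Set E2} (hF : IsClosed F) {x y : E2} (hx : x ∈ F) :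
    ∃ t ∈ Icc (0 : ℝ) 1, x + t • (y - x) ∈ F ∧
      ∀ s ∈ Icc (0 : ℝ) 1, t < s → x + s • (y - x) ∉ F := by
  have hcomp : IsCompact (Icc (0 : ℝ) 1 ∩ (fun t : ℝ => x + t • (y - x)) ⁻¹' F) :=
    isCompact_Icc.inter_right (hF.preimage (by fun_prop))
  obtain ⟨t, ht, hmax⟩ := hcomp.exists_isMaxOn ⟨0, by simp [hx]⟩ continuousOn_id
  refine ⟨t, ht.1, ht.2, fun s hs hts hsF => ?_⟩
  have := hmax ⟨hs, hsF⟩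
  simp at this
  linarith

theorem boundary_subset_closure {y0 : E2} (hy0 : y0 ∉ P.boundary) :
    P.boundary ⊆ closure (connectedComponentIn P.boundaryᶜ y0) := by
  set U := connectedComponentIn P.boundaryᶜ y0 with hU
  have hloc : ∀ z ∈ P.boundary, ∀ᶠ y in 𝓝 z, y ∈ P.boundary →
      (y ∈ closure U ↔ z ∈ closure U) := by
    intro z hz
    by_cases hzU : z ∈ closure U
    · obtain ⟨a, b, h, h0⟩ := exists_arms hz 1
      have hc := h.corner one_ne_zero h0
      obtain ⟨r, hr, hb⟩ := h.mem_boundary_iff hc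
      filter_upwards [Metric.ball_mem_nhds z hr] with y hy hyb
      refine iff_of_true ?_ hzU
      have hyn := (hb y hy).1 hyb
      rcases component_contains_sector hc hr hb hzU with h1 | h1
      · exact closure_mono h1 (hc.mem_closure_sector_inter hy hyn.2)
      · exact closure_mono h1 (hc.mem_closure_cosector_inter hy hyn.1)
    · filter_upwards [isClosed_closure.isOpen_compl.mem_nhds hzU] with y hy _
      exact iff_of_false hy hzU
  refine (isPreconnected_boundary.subset_or_disjoint_of_locally_const hloc).resolve_right ?_
  intro hd
  obtain ⟨t, ht, htb, hlast⟩ := exists_last_mem isClosed_boundary (y := y0)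
    (vtx_mem_boundary (P := P) 0)
  set x := P.vtx 0
  have ht1 : t < 1 := by
    refine lt_of_le_of_ne ht.2 ?_
    rintro rfl
    simp at htb; exact hy0 htb
  refine Set.disjoint_left.1 hd htb ?_
  have hsub : (fun s : ℝ => x + s • (y0 - x)) '' Ioc t 1 ⊆ U := by
    refine subset_component (y := y0) (isPreconnected_Ioc.image _ (by fun_prop)) ?_
      ⟨1, ⟨ht1, le_rfl⟩, by simp⟩ (mem_connectedComponentIn hy0)
    rintro _ ⟨s, hs, rfl⟩
    exact hlast s ⟨ht.1.trans hs.1.le, hs.2⟩ hs.1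
  have hcont : Continuous fun s : ℝ => x + s • (y0 - x) := by fun_prop
  have hmem : t ∈ closure (Ioc t 1) := by
    rw [closure_Ioc ht1.ne]; exact ⟨le_rfl, ht1.le⟩
  exact closure_mono hsub (image_closure_subset_closure_image hcont ⟨t, hmem, rfl⟩)

theorem wind_ne_of_sector {z a b : E2} {σ r : ℝ} (h : P.Arms z a b) (hc : Corner σ a b)
    (hr : 0 < r)
    (hb : ∀ y ∈ Metric.ball z r,
      (y ∈ P.boundary ↔ y ∉ sector σ z a b ∧ y ∉ cosector σ z a b)) {y y' : E2}
    (hy : y ∈ sector σ z a b ∩ Metric.ball z r) (hy' : y' ∈ cosector σ z a b ∩ Metric.ball z r) :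
    P.wind y ≠ P.wind y' := by
  obtain ⟨w, hw1, hw2⟩ := hc.exists_dir
  have hev : ∀ᶠ ε : ℝ in 𝓝[>] 0, (0 < ε ∧ ε < 1) ∧ z + ε • a ∈ Metric.ball z r :=
    (show ∀ᶠ ε : ℝ in 𝓝[>] 0, 0 < ε ∧ ε < 1 from Ioo_mem_nhdsGT one_pos).and
      ((Corner.tendsto_line z a).eventually (Metric.ball_mem_nhds z hr))
  obtain ⟨ε, hε, hεr⟩ := hev.exists
  obtain ⟨U, hU, hj⟩ := h.jump_left ε hε
  have hmn := (hc.notMem_iff z (z + ε • a)).2 (Or.inl ⟨ε, hε.1.le, rfl⟩)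
  set m := z + ε • a with hm
  have hnhds : U ∩ Metric.ball z r ∈ 𝓝 m := inter_mem hU (Metric.isOpen_ball.mem_nhds hεr)
  have hev2 : ∀ᶠ s : ℝ in 𝓝[>] 0, 0 < s ∧ m + s • w ∈ U ∩ Metric.ball z r ∧
      m + s • (-w) ∈ U ∩ Metric.ball z r :=
    (eventually_mem_nhdsWithin).and
      (((Corner.tendsto_line m w).eventually hnhds).and
        ((Corner.tendsto_line m (-w)).eventually hnhds))
  obtain ⟨s, hs, hs1, hs2⟩ := hev2.exists
  have e1 : m + s • w ∈ sector σ z a b := Corner.add_mem_sector hmn.2 hw1 hw2 hs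
  have e2 : m + s • (-w) ∈ cosector σ z a b := by
    rw [smul_neg, ← sub_eq_add_neg]; exact Corner.sub_mem_cosector hmn.1 hw1 hw2 hs
  have c1 : P.wind y = P.wind (m + s • w) :=
    wind_eq (Corner.isPreconnected_sector_inter r)
      (fun x hx hxb => ((hb x hx.2).1 hxb).1 hx.1) hy ⟨e1, hs1.2⟩
  have c2 : P.wind y' = P.wind (m + s • (-w)) :=
    wind_eq (hc.isPreconnected_cosector_inter hr)
      (fun x hx hxb => ((hb x hx.2).1 hxb).2 hx.1) hy' ⟨e2, hs2.2⟩
  rw [c1, c2]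
  have hσ : ∀ x : E2, area σ a x = σ * area 1 a x := by intro x; simp [area]
  have a1 : area 1 a (m + s • w - z) = s * area 1 a w := by
    have : m + s • w - z = ε • a + s • w := by rw [hm]; abel
    rw [this, area_add_right, area_smul_right, area_smul_right, area_self]; ring
  have a2 : area 1 a (m + s • (-w) - z) = -(s * area 1 a w) := by
    have : m + s • (-w) - z = ε • a - s • w := by rw [hm, smul_neg]; abel
    rw [this, area_sub_right, area_smul_right, area_smul_right, area_self]; ring
  rw [hσ] at hw2
  rcases lt_or_gt_of_ne hc.orient with h1 | h1
  · have : area 1 a w < 0 := by nlinarith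
    refine (hj _ hs2.1 _ hs1.1 ?_ ?_).symm
    · rw [a2]; nlinarith
    · rw [a1]; nlinarith
  · have : 0 < area 1 a w := by nlinarith
    refine hj _ hs1.1 _ hs2.1 ?_ ?_
    · rw [a1]; nlinarith
    · rw [a2]; nlinarith

theorem exists_unbounded (P : SimplePolygon) : ∃ y : E2, y ∉ P.boundary ∧
    ¬ Bornology.IsBounded (connectedComponentIn P.boundaryᶜ y) := by
  obtain ⟨ρ, hρ, h⟩ := exists_far P
  set y : E2 := (ρ + 1) • EuclideanSpace.single 0 1 with hy
  have hn : ∀ s : ℝ, 1 ≤ s → ‖s • y‖ = s * (ρ + 1) := by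
    intro s hs
    rw [norm_smul, hy, norm_smul, Real.norm_of_nonneg (by linarith),
      Real.norm_of_nonneg (by linarith)]
    simp
  have hfar : ∀ s : ℝ, 1 ≤ s → s • y ∉ P.boundary := by
    intro s hs
    refine (h _ ?_).1
    rw [hn s hs]; nlinarith
  refine ⟨y, by simpa using hfar 1 le_rfl, fun hb => ?_⟩
  have hsub : (fun s : ℝ => s • y) '' Ici 1 ⊆ connectedComponentIn P.boundaryᶜ y := by
    apply IsPreconnected.subset_connectedComponentIn
    · exact isPreconnected_Ici.image _ (by fun_prop)
    · exact ⟨1, by simp, by simp⟩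
    · rintro _ ⟨s, hs, rfl⟩; exact hfar s hs
  obtain ⟨M, hM⟩ := isBounded_iff_forall_norm_le.1 (hb.subset hsub)
  have h1 := hM _ ⟨|M| + 1, by simp, rfl⟩
  simp only at h1
  rw [hn _ (by simp)] at h1
  nlinarith [le_abs_self M, abs_nonneg M]

theorem mem_region_iff {y : E2} (hy : y ∉ P.boundary) :
    y ∈ P.region ↔ Bornology.IsBounded (connectedComponentIn P.boundaryᶜ y) := by
  simp [region, hy]

/-- At a boundary point, one of the two sectors is inside and the other one outside. -/
theorem Arms.components {z a b : E2} (h : P.Arms z a b) {σ : ℝ} (hc : Corner σ a b) :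
    ∃ r > 0, (∀ y ∈ Metric.ball z r,
      (y ∈ P.boundary ↔ y ∉ sector σ z a b ∧ y ∉ cosector σ z a b)) ∧
      ((∀ y0 ∉ P.boundary, (y0 ∈ P.region ↔ P.wind y0 ≠ 0) ∧
          (y0 ∈ P.region → sector σ z a b ∩ Metric.ball z r ⊆ connectedComponentIn P.boundaryᶜ y0) ∧
          (y0 ∉ P.region → cosector σ z a b ∩ Metric.ball z r ⊆ connectedComponentIn P.boundaryᶜ y0)) ∨
       (∀ y0 ∉ P.boundary, (y0 ∈ P.region ↔ P.wind y0 ≠ 0) ∧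
          (y0 ∈ P.region → cosector σ z a b ∩ Metric.ball z r ⊆ connectedComponentIn P.boundaryᶜ y0) ∧
          (y0 ∉ P.region → sector σ z a b ∩ Metric.ball z r ⊆ connectedComponentIn P.boundaryᶜ y0))) := by
  obtain ⟨r, hr, hb⟩ := h.mem_boundary_iff hc
  refine ⟨r, hr, hb, ?_⟩
  have hzr := Metric.mem_ball_self (x := z) hr
  obtain ⟨k, hk⟩ : (sector σ z a b ∩ Metric.ball z r).Nonempty :=
    closure_nonempty_iff.1 ⟨z, hc.mem_closure_sector_inter hzr (Corner.self_notMem_cosector z)⟩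
  obtain ⟨k', hk'⟩ : (cosector σ z a b ∩ Metric.ball z r).Nonempty :=
    closure_nonempty_iff.1 ⟨z, hc.mem_closure_cosector_inter hzr (Corner.self_notMem_sector z)⟩
  have hzb : z ∈ P.boundary :=
    (hb z hzr).2 ⟨Corner.self_notMem_sector z, Corner.self_notMem_cosector z⟩
  have hw := wind_ne_of_sector h hc hr hb hk hk'
  obtain ⟨f, hf, hfu⟩ := exists_unbounded P
  have hf0 : P.wind f = 0 := wind_eq_zero_of_unbounded isPreconnected_connectedComponentIn
    (connectedComponentIn_subset _ _) hfu (mem_connectedComponentIn hf)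
  have hcon : ∀ y0 ∉ P.boundary,
      sector σ z a b ∩ Metric.ball z r ⊆ connectedComponentIn P.boundaryᶜ y0 ∨
      cosector σ z a b ∩ Metric.ball z r ⊆ connectedComponentIn P.boundaryᶜ y0 := fun y0 hy0 =>
    component_contains_sector hc hr hb (boundary_subset_closure hy0 hzb)
  have hwc : ∀ y0 ∉ P.boundary, ∀ x ∈ connectedComponentIn P.boundaryᶜ y0,
      P.wind x = P.wind y0 := fun y0 hy0 x hx =>
    wind_eq isPreconnected_connectedComponentIn
      (connectedComponentIn_subset _ _) hx (mem_connectedComponentIn hy0)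
  have hfar : ∀ y0 ∉ P.boundary, y0 ∉ P.region → P.wind y0 = 0 := by
    intro y0 hy0 hR
    rw [mem_region_iff hy0] at hR
    exact wind_eq_zero_of_unbounded isPreconnected_connectedComponentIn
      (connectedComponentIn_subset _ _) hR (mem_connectedComponentIn hy0)
  have hsep : ∀ y0 ∉ P.boundary, y0 ∈ P.region → ∀ x ∈ connectedComponentIn P.boundaryᶜ y0,
      x ∉ connectedComponentIn P.boundaryᶜ f := by
    intro y0 hy0 hR x hx hx'
    rw [mem_region_iff hy0, connectedComponentIn_eq hx, ← connectedComponentIn_eq hx'] at hR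
    exact hfu hR
  rcases hcon f hf with hF | hF
  · right
    intro y0 hy0
    have wk : P.wind k = 0 := by rw [hwc f hf k (hF hk), hf0]
    by_cases hR : y0 ∈ P.region
    · have hc' := (hcon y0 hy0).resolve_left fun hs => hsep y0 hy0 hR k (hs hk) (hF hk)
      refine ⟨iff_of_true hR ?_, fun _ => hc', fun h => absurd hR h⟩
      rw [← hwc y0 hy0 k' (hc' hk'), ← wk]; exact hw.symm
    · have h0 := hfar y0 hy0 hR
      refine ⟨iff_of_false hR (not_not.2 h0), fun h => absurd h hR, fun _ => ?_⟩
      refine (hcon y0 hy0).resolve_right fun hs => hw ?_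
      rw [wk, hwc y0 hy0 k' (hs hk'), h0]
  · left
    intro y0 hy0
    have wk : P.wind k' = 0 := by rw [hwc f hf k' (hF hk'), hf0]
    by_cases hR : y0 ∈ P.region
    · have hc' := (hcon y0 hy0).resolve_right fun hs => hsep y0 hy0 hR k' (hs hk') (hF hk')
      refine ⟨iff_of_true hR ?_, fun _ => hc', fun h => absurd hR h⟩
      rw [← hwc y0 hy0 k (hc' hk), ← wk]; exact hw
    · have h0 := hfar y0 hy0 hR
      refine ⟨iff_of_false hR (not_not.2 h0), fun h => absurd h hR, fun _ => ?_⟩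
      refine (hcon y0 hy0).resolve_left fun hs => hw ?_
      rw [wk, hwc y0 hy0 k (hs hk), h0]

theorem mem_region_iff_wind {y : E2} (hy : y ∉ P.boundary) : y ∈ P.region ↔ P.wind y ≠ 0 := by
  obtain ⟨a, b, h, h0⟩ := exists_arms (vtx_mem_boundary (P := P) 0) 1
  obtain ⟨r, -, -, h1 | h1⟩ := h.components (h.corner one_ne_zero h0)
  · exact (h1 y hy).1
  · exact (h1 y hy).1

theorem boundary_subset_region : P.boundary ⊆ P.region := subset_union_left

theorem mem_inner_of_component {x y : E2} (hx : x ∈ P.inner)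
    (hy : y ∈ connectedComponentIn P.boundaryᶜ x) : y ∈ P.inner := by
  have hyb : y ∉ P.boundary := connectedComponentIn_subset _ _ hy
  refine ⟨?_, hyb⟩
  rw [mem_region_iff hyb, ← connectedComponentIn_eq hy, ← mem_region_iff hx.2]
  exact hx.1

theorem isOpen_inner : IsOpen P.inner := by
  rw [isOpen_iff_mem_nhds]
  intro x hx
  have ho : IsOpen (connectedComponentIn P.boundaryᶜ x) :=
    isClosed_boundary.isOpen_compl.connectedComponentIn
  exact mem_of_superset (ho.mem_nhds (mem_connectedComponentIn hx.2))
    fun y hy => mem_inner_of_component hx hy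

theorem isClosed_region : IsClosed P.region := by
  rw [← isOpen_compl_iff, isOpen_iff_mem_nhds]
  intro x hx
  have hxb : x ∉ P.boundary := fun h => hx (boundary_subset_region h)
  have ho : IsOpen (connectedComponentIn P.boundaryᶜ x) :=
    isClosed_boundary.isOpen_compl.connectedComponentIn
  refine mem_of_superset (ho.mem_nhds (mem_connectedComponentIn hxb)) fun y hy hyR => ?_
  have hyb : y ∉ P.boundary := connectedComponentIn_subset _ _ hy
  rw [mem_region_iff hyb, ← connectedComponentIn_eq hy, ← mem_region_iff hxb] at hyR
  exact hx hyR

theorem subset_inner {T : Set E2} (hT : IsPreconnected T) (h : Disjoint T P.boundary) {y : E2}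
    (hy : y ∈ T) (hyi : y ∈ P.inner) : T ⊆ P.inner := fun _ hx =>
  mem_inner_of_component hyi
    (hT.subset_connectedComponentIn hy h.subset_compl_right hx)

/-- Near a boundary point, the region is one of the two sectors, together with the boundary. -/
theorem Arms.local_structure {z a b : E2} (h : P.Arms z a b) {σ : ℝ} (hc : Corner σ a b) :
    ∃ r > 0, (∀ y ∈ Metric.ball z r,
      (y ∈ P.boundary ↔ y ∉ sector σ z a b ∧ y ∉ cosector σ z a b)) ∧
      ((∀ y ∈ Metric.ball z r, (y ∈ sector σ z a b → y ∈ P.inner) ∧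
          (y ∈ cosector σ z a b → y ∉ P.region)) ∨
       (∀ y ∈ Metric.ball z r, (y ∈ sector σ z a b → y ∉ P.region) ∧
          (y ∈ cosector σ z a b → y ∈ P.inner))) := by
  obtain ⟨r, hr, hb, hcomp⟩ := h.components hc
  refine ⟨r, hr, hb, ?_⟩
  have key : ∀ {S S' : Set E2},
      (S ∩ Metric.ball z r).Nonempty → (S' ∩ Metric.ball z r).Nonempty →
      (∀ y ∈ S ∩ Metric.ball z r, ∀ y' ∈ S' ∩ Metric.ball z r, P.wind y ≠ P.wind y') →
      (∀ y ∈ S ∩ Metric.ball z r, y ∉ P.boundary) → (∀ y ∈ S' ∩ Metric.ball z r, y ∉ P.boundary) →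
      (∀ y0 ∉ P.boundary, (y0 ∈ P.region ↔ P.wind y0 ≠ 0) ∧
          (y0 ∈ P.region → S ∩ Metric.ball z r ⊆ connectedComponentIn P.boundaryᶜ y0) ∧
          (y0 ∉ P.region → S' ∩ Metric.ball z r ⊆ connectedComponentIn P.boundaryᶜ y0)) →
      ∀ y ∈ Metric.ball z r, (y ∈ S → y ∈ P.inner) ∧ (y ∈ S' → y ∉ P.region) := by
    intro S S' ⟨k, hk⟩ ⟨k', hk'⟩ hw hSb hSb' hcomp y hy
    constructor
    · intro hyS
      refine ⟨?_, hSb y ⟨hyS, hy⟩⟩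
      by_contra hR
      have h1 := (hcomp y (hSb y ⟨hyS, hy⟩)).2.2 hR
      refine hw y ⟨hyS, hy⟩ k' hk' ?_
      exact wind_eq isPreconnected_connectedComponentIn (connectedComponentIn_subset _ _)
        (mem_connectedComponentIn (hSb y ⟨hyS, hy⟩)) (h1 hk')
    · intro hyS hR
      have h1 := (hcomp y (hSb' y ⟨hyS, hy⟩)).2.1 hR
      refine hw k hk y ⟨hyS, hy⟩ ?_
      exact wind_eq isPreconnected_connectedComponentIn (connectedComponentIn_subset _ _)
        (h1 hk) (mem_connectedComponentIn (hSb' y ⟨hyS, hy⟩))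
  have hzr := Metric.mem_ball_self (x := z) hr
  have n1 : (sector σ z a b ∩ Metric.ball z r).Nonempty :=
    closure_nonempty_iff.1 ⟨z, hc.mem_closure_sector_inter hzr (Corner.self_notMem_cosector z)⟩
  have n2 : (cosector σ z a b ∩ Metric.ball z r).Nonempty :=
    closure_nonempty_iff.1 ⟨z, hc.mem_closure_cosector_inter hzr (Corner.self_notMem_sector z)⟩
  have b1 : ∀ y ∈ sector σ z a b ∩ Metric.ball z r, y ∉ P.boundary :=
    fun x hx hxb => ((hb x hx.2).1 hxb).1 hx.1
  have b2 : ∀ y ∈ cosector σ z a b ∩ Metric.ball z r, y ∉ P.boundary :=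
    fun x hx hxb => ((hb x hx.2).1 hxb).2 hx.1
  have hw : ∀ y ∈ sector σ z a b ∩ Metric.ball z r, ∀ y' ∈ cosector σ z a b ∩ Metric.ball z r,
      P.wind y ≠ P.wind y' := fun y hy y' hy' => wind_ne_of_sector h hc hr hb hy hy'
  rcases hcomp with h1 | h1
  · left
    exact key n1 n2 hw b1 b2 h1
  · right
    intro y hy
    have := key n2 n1 (fun y hy y' hy' => (hw y' hy' y hy).symm)
      b2 b1 h1 y hy
    exact this.symm

theorem isPreconnected_inner : IsPreconnected P.inner := by
  obtain ⟨a, b, h, h0⟩ := exists_arms (vtx_mem_boundary (P := P) 0) 1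
  have hc := h.corner one_ne_zero h0
  obtain ⟨r, hr, -, h1⟩ := h.components hc
  have hzr := Metric.mem_ball_self (x := P.vtx 0) hr
  have hcommon : ∃ k, ∀ y ∈ P.inner, k ∈ connectedComponentIn P.boundaryᶜ y := by
    rcases h1 with h1 | h1
    · obtain ⟨k, hk⟩ : (sector 1 (P.vtx 0) a b ∩ Metric.ball (P.vtx 0) r).Nonempty :=
        closure_nonempty_iff.1
          ⟨_, hc.mem_closure_sector_inter hzr (Corner.self_notMem_cosector _)⟩
      refine ⟨k, fun y hy => ?_⟩
      exact (h1 y hy.2).2.1 hy.1 hk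
    · obtain ⟨k, hk⟩ : (cosector 1 (P.vtx 0) a b ∩ Metric.ball (P.vtx 0) r).Nonempty :=
        closure_nonempty_iff.1
          ⟨_, hc.mem_closure_cosector_inter hzr (Corner.self_notMem_sector _)⟩
      refine ⟨k, fun y hy => ?_⟩
      exact (h1 y hy.2).2.1 hy.1 hk
  obtain ⟨k, hk⟩ := hcommon
  refine isPreconnected_of_forall k fun y hy => ⟨connectedComponentIn P.boundaryᶜ y, ?_, hk y hy,
    mem_connectedComponentIn hy.2, isPreconnected_connectedComponentIn⟩
  exact fun x hx => mem_inner_of_component hy hx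

theorem exists_ray_notMem_region (P : SimplePolygon) (x : E2) {e : E2} (he : e ≠ 0) :
    ∃ t > (0 : ℝ), x + t • e ∉ P.region := by
  obtain ⟨ρ, hρ, hfar⟩ := exists_far P
  have he' := norm_pos_iff.2 he
  set t := (ρ + ‖x‖ + 1) / ‖e‖ with ht
  have ht0 : 0 < t := by positivity
  have hn : ρ < ‖x + t • e‖ := by
    have h1 : ‖t • e‖ = ρ + ‖x‖ + 1 := by
      rw [norm_smul, Real.norm_of_nonneg ht0.le, ht, div_mul_cancel₀ _ he'.ne']
    have h2 := norm_sub_norm_le (t • e) (-x)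
    rw [norm_neg, sub_neg_eq_add, add_comm (t • e)] at h2
    linarith
  refine ⟨t, ht0, fun hR => ?_⟩
  obtain ⟨h1, h2⟩ := hfar _ hn
  exact (mem_region_iff_wind h1).1 hR h2

/-- Every point of the region is the start of a short segment running inside. -/
theorem exists_inward {z : E2} (hz : z ∈ P.region) :
    ∃ w : E2, ∀ᶠ ε : ℝ in 𝓝[>] 0, z + ε • w ∈ P.inner := by
  by_cases hb : z ∈ P.boundary
  · obtain ⟨a, b, h, h0⟩ := exists_arms hb 1
    have hc := h.corner one_ne_zero h0
    obtain ⟨w, hw1, hw2⟩ := hc.exists_dir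
    obtain ⟨r, hr, -, h1⟩ := h.local_structure hc
    rcases h1 with h1 | h1
    · refine ⟨w, ?_⟩
      filter_upwards [self_mem_nhdsWithin,
        (Corner.tendsto_line z w).eventually (Metric.ball_mem_nhds z hr)] with ε hε hεr
      exact (h1 _ hεr).1 (Corner.add_mem_sector (Corner.self_notMem_cosector z) hw1 hw2 hε)
    · refine ⟨-w, ?_⟩
      filter_upwards [self_mem_nhdsWithin,
        (Corner.tendsto_line z (-w)).eventually (Metric.ball_mem_nhds z hr)] with ε hε hεr
      refine (h1 _ hεr).2 ?_
      rw [smul_neg, ← sub_eq_add_neg]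
      exact Corner.sub_mem_cosector (Corner.self_notMem_sector z) hw1 hw2 hε
  · refine ⟨0, ?_⟩
    simp only [smul_zero, add_zero]
    exact Eventually.of_forall fun _ => ⟨hz, hb⟩

end SimplePolygon

/-! ### Separation by a chord -/

/-- The polygonal curve formed by the first `N` edges of the chain `q`. -/
def chainSet (q : ℕ → E2) (N : ℕ) : Set E2 := ⋃ k ∈ Finset.range N, segment ℝ (q k) (q (k + 1))

theorem mem_chainSet {q : ℕ → E2} {N : ℕ} {z : E2} :
    z ∈ chainSet q N ↔ ∃ k < N, z ∈ segment ℝ (q k) (q (k + 1)) := by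
  simp [chainSet]

theorem isClosed_segment (a b : E2) : IsClosed (segment ℝ a b) := by
  rw [segment_eq_image]
  exact (isCompact_Icc.image (by fun_prop)).isClosed

theorem isClosed_chainSet (q : ℕ → E2) (N : ℕ) : IsClosed (chainSet q N) :=
  isClosed_biUnion_finset fun _ _ => isClosed_segment _ _

theorem continuousAt_chainAngle_of_notMem {q : ℕ → E2} {N : ℕ} {y : E2} (h : y ∉ chainSet q N) :
    ContinuousAt (chainAngle q N) y :=
  continuousAt_chainAngle fun k hk hy => h (mem_chainSet.2 ⟨k, hk, hy⟩)

theorem exp_chainAngle_of_notMem {q : ℕ → E2} {N : ℕ} {y : E2} (hN : 0 < N)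
    (h : y ∉ chainSet q N) :
    Complex.exp (chainAngle q N y * Complex.I) = unitToward (q N) y / unitToward (q 0) y := by
  refine exp_chainAngle fun k hk => ?_
  rintro rfl
  apply h
  rcases hk.lt_or_eq with hk | rfl
  · exact mem_chainSet.2 ⟨k, hk, left_mem_segment ℝ _ _⟩
  · obtain ⟨k, rfl⟩ := Nat.exists_eq_add_of_lt hN
    rw [zero_add]
    exact mem_chainSet.2 ⟨k, by omega, right_mem_segment ℝ _ _⟩

theorem chain_endpoints_mem {q : ℕ → E2} {N : ℕ} (hN : 0 < N) :
    q 0 ∈ chainSet q N ∧ q N ∈ chainSet q N := by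
  refine ⟨mem_chainSet.2 ⟨0, hN, left_mem_segment ℝ _ _⟩, ?_⟩
  obtain ⟨k, rfl⟩ := Nat.exists_eq_add_of_lt hN
  rw [zero_add]
  exact mem_chainSet.2 ⟨k, by omega, right_mem_segment ℝ _ _⟩

theorem eventually_eq_of_exp_eq_one {g : E2 → ℝ} {z : E2} (hg : ContinuousAt g z)
    (h : ∀ᶠ y in 𝓝 z, Complex.exp (g y * Complex.I) = 1) : ∀ᶠ y in 𝓝 z, g y = g z := by
  filter_upwards [h, hg.eventually (Metric.ball_mem_nhds _ (by norm_num : (0 : ℝ) < 6))] with y h1 h2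
  exact eq_of_abs_sub_lt h1 h.self_of_nhds (by simpa [Real.dist_eq] using h2)

namespace SimplePolygon

variable {P : SimplePolygon}

/-- A chord separates the region: some set `A` is locally constant on the region off the chord and
contains exactly one of the two sides of the chord. -/
theorem exists_separation_of_chains {v b : E2} {q1 q2 : ℕ → E2} {N1 N2 : ℕ} (hN1 : 0 < N1)
    (hN2 : 0 < N2) (h10 : q1 0 = v) (h1N : q1 N1 = b) (h20 : q2 0 = b) (h2N : q2 N2 = v)
    (hun : chainSet q1 N1 ∪ chainSet q2 N2 = P.boundary)
    (hint : ∀ z ∈ chainSet q1 N1, z ∈ chainSet q2 N2 → z = v ∨ z = b)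
    (hin : openSegment ℝ v b ⊆ P.inner) {m : E2} (hm : m ∈ openSegment ℝ v b) :
    ∃ A : Set E2, (∀ z ∈ P.region \ segment ℝ v b, ∀ᶠ y in 𝓝 z, y ∈ P.region → (y ∈ A ↔ z ∈ A)) ∧
      ∀ᶠ y in 𝓝 m, (0 < area 1 (b - v) (y - v) → y ∈ A) ∧
        (area 1 (b - v) (y - v) < 0 → y ∉ A) := by
  classical
  set S := segment ℝ v b with hS
  set C1 := chainSet q1 N1 with hC1
  set C2 := chainSet q2 N2 with hC2
  have hvS : v ∈ S := left_mem_segment ℝ _ _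
  have hbS : b ∈ S := right_mem_segment ℝ _ _
  have hbC : b ∈ C1 := h1N ▸ (chain_endpoints_mem hN1).2
  have hvC : v ∈ C1 := h10 ▸ (chain_endpoints_mem hN1).1
  have hbv : b ≠ v := by
    rintro rfl
    exact (hin hm).2 (hun ▸ Or.inl (by simpa using (by simpa using hm : m = b) ▸ hbC))
  have hS' : ∀ y, y ∉ S → y ∉ segment ℝ b v := fun y hy => by rwa [segment_symm]
  set W : E2 → ℝ := fun y => chainAngle q1 N1 y + subtend b v y with hW
  set W' : E2 → ℝ := fun y => chainAngle q2 N2 y + subtend v b y with hW'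
  set V : E2 → ℝ := fun y => chainAngle q1 N1 y + chainAngle q2 N2 y with hV
  have eW : ∀ y, y ∉ C1 → y ∉ S → Complex.exp (W y * Complex.I) = 1 := by
    intro y h1 h2
    have nv : y ≠ v := by rintro rfl; exact h2 hvS
    have nb : y ≠ b := by rintro rfl; exact h2 hbS
    have uv := unitToward_ne_zero nv
    have ub := unitToward_ne_zero nb
    rw [hW, Complex.ofReal_add, add_mul, Complex.exp_add, exp_chainAngle_of_notMem hN1 h1,
      exp_subtend nb nv, h1N, h10]
    field_simp
  have eW' : ∀ y, y ∉ C2 → y ∉ S → Complex.exp (W' y * Complex.I) = 1 := by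
    intro y h1 h2
    have nv : y ≠ v := by rintro rfl; exact h2 hvS
    have nb : y ≠ b := by rintro rfl; exact h2 hbS
    have uv := unitToward_ne_zero nv
    have ub := unitToward_ne_zero nb
    rw [hW', Complex.ofReal_add, add_mul, Complex.exp_add, exp_chainAngle_of_notMem hN2 h1,
      exp_subtend nv nb, h2N, h20]
    field_simp
  have eV : ∀ y, y ∉ C1 → y ∉ C2 → Complex.exp (V y * Complex.I) = 1 := by
    intro y h1 h2
    have nv : y ≠ v := by rintro rfl; exact h1 hvC
    have nb : y ≠ b := by rintro rfl; exact h1 hbC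
    have uv := unitToward_ne_zero nv
    have ub := unitToward_ne_zero nb
    rw [hV, Complex.ofReal_add, add_mul, Complex.exp_add, exp_chainAngle_of_notMem hN1 h1,
      exp_chainAngle_of_notMem hN2 h2, h1N, h10, h2N, h20]
    field_simp
  have cW : ∀ y, y ∉ C1 → y ∉ S → ContinuousAt W y := fun y h1 h2 =>
    (continuousAt_chainAngle_of_notMem h1).add (continuousAt_subtend (hS' y h2))
  have cW' : ∀ y, y ∉ C2 → y ∉ S → ContinuousAt W' y := fun y h1 h2 =>
    (continuousAt_chainAngle_of_notMem h1).add (continuousAt_subtend h2)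
  have cV : ∀ y, y ∉ C1 → y ∉ C2 → ContinuousAt V y := fun y h1 h2 =>
    (continuousAt_chainAngle_of_notMem h1).add (continuousAt_chainAngle_of_notMem h2)
  have hD1 : ∀ y ∈ P.inner, y ∉ C1 := fun y hy h => hy.2 (hun ▸ Or.inl h)
  have hD2 : ∀ y ∈ P.inner, y ∉ C2 := fun y hy h => hy.2 (hun ▸ Or.inr h)
  set c := V m with hcdef
  have hc : ∀ y ∈ P.inner, V y = c := fun y hy =>
    isPreconnected_inner.eq_of_exp_eq_one
      (fun x hx => (cV x (hD1 x hx) (hD2 x hx)).continuousWithinAt)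
      (fun x hx => eV x (hD1 x hx) (hD2 x hx)) hy (hin hm)
  have hrel : ∀ y ∈ P.inner, y ∉ S → W y = c - W' y := by
    intro y hy hyS
    have h1 := hc y hy
    have h2 := subtend_swap hyS
    simp only [hV, hW, hW'] at h1 ⊢
    linarith
  set g : E2 → ℝ := fun y => if y ∈ C1 then c - W' y else W y with hg
  have hloc : ∀ z ∈ P.region \ S, ∀ᶠ y in 𝓝 z, y ∈ P.region → g y = g z := by
    rintro z ⟨hzR, hzS⟩
    have nS : ∀ᶠ y in 𝓝 z, y ∉ S := (isClosed_segment v b).isOpen_compl.mem_nhds hzS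
    by_cases hz1 : z ∈ C1
    · have hz2 : z ∉ C2 := by
        intro hz2
        rcases hint z hz1 hz2 with rfl | rfl
        · exact hzS hvS
        · exact hzS hbS
      have n2 : ∀ᶠ y in 𝓝 z, y ∉ C2 := (isClosed_chainSet q2 N2).isOpen_compl.mem_nhds hz2
      have hev := eventually_eq_of_exp_eq_one (cW' z hz2 hzS)
        (by filter_upwards [nS, n2] with y h1 h2 using eW' y h2 h1)
      filter_upwards [nS, n2, hev] with y h1 h2 h3 hyR
      have e1 : g z = c - W' z := if_pos hz1
      by_cases hy1 : y ∈ C1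
      · rw [e1, ← h3]; exact if_pos hy1
      · have e2 : g y = W y := if_neg hy1
        have hyi : y ∈ P.inner := ⟨hyR, by rw [← hun]; exact fun h => h.elim hy1 h2⟩
        rw [e1, e2, hrel y hyi h1, h3]
    · have n1 : ∀ᶠ y in 𝓝 z, y ∉ C1 := (isClosed_chainSet q1 N1).isOpen_compl.mem_nhds hz1
      have hev := eventually_eq_of_exp_eq_one (cW z hz1 hzS)
        (by filter_upwards [nS, n1] with y h1 h2 using eW y h2 h1)
      filter_upwards [n1, hev] with y h2 h3 _
      have e1 : g z = W z := if_neg hz1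
      have e2 : g y = W y := if_neg h2
      rw [e1, e2, h3]
  have hm1 : m ∉ C1 := hD1 m (hin hm)
  refine ⟨{y | |g y - (chainAngle q1 N1 m - Real.pi)| < 1}, ?_, ?_⟩
  · intro z hz
    filter_upwards [hloc z hz] with y hy hyR
    simp only [hy hyR]
  · have hm' : m ∈ openSegment ℝ b v := by rwa [openSegment_symm]
    have h1 := subtend_jump hm' hbv (by norm_num : (0 : ℝ) < 1 / 2)
    have h2 := (continuousAt_chainAngle_of_notMem hm1).eventually
      (Metric.ball_mem_nhds _ (by norm_num : (0 : ℝ) < 1 / 2))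
    have n1 : ∀ᶠ y in 𝓝 m, y ∉ C1 := (isClosed_chainSet q1 N1).isOpen_compl.mem_nhds hm1
    filter_upwards [h1, h2, n1] with y hy1 hy2 hy3
    have e : g y = W y := if_neg hy3
    have ea : area 1 (v - b) (y - b) = -area 1 (b - v) (y - v) := by simp [area]; ring
    rw [ea] at hy1
    rw [Real.dist_eq, abs_lt] at hy2
    simp only [e, hW]
    constructor
    · intro h
      have := hy1.2 (by linarith)
      rw [abs_lt] at this ⊢
      constructor <;> linarith
    · intro h h'
      have := hy1.1 (by linarith)
      rw [abs_lt] at this h'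
      linarith [Real.pi_gt_three]

theorem mem_edges_from {i : ZMod P.n} {k l : ℕ} (hkl : k < l) (hl : l < P.n) {z : E2}
    (hk : z ∈ P.edge (i + k)) (hlz : z ∈ P.edge (i + l)) :
    (l = k + 1 ∧ z = P.vtx (i + l)) ∨ (k = 0 ∧ l + 1 = P.n ∧ z = P.vtx i) := by
  have hinj : ∀ s t : ℕ, s < P.n → t < P.n → (s : ZMod P.n) = t → s = t := by
    intro s t hs ht h
    rw [ZMod.natCast_eq_natCast_iff'] at h
    rwa [Nat.mod_eq_of_lt hs, Nat.mod_eq_of_lt ht] at h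
  have hne : i + (k : ZMod P.n) ≠ i + l := by
    intro h
    have := hinj k l (by omega) hl (add_left_cancel h)
    omega
  rcases eq_vtx_of_mem_edge hne hk hlz with ⟨h1, h2⟩ | ⟨h1, h2⟩
  · left
    refine ⟨?_, h2⟩
    rw [add_assoc] at h1
    refine hinj l (k + 1) hl (by omega) ?_
    push_cast
    exact add_left_cancel h1
  · right
    rw [add_assoc] at h1
    have h3 := add_left_cancel h1
    by_cases h4 : l + 1 = P.n
    · have hk0 : (k : ZMod P.n) = 0 := by
        have : ((l + 1 : ℕ) : ZMod P.n) = 0 := by rw [h4]; exact ZMod.natCast_self _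
        rw [h3, ← this]; push_cast; rfl
      have : k = 0 := hinj k 0 (by omega) (by omega) (by simpa using hk0)
      refine ⟨this, h4, ?_⟩
      rw [h2, hk0, add_zero]
    · have := hinj k (l + 1) (by omega) (by omega) (by push_cast; exact h3)
      omega

theorem eq_of_mem_segment_of_mem_segment {p q b z : E2} (hb : b ∈ segment ℝ p q)
    (h1 : z ∈ segment ℝ p b) (h2 : z ∈ segment ℝ b q) : z = b := by
  rw [segment_eq_image'] at hb
  obtain ⟨t, ⟨t0, t1⟩, rfl⟩ := hb
  simp only at h1 h2 ⊢
  rw [segment_eq_image'] at h1 h2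
  obtain ⟨s, ⟨s0, s1⟩, rfl⟩ := h1
  obtain ⟨r, ⟨r0, r1⟩, hr⟩ := h2
  simp only [add_sub_cancel_left] at hr ⊢
  have e : (t + r * (1 - t) - s * t) • (q - p) = 0 := by
    have e1 : q - (p + t • (q - p)) = (1 - t) • (q - p) := by rw [sub_smul, one_smul]; abel
    rw [e1, add_assoc, add_right_inj] at hr
    rw [sub_smul, add_smul, mul_smul, mul_smul, hr, sub_self]
  rcases smul_eq_zero.1 e with h | h
  · have h1 : s * t ≤ t := by nlinarith
    have h2 : 0 ≤ r * (1 - t) := mul_nonneg r0 (by linarith)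
    have : s * t = t := by linarith
    rw [smul_smul, this]
  · simp [h]

theorem exists_separation {i : ZMod P.n} {b m : E2} (hb : b ∈ P.boundary)
    (hin : openSegment ℝ (P.vtx i) b ⊆ P.inner) (hm : m ∈ openSegment ℝ (P.vtx i) b)
    {σ : ℝ} (hσ : σ ≠ 0) :
    ∃ A : Set E2, (∀ z ∈ P.region \ segment ℝ (P.vtx i) b,
        ∀ᶠ y in 𝓝 z, y ∈ P.region → (y ∈ A ↔ z ∈ A)) ∧
      ∀ᶠ y in 𝓝 m, (0 < area σ (b - P.vtx i) (y - P.vtx i) → y ∈ A) ∧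
        (area σ (b - P.vtx i) (y - P.vtx i) < 0 → y ∉ A) := by
  obtain ⟨l, hl⟩ := mem_boundary.1 hb
  obtain ⟨j, hj, rfl⟩ : ∃ j : ℕ, j < P.n ∧ l = i + j := by
    refine ⟨(l - i).val, ZMod.val_lt _, ?_⟩
    rw [ZMod.natCast_zmod_val]; ring
  obtain ⟨q, hq⟩ : ∃ q : ℕ → E2, ∀ k, q k = P.vtx (i + k) := ⟨_, fun _ => rfl⟩
  have hedge : ∀ k : ℕ, P.edge (i + k) = segment ℝ (q k) (q (k + 1)) := by
    intro k
    rw [edge, hq, hq]; push_cast; rw [add_assoc]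
  have hqn : q P.n = P.vtx i := by simp [hq]
  have hq0 : q 0 = P.vtx i := by simp [hq]
  have hbj : b ∈ segment ℝ (q j) (q (j + 1)) := by rw [hedge] at hl; exact hl
  set q1 : ℕ → E2 := fun k => if k ≤ j then q k else b with hq1
  set q2 : ℕ → E2 := fun k => if k = 0 then b else q (j + k) with hq2
  have s1 : ∀ z, z ∈ chainSet q1 (j + 1) ↔
      (∃ k < j, z ∈ P.edge (i + k)) ∨ z ∈ segment ℝ (q j) b := by
    intro z
    rw [mem_chainSet]
    constructor
    · rintro ⟨k, hk, hz⟩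
      rcases (Nat.lt_succ_iff.1 hk).lt_or_eq with h | rfl
      · left
        refine ⟨k, h, ?_⟩
        rw [hedge]
        simpa [hq1, h.le, Nat.succ_le_of_lt h] using hz
      · right
        simpa [hq1] using hz
    · rintro (⟨k, hk, hz⟩ | hz)
      · refine ⟨k, by omega, ?_⟩
        rw [hedge] at hz
        simpa [hq1, hk.le, Nat.succ_le_of_lt hk] using hz
      · exact ⟨j, by omega, by simpa [hq1] using hz⟩
  have s2 : ∀ z, z ∈ chainSet q2 (P.n - j) ↔
      (∃ k, j < k ∧ k < P.n ∧ z ∈ P.edge (i + k)) ∨ z ∈ segment ℝ b (q (j + 1)) := by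
    intro z
    rw [mem_chainSet]
    constructor
    · rintro ⟨k, hk, hz⟩
      rcases Nat.eq_zero_or_pos k with rfl | h
      · right
        simpa [hq2] using hz
      · left
        refine ⟨j + k, by omega, by omega, ?_⟩
        rw [hedge]
        simpa [hq2, h.ne', add_assoc] using hz
    · rintro (⟨k, hk, hkn, hz⟩ | hz)
      · refine ⟨k - j, by omega, ?_⟩
        obtain ⟨d, rfl⟩ := Nat.exists_eq_add_of_lt hk
        rw [hedge] at hz
        have e : j + d + 1 - j = d + 1 := by omega
        rw [e]
        simpa [hq2, add_assoc] using hz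
      · exact ⟨0, by omega, by simpa [hq2] using hz⟩
  have hun : chainSet q1 (j + 1) ∪ chainSet q2 (P.n - j) = P.boundary := by
    have sub1 : segment ℝ (q j) b ⊆ P.edge (i + j) := by
      rw [hedge]; exact (convex_segment _ _).segment_subset (left_mem_segment ℝ _ _) hbj
    have sub2 : segment ℝ b (q (j + 1)) ⊆ P.edge (i + j) := by
      rw [hedge]; exact (convex_segment _ _).segment_subset hbj (right_mem_segment ℝ _ _)
    ext z
    rw [mem_union, s1, s2, mem_boundary]
    constructor
    · rintro ((⟨k, -, hz⟩ | hz) | ⟨k, -, -, hz⟩ | hz)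
      · exact ⟨_, hz⟩
      · exact ⟨_, sub1 hz⟩
      · exact ⟨_, hz⟩
      · exact ⟨_, sub2 hz⟩
    · rintro ⟨l', hz⟩
      obtain ⟨k, hk, rfl⟩ : ∃ k : ℕ, k < P.n ∧ l' = i + k := by
        refine ⟨(l' - i).val, ZMod.val_lt _, ?_⟩
        rw [ZMod.natCast_zmod_val]; ring
      rcases lt_trichotomy k j with h | rfl | h
      · exact Or.inl (Or.inl ⟨k, h, hz⟩)
      · rw [hedge] at hz
        rw [segment_eq_union hbj] at hz
        rcases hz with h | h
        · exact Or.inl (Or.inr h)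
        · exact Or.inr (Or.inr h)
      · exact Or.inr (Or.inl ⟨k, h, hk, hz⟩)
  have hint : ∀ z ∈ chainSet q1 (j + 1), z ∈ chainSet q2 (P.n - j) → z = P.vtx i ∨ z = b := by
    have sub1 : segment ℝ (q j) b ⊆ P.edge (i + j) := by
      rw [hedge]; exact (convex_segment _ _).segment_subset (left_mem_segment ℝ _ _) hbj
    have sub2 : segment ℝ b (q (j + 1)) ⊆ P.edge (i + j) := by
      rw [hedge]; exact (convex_segment _ _).segment_subset hbj (right_mem_segment ℝ _ _)
    intro z hz1 hz2
    rw [s1] at hz1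
    rw [s2] at hz2
    rcases hz1 with ⟨k, hk, hz1⟩ | hz1 <;> rcases hz2 with ⟨l, hl1, hl2, hz2⟩ | hz2
    · rcases mem_edges_from (by omega) hl2 hz1 hz2 with ⟨h, -⟩ | ⟨-, -, h⟩
      · omega
      · exact Or.inl h
    · rcases mem_edges_from hk hj hz1 (sub2 hz2) with ⟨-, h⟩ | ⟨-, -, h⟩
      · right
        refine eq_of_mem_segment_of_mem_segment hbj ?_ hz2
        rw [h, ← hq]; exact left_mem_segment ℝ _ _
      · exact Or.inl h
    · rcases mem_edges_from hl1 hl2 (sub1 hz1) hz2 with ⟨e, h⟩ | ⟨-, -, h⟩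
      · right
        refine eq_of_mem_segment_of_mem_segment hbj hz1 ?_
        rw [h, ← hq, e]; exact right_mem_segment ℝ _ _
      · exact Or.inl h
    · exact Or.inr (eq_of_mem_segment_of_mem_segment hbj hz1 hz2)
  obtain ⟨A, hA1, hA2⟩ := exists_separation_of_chains (P := P) (v := P.vtx i) (b := b)
    (q1 := q1) (q2 := q2) (N1 := j + 1) (N2 := P.n - j) (by omega) (by omega)
    (by simp [hq1, hq0]) (by simp [hq1]) (by simp [hq2])
    (by
      have : P.n - j ≠ 0 := by omega
      have e : j + (P.n - j) = P.n := by omega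
      simp [hq2, this, e, hqn]) hun hint hin hm
  have hs : ∀ x y : E2, area σ x y = σ * area 1 x y := by intro x y; simp [area]
  simp only [hs]
  rcases lt_or_gt_of_ne hσ with h | h
  · refine ⟨Aᶜ, fun z hz => ?_, ?_⟩
    · filter_upwards [hA1 z hz] with y hy hyR
      rw [mem_compl_iff, mem_compl_iff, hy hyR]
    · filter_upwards [hA2] with y hy
      exact ⟨fun h1 => hy.2 (by nlinarith), fun h1 => not_not.2 (hy.1 (by nlinarith))⟩
  · refine ⟨A, hA1, ?_⟩
    filter_upwards [hA2] with y hy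
    exact ⟨fun h1 => hy.1 (by nlinarith), fun h1 => hy.2 (by nlinarith)⟩

end SimplePolygon

/-! ### Visibility segments, chords and thin triangles -/

/-- The thin triangle at `a`, above the segment from `a` to `a + f`, of slope `δ` in direction
`n`. -/
def tri (σ : ℝ) (a f n : E2) (δ : ℝ) : Set E2 :=
  {z | 0 < area σ f (z - a) ∧ area σ f (z - a) < δ * area σ (z - a) n ∧
    area σ (z - a) n ≤ area σ f n}

theorem convex_tri (σ : ℝ) (a f n : E2) (δ : ℝ) : Convex ℝ (tri σ a f n δ) := by
  rintro y ⟨h1, h2, h3⟩ z ⟨g1, g2, g3⟩ s t hs ht hst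
  have e : s • y + t • z - a = s • (y - a) + t • (z - a) := by
    have : a = (s + t) • a := by rw [hst, one_smul]
    conv_lhs => rw [this]
    module
  simp only [tri, Set.mem_ofPred_eq, e, area_add_right, area_smul_right, area_add_left,
    area_smul_left]
  have hc : area σ f n = s * area σ f n + t * area σ f n := by rw [← add_mul, hst, one_mul]
  rcases hs.lt_or_eq with hs | rfl
  · refine ⟨by positivity, ?_, ?_⟩
    · nlinarith [mul_lt_mul_of_pos_left h2 hs, mul_le_mul_of_nonneg_left g2.le ht]
    · rw [hc]; gcongr
  · have : t = 1 := by linarith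
    subst this
    simpa using ⟨g1, g2, g3⟩

theorem tri_mono {σ : ℝ} {a f n : E2} {δ δ' : ℝ} (hδ : 0 < δ)
    (h : δ ≤ δ') : tri σ a f n δ ⊆ tri σ a f n δ' := by
  rintro z ⟨h1, h2, h3⟩
  refine ⟨h1, h2.trans_le ?_, h3⟩
  have : 0 < area σ (z - a) n := by
    by_contra hn
    nlinarith
  gcongr

theorem mem_tri {σ : ℝ} {a f n : E2} (hc : 0 < area σ f n) {δ τ s : ℝ} (hs : s ∈ Ioc (0 : ℝ) 1)
    (hτ : τ ∈ Ioo 0 δ) : a + s • (f + τ • n) ∈ tri σ a f n δ := by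
  simp only [tri, Set.mem_ofPred_eq, add_sub_cancel_left, area_add_right, area_smul_right,
    area_add_left, area_smul_left, area_self]
  obtain ⟨h1, h2⟩ := hs
  obtain ⟨h3, h4⟩ := hτ
  refine ⟨by simp; positivity, ?_, by nlinarith⟩
  have := mul_lt_mul_of_pos_right h4 (mul_pos h1 hc)
  linarith

theorem eventually_mem_tri {σ : ℝ} {a f n : E2} (hc : 0 < area σ f n) {δ s : ℝ} (hδ : 0 < δ)
    (hs : s ∈ Ioo (0 : ℝ) 1) :
    ∀ᶠ z in 𝓝 (a + s • f), 0 < area σ f (z - a) → z ∈ tri σ a f n δ := by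
  have h1 : ∀ᶠ z in 𝓝 (a + s • f), area σ f (z - a) < δ * area σ (z - a) n := by
    apply IsOpen.mem_nhds (isOpen_lt (continuous_area_right f a)
      (continuous_const.mul (continuous_area_left n a)))
    change area σ f (a + s • f - a) < δ * area σ (a + s • f - a) n
    have := hs.1
    rw [add_sub_cancel_left, area_smul_right, area_self, area_smul_left, mul_zero]
    positivity
  have h2 : ∀ᶠ z in 𝓝 (a + s • f), area σ (z - a) n < area σ f n := by
    apply IsOpen.mem_nhds (isOpen_lt (continuous_area_left n a) continuous_const)
    simp only [Set.mem_ofPred_eq, add_sub_cancel_left, area_smul_left]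
    nlinarith [hs.2]
  filter_upwards [h1, h2] with z g1 g2 g3 using ⟨g3, g1, g2.le⟩

theorem plucker (σ : ℝ) (p q f n : E2) : area σ p q * area σ f n =
    area σ p n * area σ f q - area σ f p * area σ q n := by
  simp only [area]; ring

theorem area_segment {σ : ℝ} {p q x y z : E2} (hx : x ∈ segment ℝ p q) (hy : y ∈ segment ℝ p q)
    (hz : z ∈ segment ℝ p q) : area σ (x - z) (y - z) = 0 := by
  rw [segment_eq_image'] at hx hy hz
  obtain ⟨t, -, rfl⟩ := hx
  obtain ⟨s, -, rfl⟩ := hy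
  obtain ⟨r, -, rfl⟩ := hz
  simp only [area, PiLp.sub_apply, PiLp.add_apply, PiLp.smul_apply, smul_eq_mul]
  ring

theorem exists_disjoint_tri_segment {σ : ℝ} {a f n p q : E2} (hc : 0 < area σ f n)
    (h : ∀ s ∈ segment ℝ p q, area σ f (s - a) = 0 → 0 < area σ (s - a) n →
      area σ (s - a) n ≤ area σ f n → ∀ z ∈ segment ℝ p q, area σ f (z - a) ≤ 0) :
    ∃ δ > 0, Disjoint (tri σ a f n δ) (segment ℝ p q) := by
  by_cases hY : ∃ z ∈ segment ℝ p q, 0 < area σ f (z - a)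
  swap
  · push Not at hY
    exact ⟨1, one_pos, Set.disjoint_left.2 fun z hz hz' => absurd hz.1 (hY z hz').not_gt⟩
  obtain ⟨zY, hzY, hY⟩ := hY
  by_cases ha : a ∈ segment ℝ p q
  · by_cases hT : Disjoint (tri σ a f n 1) (segment ℝ p q)
    · exact ⟨1, one_pos, hT⟩
    obtain ⟨z₁, ⟨h1, h2, h3⟩, hz₁⟩ := Set.not_disjoint_iff.1 hT
    have hX : 0 < area σ (z₁ - a) n := by linarith
    refine ⟨area σ f (z₁ - a) / area σ (z₁ - a) n, div_pos h1 hX, ?_⟩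
    rw [Set.disjoint_left]
    rintro z ⟨g1, g2, g3⟩ hz
    have := plucker σ (z - a) (z₁ - a) f n
    rw [area_segment hz hz₁ ha] at this
    rw [div_mul_eq_mul_div, lt_div_iff₀ hX] at g2
    nlinarith
  · set F := segment ℝ p q ∩ {z | 0 ≤ area σ f (z - a) ∧ 0 ≤ area σ (z - a) n ∧
      area σ (z - a) n ≤ area σ f n} with hF
    have hFc : IsCompact F := by
      refine IsCompact.inter_right ?_ ?_
      · rw [segment_eq_image']
        exact isCompact_Icc.image (by fun_prop)
      · exact (isClosed_le continuous_const (continuous_area_right f a)).inter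
          ((isClosed_le continuous_const (continuous_area_left n a)).inter
          (isClosed_le (continuous_area_left n a) continuous_const))
    have key : ∀ δ > 0, ∀ z ∈ tri σ a f n δ, z ∈ segment ℝ p q → z ∈ F := by
      rintro δ hδ z ⟨g1, g2, g3⟩ hz
      refine ⟨hz, g1.le, ?_, g3⟩
      by_contra hn
      nlinarith
    rcases F.eq_empty_or_nonempty with he | hne
    · refine ⟨1, one_pos, Set.disjoint_left.2 fun z hz hz' => ?_⟩
      have := key 1 one_pos z hz hz'
      rw [he] at this
      exact this
    obtain ⟨z₀, ⟨hz₀, h1, h2, h3⟩, hmin⟩ :=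
      hFc.exists_isMinOn hne (continuous_area_right (σ := σ) f a).continuousOn
    have hpos : 0 < area σ f (z₀ - a) := by
      refine lt_of_le_of_ne h1 fun h0 => ?_
      rcases h2.lt_or_eq with h2 | h2
      · exact absurd hY (h z₀ hz₀ h0.symm h2 h3 zY hzY).not_gt
      · apply ha
        have hf : f ≠ 0 := by rintro rfl; simp [area] at hc
        have hσ : σ ≠ 0 := by rintro rfl; simp [area] at hc
        obtain ⟨k, hk⟩ := exists_smul_of_area_eq_zero hσ hf h0.symm
        rw [hk, area_smul_left] at h2
        have : k = 0 := (mul_eq_zero.1 h2.symm).resolve_right hc.ne'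
        rw [this, zero_smul, sub_eq_zero] at hk
        rwa [← hk]
    refine ⟨area σ f (z₀ - a) / area σ f n, div_pos hpos hc, ?_⟩
    rw [Set.disjoint_left]
    intro z hz hz'
    have hm : area σ f (z₀ - a) ≤ area σ f (z - a) := hmin (key _ (div_pos hpos hc) z hz hz')
    obtain ⟨g1, g2, g3⟩ := hz
    rw [div_mul_eq_mul_div, lt_div_iff₀ hc] at g2
    nlinarith

namespace SimplePolygon

variable {P : SimplePolygon}

theorem exists_disjoint_tri {σ : ℝ} {a f n : E2} (hc : 0 < area σ f n)
    (h : ∀ k, ∀ s ∈ P.edge k, area σ f (s - a) = 0 → 0 < area σ (s - a) n →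
      area σ (s - a) n ≤ area σ f n → ∀ z ∈ P.edge k, area σ f (z - a) ≤ 0) :
    ∃ δ > 0, Disjoint (tri σ a f n δ) P.boundary := by
  have : NeZero P.n := ⟨by have := P.three_le; omega⟩
  choose d hd hdisj using fun k => exists_disjoint_tri_segment hc (h k)
  obtain ⟨k₀, hk₀⟩ := Finite.exists_min d
  refine ⟨d k₀, hd k₀, ?_⟩
  rw [Set.disjoint_left]
  intro z hz hb
  obtain ⟨k, hk⟩ := mem_boundary.1 hb
  exact Set.disjoint_left.1 (hdisj k) (tri_mono (hd k₀) (hk₀ k) hz) hk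

theorem eventually_mem_segment {x y s : E2} (hs : s ∈ openSegment ℝ x y) :
    ∀ᶠ ε : ℝ in 𝓝 0, s + ε • (y - x) ∈ segment ℝ x y := by
  rw [openSegment_eq_image'] at hs
  obtain ⟨t, ht, rfl⟩ := hs
  have h : Tendsto (fun ε : ℝ => t + ε) (𝓝 0) (𝓝 (t + 0)) :=
    (continuous_const.add continuous_id).tendsto 0
  rw [add_zero] at h
  filter_upwards [h.eventually (Icc_mem_nhds ht.1 ht.2)] with ε hε
  rw [segment_eq_image']
  exact ⟨t + ε, hε, by module⟩

theorem parallel_of_crossing {x y s : E2} {k : ZMod P.n} (hxy : P.Visible x y)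
    (hs : s ∈ openSegment ℝ x y) (hk : s ∈ openSegment ℝ (P.vtx k) (P.vtx (k + 1))) :
    area 1 (y - x) (P.vtx (k + 1) - P.vtx k) = 0 := by
  have harms := arms_edge hk
  have hsk := hk
  rw [openSegment_eq_image'] at hsk
  obtain ⟨t, ht, hst⟩ := hsk
  simp only at hst
  set d := P.vtx (k + 1) - P.vtx k with hd
  have ea : P.vtx (k + 1) - s = (1 - t) • d := by rw [← hst, hd]; module
  have eb : P.vtx k - s = (-t) • d := by rw [← hst]; module
  rw [ea, eb] at harms
  have hcor : Corner 1 ((1 - t) • d) ((-t) • d) :=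
    harms.corner one_ne_zero (by rw [area_smul_left, area_smul_right, area_self]; simp)
  obtain ⟨r, hr, -, hr2⟩ := harms.local_structure hcor
  have main : ∀ g : E2, (∀ᶠ ε : ℝ in 𝓝 0, s + ε • g ∈ P.region) → area 1 g d < 0 → False := by
    intro g hg hneg
    have hc : Tendsto (fun ε : ℝ => s + ε • g) (𝓝 0) (𝓝 s) := by
      have : Continuous fun ε : ℝ => s + ε • g := by fun_prop
      simpa using this.tendsto 0
    have hB := hg.and (hc.eventually (Metric.ball_mem_nhds s hr))
    have hB' : ∀ᶠ ε : ℝ in 𝓝 0, s + (-ε) • g ∈ P.region ∧ s + (-ε) • g ∈ Metric.ball s r := by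
      have : Tendsto (fun ε : ℝ => -ε) (𝓝 0) (𝓝 0) := by simpa using continuous_neg.tendsto (0:ℝ)
      exact this.eventually hB
    obtain ⟨ε, hε, ⟨h1, h2⟩, ⟨h3, h4⟩⟩ :=
      ((show ∀ᶠ ε : ℝ in 𝓝[>] 0, 0 < ε from self_mem_nhdsWithin).and
        ((hB.and hB').filter_mono nhdsWithin_le_nhds)).exists
    have hε : 0 < ε := hε
    have hsec : s + ε • g ∈ sector 1 s ((1 - t) • d) ((-t) • d) := by
      simp only [sector, Set.mem_ofPred_eq, add_sub_cancel_left, area_smul_left, area_smul_right]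
      rw [area_swap d g]
      constructor
      · nlinarith [mul_pos hε ht.1]
      · nlinarith [mul_pos hε (sub_pos.2 ht.2)]
    have hcos : s + (-ε) • g ∈ cosector 1 s ((1 - t) • d) ((-t) • d) := by
      simp only [cosector, Set.mem_ofPred_eq, add_sub_cancel_left, area_smul_left, area_smul_right]
      left
      nlinarith [mul_pos hε ht.1]
    rcases hr2 with hr2 | hr2
    · exact (hr2 _ h4).2 hcos h3
    · exact (hr2 _ h2).1 hsec h1
  have hf : ∀ᶠ ε : ℝ in 𝓝 0, s + ε • (y - x) ∈ P.region :=
    (eventually_mem_segment hs).mono fun ε h => hxy h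
  rcases lt_trichotomy (area 1 (y - x) d) 0 with h | h | h
  · exact (main _ hf h).elim
  · exact h
  · refine (main (x - y) ?_ ?_).elim
    · have hs' : s ∈ openSegment ℝ y x := by rwa [openSegment_symm]
      refine (eventually_mem_segment hs').mono fun ε h => hxy ?_
      rwa [segment_symm]
    · rw [← neg_sub, area_neg_left]; linarith

theorem exists_chord {v e : E2} (hv : v ∈ P.boundary)
    (he : ∀ᶠ s : ℝ in 𝓝[>] 0, v + s • e ∈ P.inner) :
    ∃ t > (0 : ℝ), v + t • e ∈ P.boundary ∧ ∀ s ∈ Ioo 0 t, v + s • e ∈ P.inner := by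
  obtain ⟨s₀, hs₀, hs⟩ := mem_nhdsGT_iff_exists_Ioc_subset.1 he
  have hs₀ : 0 < s₀ := hs₀
  have he0 : e ≠ 0 := by
    rintro rfl
    have : v + s₀ • (0 : E2) ∈ P.inner := hs ⟨hs₀, le_rfl⟩
    rw [smul_zero, add_zero] at this
    exact this.2 hv
  obtain ⟨t₁, ht₁, hout⟩ := exists_ray_notMem_region P v he0
  have hlt : s₀ < t₁ := by
    by_contra h
    exact hout (hs ⟨ht₁, not_lt.1 h⟩ : v + t₁ • e ∈ P.inner).1
  have hcont : Continuous fun s : ℝ => v + s • e := by fun_prop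
  set F := Icc s₀ t₁ ∩ {s : ℝ | v + s • e ∉ P.inner} with hF
  have hFc : IsCompact F := isCompact_Icc.inter_right
    ((isOpen_inner (P := P)).isClosed_compl.preimage hcont)
  obtain ⟨t, ⟨⟨ht1, ht2⟩, ht3⟩, hmin⟩ := hFc.exists_isLeast ⟨t₁, ⟨hlt.le, le_rfl⟩, fun h => hout h.1⟩
  have ht3 : v + t • e ∉ P.inner := ht3
  have hin : ∀ s ∈ Ioo 0 t, v + s • e ∈ P.inner := by
    rintro s ⟨h1, h2⟩
    rcases le_or_gt s s₀ with h | h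
    · exact hs ⟨h1, h⟩
    · by_contra hn
      exact absurd (hmin ⟨⟨h.le, h2.le.trans ht2⟩, hn⟩) h2.not_ge
  have htpos : 0 < t := hs₀.trans_le ht1
  refine ⟨t, htpos, ?_, hin⟩
  have hreg : v + t • e ∈ P.region := by
    have hcl : t ∈ closure (Ioo 0 t) := by
      rw [closure_Ioo htpos.ne]; exact ⟨htpos.le, le_rfl⟩
    have := isClosed_region (P := P) |>.preimage hcont
    exact this.closure_subset_iff.2 (fun s hs => (hin s hs).1) hcl
  by_contra hb
  exact ht3 ⟨hreg, hb⟩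

end SimplePolygon

namespace SimplePolygon

variable {P : SimplePolygon}

/-! ### The window through which a connected set is hidden from a point -/

theorem isClosed_visible (x : E2) : IsClosed {y | P.Visible x y} := by
  have : {y | P.Visible x y} = ⋂ t ∈ Icc (0 : ℝ) 1, {y | x + t • (y - x) ∈ P.region} := by
    ext y
    simp only [Visible, segment_eq_image', Set.image_subset_iff, Set.mem_iInter,
      Set.mem_ofPred_eq]
    rfl
  rw [this]
  exact isClosed_biInter fun t _ => isClosed_region.preimage (by fun_prop)

theorem segment_eq_ray_image (z w : E2) {ε : ℝ} (hε : 0 ≤ ε) :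
    segment ℝ z (z + ε • w) = (fun s : ℝ => z + s • w) '' Icc 0 ε := by
  rw [segment_eq_image']
  ext q
  constructor
  · rintro ⟨t, ht, rfl⟩
    exact ⟨t * ε, ⟨mul_nonneg ht.1 hε, by nlinarith [ht.2]⟩, by simp [smul_smul]⟩
  · rintro ⟨s, hs, rfl⟩
    rcases hε.eq_or_lt with rfl | hε
    · obtain rfl : s = 0 := le_antisymm hs.2 hs.1
      exact ⟨0, by simp, by simp⟩
    · refine ⟨s / ε, ⟨div_nonneg hs.1 hε.le, (div_le_one hε).2 hs.2⟩, ?_⟩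
      simp [div_mul_cancel₀ _ hε.ne', smul_smul]

/-- A connected set of hidden points reaches the visibility region of `x` at an interior point. -/
theorem exists_transition {x : E2} {T : Set E2} (hx : x ∈ P.region) (hT : IsConnected T)
    (hsub : T ⊆ P.region) (hvis : ∀ p ∈ T, ¬ P.Visible x p) :
    ∃ (H : Set E2) (y n : E2), IsPreconnected H ∧ T ⊆ H ∧ H ⊆ P.region ∧
      (∀ p ∈ H, ¬ P.Visible x p) ∧ P.Visible x y ∧ (∀ s ∈ Icc (0 : ℝ) 1, y + s • n ∈ P.inner) ∧
      ∀ s ∈ Ioc (0 : ℝ) 1, y + s • n ∈ H := by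
  set V := {y | P.Visible x y} with hV
  have hVc : IsClosed V := isClosed_visible x
  obtain ⟨p₀, hp₀⟩ := hT.nonempty
  have hTS : T ⊆ P.region \ V := fun p hp => ⟨hsub hp, hvis p hp⟩
  set H := connectedComponentIn (P.region \ V) p₀ with hH
  have hHS : H ⊆ P.region \ V := connectedComponentIn_subset _ _
  have hHc : IsPreconnected H := isPreconnected_connectedComponentIn
  have grow : ∀ S : Set E2, IsPreconnected S → S ⊆ P.region \ V → (S ∩ H).Nonempty → S ⊆ H := by
    rintro S hS hSR ⟨q, hq1, hq2⟩
    rw [hH, connectedComponentIn_eq hq2]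
    exact hS.subset_connectedComponentIn hq1 hSR
  have hp₀H : p₀ ∈ H := mem_connectedComponentIn (hTS hp₀)
  obtain ⟨q₁, hq₁D, hq₁H⟩ : (P.inner ∩ H).Nonempty := by
    obtain ⟨w, hw⟩ := exists_inward (hsub hp₀)
    have hnV : ∀ᶠ ε : ℝ in 𝓝[>] 0, p₀ + ε • w ∉ V :=
      (Corner.tendsto_line p₀ w).eventually (hVc.isOpen_compl.mem_nhds (hvis p₀ hp₀))
    obtain ⟨ε, hε, hs⟩ := mem_nhdsGT_iff_exists_Ioc_subset.1 (hw.and hnV)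
    have hε : 0 < ε := hε
    refine ⟨p₀ + ε • w, (hs ⟨hε, le_rfl⟩).1, ?_⟩
    refine grow (segment ℝ p₀ (p₀ + ε • w)) (convex_segment _ _).isPreconnected ?_
      ⟨p₀, left_mem_segment _ _ _, hp₀H⟩ (right_mem_segment _ _ _)
    rw [segment_eq_ray_image _ _ hε.le]
    rintro _ ⟨s, ⟨h0, h1⟩, rfl⟩
    rcases h0.eq_or_lt with rfl | h0
    · simpa using hTS hp₀
    · exact ⟨(hs ⟨h0, h1⟩).1.1, (hs ⟨h0, h1⟩).2⟩
  obtain ⟨q₂, hq₂D, hq₂V⟩ : (P.inner ∩ V).Nonempty := by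
    obtain ⟨w, hw⟩ := exists_inward hx
    obtain ⟨ε, hε, hs⟩ := mem_nhdsGT_iff_exists_Ioc_subset.1 hw
    have hε : 0 < ε := hε
    refine ⟨x + ε • w, hs ⟨hε, le_rfl⟩, ?_⟩
    change segment ℝ x (x + ε • w) ⊆ P.region
    rw [segment_eq_ray_image _ _ hε.le]
    rintro _ ⟨s, ⟨h0, h1⟩, rfl⟩
    rcases h0.eq_or_lt with rfl | h0
    · simpa using hx
    · exact (hs ⟨h0, h1⟩ : x + s • w ∈ P.inner).1
  have hnot : ∃ z ∈ P.inner, ∃ᶠ y in 𝓝 z, y ∈ P.inner ∧ ¬ (y ∈ H ↔ z ∈ H) := by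
    by_contra hcon
    push Not at hcon
    have := isPreconnected_inner (P := P) |>.subset_or_disjoint_of_locally_const (A := H)
      hcon
    rcases this with h | h
    · exact (hHS (h hq₂D)).2 hq₂V
    · exact Set.disjoint_left.1 h hq₁D hq₁H
  obtain ⟨z, hz, hfreq⟩ := hnot
  obtain ⟨r, hr, hball⟩ := Metric.isOpen_iff.1 (isOpen_inner (P := P)) z hz
  obtain ⟨y', ⟨-, hne⟩, hy'⟩ := (hfreq.and_eventually (Metric.ball_mem_nhds z hr)).exists
  have hz' := Metric.mem_ball_self (x := z) hr
  obtain ⟨p, q, hp, hq, hpH, hqH⟩ : ∃ p q, p ∈ Metric.ball z r ∧ q ∈ Metric.ball z r ∧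
      p ∈ H ∧ q ∉ H := by
    by_cases h : z ∈ H
    · exact ⟨z, y', hz', hy', h, fun h' => hne (by simp [h, h'])⟩
    · exact ⟨y', z, hy', hz', by by_contra h'; exact hne (by simp [h, h']), h⟩
  have hseg : ∀ {a}, a ∈ Metric.ball z r → segment ℝ a p ⊆ Metric.ball z r := fun ha =>
    (convex_ball z r).segment_subset ha hp
  obtain ⟨y₂, hy₂s, hy₂V⟩ : (segment ℝ q p ∩ V).Nonempty := by
    by_contra hcon
    rw [Set.not_nonempty_iff_eq_empty] at hcon
    refine hqH (grow (segment ℝ q p) (convex_segment _ _).isPreconnected (fun c hc => ⟨?_, ?_⟩)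
      ⟨p, right_mem_segment _ _ _, hpH⟩ (left_mem_segment _ _ _))
    · exact (hball (hseg hq hc)).1
    · intro hcV
      have : c ∈ segment ℝ q p ∩ V := ⟨hc, hcV⟩
      rw [hcon] at this
      exact this
  obtain ⟨t, ht, hyV, hlast⟩ := exists_last_mem (y := p) hVc hy₂V
  set y := y₂ + t • (p - y₂) with hy
  have hy₂b : y₂ ∈ Metric.ball z r := hseg hq hy₂s
  have hyb : y ∈ Metric.ball z r := hseg hy₂b (by rw [segment_eq_image']; exact ⟨t, ht, rfl⟩)
  have hyp : ∀ s ∈ Icc (0 : ℝ) 1, y + s • (p - y) ∈ P.inner := fun s hs =>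
    hball (hseg hyb (by rw [segment_eq_image']; exact ⟨s, hs, rfl⟩))
  have ht1 : t < 1 := by
    refine lt_of_le_of_ne ht.2 ?_
    rintro rfl
    rw [hy] at hyV
    simp only [one_smul, add_sub_cancel] at hyV
    exact (hHS hpH).2 hyV
  refine ⟨H, y, p - y, hHc, ?_, fun q hq => (hHS hq).1, fun q hq => (hHS hq).2, hyV, hyp, ?_⟩
  · exact hT.isPreconnected.subset_connectedComponentIn hp₀ hTS
  · have himg := grow ((fun s : ℝ => y + s • (p - y)) '' Ioc 0 1)
      (isPreconnected_Ioc.image _ (by fun_prop)) ?_ ⟨p, ⟨1, by simp, by simp⟩, hpH⟩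
    · exact fun s hs => himg ⟨s, hs, rfl⟩
    · rintro _ ⟨s, hs, rfl⟩
      refine ⟨(hyp s ⟨hs.1.le, hs.2⟩).1, ?_⟩
      have e : y + s • (p - y) = y₂ + (t + s * (1 - t)) • (p - y₂) := by rw [hy]; module
      have hlt := mul_pos hs.1 (sub_pos.2 ht1)
      simp only [e]
      exact hlast _ ⟨by linarith [ht.1], by nlinarith [hs.2]⟩ (by linarith)

theorem visible_trans {x y z : E2} (hz : y ∈ segment ℝ x z) (h1 : P.Visible x y)
    (h2 : P.Visible y z) : P.Visible x z := by
  rw [Visible, segment_eq_union hz]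
  exact Set.union_subset h1 h2

theorem visible_of_mem_segment {x y z : E2} (hz : z ∈ segment ℝ x y) (h : P.Visible x y) :
    P.Visible x z := by
  rw [Visible, segment_eq_union hz] at h
  exact subset_union_left.trans h

theorem area_one_ne_zero_of_transition {x y n : E2} (hxy : P.Visible x y)
    (hin : ∀ s ∈ Icc (0 : ℝ) 1, y + s • n ∈ P.inner)
    (hh : ∀ s ∈ Ioc (0 : ℝ) 1, ¬ P.Visible x (y + s • n)) : area 1 (y - x) n ≠ 0 := by
  intro h0
  have hyn : P.Visible y (y + n) := by
    rw [Visible, segment_eq_image']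
    rintro _ ⟨t, ht, rfl⟩
    simpa using (hin t ht).1
  have hh1 : ¬ P.Visible x (y + n) := by simpa using hh 1 (by simp)
  rcases eq_or_ne (y - x) 0 with hf | hf
  · rw [sub_eq_zero] at hf
    rw [hf] at hyn
    rw [hf] at hh1
    exact hh1 hyn
  obtain ⟨k, hk⟩ := exists_smul_of_area_eq_zero one_ne_zero hf h0
  rcases le_or_gt 0 k with hk0 | hk0
  · refine hh1 (visible_trans ?_ hxy hyn)
    rw [segment_eq_image']
    refine ⟨1 / (1 + k), ⟨by positivity, by rw [div_le_one (by linarith)]; linarith⟩, ?_⟩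
    have e : y + n - x = (1 + k) • (y - x) := by rw [hk]; module
    simp only [e, smul_smul]
    rw [one_div_mul_cancel (by linarith), one_smul]
    abel
  · have hm : 0 < min 1 (-1 / k) := lt_min one_pos (div_pos_of_neg_of_neg (by norm_num) hk0)
    refine hh (min 1 (-1 / k)) ⟨hm, min_le_left _ _⟩ (visible_of_mem_segment ?_ hxy)
    rw [segment_eq_image']
    refine ⟨1 + min 1 (-1 / k) * k, ⟨?_, ?_⟩, ?_⟩
    · have := mul_le_mul_of_nonpos_right (min_le_right 1 (-1 / k)) hk0.le
      rw [div_mul_cancel₀ _ hk0.ne] at this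
      linarith
    · nlinarith
    · simp only [hk]; module

theorem exists_disjoint_tri_of_no_blocker {x y n : E2} {σ r : ℝ} (hxy : P.Visible x y)
    (hy : y ∉ P.boundary) (hr : r ∈ Ico (0 : ℝ) 1) (hc : 0 < area σ (y - x) n)
    (hno : ∀ i, ∀ l ∈ Ioo r 1, P.vtx i = x + l • (y - x) →
      area σ (y - x) (P.vtx (i + 1) - P.vtx i) ≤ 0 ∧ area σ (y - x) (P.vtx (i - 1) - P.vtx i) ≤ 0) :
    ∃ δ > 0, Disjoint (tri σ (x + r • (y - x)) ((1 - r) • (y - x)) n δ) P.boundary := by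
  have hr1 : 0 < 1 - r := by linarith [hr.2]
  have hσ : σ ≠ 0 := by rintro rfl; simp [area] at hc
  have hf : y - x ≠ 0 := by intro h; simp [h, area] at hc
  apply exists_disjoint_tri (by rw [area_smul_left]; positivity)
  intro k s hs h0 h1 h2 z hz
  rw [area_smul_left] at h0 h2 ⊢
  obtain ⟨l, hl⟩ := exists_smul_of_area_eq_zero hσ hf
    ((mul_eq_zero.1 h0).resolve_left hr1.ne')
  rw [hl, area_smul_left] at h1 h2
  have hl0 : 0 < l := pos_of_mul_pos_left h1 hc.le
  have hl1 : l ≤ 1 - r := le_of_mul_le_mul_right h2 hc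
  have hse : s = x + (r + l) • (y - x) := by
    rw [sub_eq_iff_eq_add] at hl; rw [hl]; module
  have hsb : s ∈ P.boundary := mem_boundary.2 ⟨k, hs⟩
  have hlt : r + l < 1 := by
    refine lt_of_le_of_ne (by linarith) fun h => hy ?_
    rw [hse, h, one_smul, add_sub_cancel] at hsb
    exact hsb
  have hzs : area σ (y - x) (z - (x + r • (y - x))) = area σ (y - x) (z - s) := by
    rw [hse]
    simp only [area_sub_right, area_add_right, area_smul_right, area_self]
    ring
  rw [hzs]
  have hz' : z ∈ segment ℝ (P.vtx k) (P.vtx (k + 1)) := hz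
  rw [segment_eq_image'] at hz'
  obtain ⟨t, ht, hzt⟩ := hz'
  simp only at hzt
  suffices h : area σ (y - x) (z - s) ≤ 0 from mul_nonpos_of_nonneg_of_nonpos hr1.le h
  by_cases e1 : s = P.vtx k
  · rw [← hzt, e1, add_sub_cancel_left, area_smul_right]
    exact mul_nonpos_of_nonneg_of_nonpos ht.1
      (hno k _ ⟨by linarith, hlt⟩ (e1.symm.trans hse)).1
  by_cases e2 : s = P.vtx (k + 1)
  · have := (hno (k + 1) _ ⟨by linarith, hlt⟩ (e2.symm.trans hse)).2
    rw [add_sub_cancel_right] at this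
    have e : z - s = (1 - t) • (P.vtx k - P.vtx (k + 1)) := by rw [← hzt, e2]; module
    rw [e, area_smul_right]
    exact mul_nonpos_of_nonneg_of_nonpos (by linarith [ht.2]) this
  · have hso : s ∈ openSegment ℝ (P.vtx k) (P.vtx (k + 1)) :=
      mem_openSegment_of_ne_left_right (Ne.symm e1) (Ne.symm e2) hs
    have hsx : s ∈ openSegment ℝ x y := by
      rw [openSegment_eq_image']
      exact ⟨r + l, ⟨by linarith [hr.1], hlt⟩, hse.symm⟩
    have hpar := parallel_of_crossing hxy hsx hso
    have hs' : s ∈ segment ℝ (P.vtx k) (P.vtx (k + 1)) := hs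
    rw [segment_eq_image'] at hs'
    obtain ⟨t', ht', hst⟩ := hs'
    simp only at hst
    have e : z - s = (t - t') • (P.vtx (k + 1) - P.vtx k) := by rw [← hzt, ← hst]; module
    have hpar' : area σ (y - x) (P.vtx (k + 1) - P.vtx k) = 0 := by
      simp only [area] at hpar ⊢
      rw [one_mul] at hpar
      rw [hpar, mul_zero]
    rw [e, area_smul_right, hpar', mul_zero]

/-- If a connected set `T` is hidden from `x`, then there is a vertex `v` at which the line of
sight from `x` grazes `∂P` such that `T` and a thin triangle above the line of sight beyond `v` lie
in a common connected set avoiding the line of sight. -/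
theorem exists_window {x : E2} {T : Set E2} (hx : x ∈ P.region) (hT : IsConnected T)
    (hsub : T ⊆ P.region) (hvis : ∀ p ∈ T, ¬ P.Visible x p) :
    ∃ (σ : ℝ) (i : ZMod P.n) (f n : E2) (δ : ℝ) (Z : Set E2), 0 < area σ f n ∧ 0 < δ ∧
      tri σ (P.vtx i) f n δ ⊆ P.inner ∧ IsPreconnected Z ∧ Z ⊆ P.region ∧ T ⊆ Z ∧
      tri σ (P.vtx i) f n δ ⊆ Z ∧
      (∀ t : ℝ, 0 ≤ t → segment ℝ (P.vtx i) (P.vtx i + t • f) ⊆ P.region →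
        Disjoint Z (segment ℝ (P.vtx i) (P.vtx i + t • f))) ∧
      (∀ᶠ ε : ℝ in 𝓝[>] 0, P.vtx i + ε • (-f) ∈ P.region) ∧
      (0 < area σ f (P.vtx (i + 1) - P.vtx i) ∨ 0 < area σ f (P.vtx (i - 1) - P.vtx i)) := by
  have : NeZero P.n := ⟨by have := P.three_le; omega⟩
  obtain ⟨H, y, n, hHc, hTH, hHR, hHV, hxy, hin, hyH⟩ := exists_transition hx hT hsub hvis
  have hne := area_one_ne_zero_of_transition hxy hin fun s hs => hHV _ (hyH s hs)
  have hyD : y ∈ P.inner := by simpa using hin 0 (by simp)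
  obtain ⟨σ, hc⟩ : ∃ σ : ℝ, 0 < area σ (y - x) n := by
    refine ⟨area 1 (y - x) n, ?_⟩
    have e : area (area 1 (y - x) n) (y - x) n = area 1 (y - x) n * area 1 (y - x) n := by
      simp only [area]; ring
    rw [e]
    exact mul_self_pos.2 hne
  have hσ : σ ≠ 0 := by rintro rfl; simp [area] at hc
  -- a triangle disjoint from the boundary lies in the interior and meets `H`
  have htri : ∀ r ∈ Ico (0 : ℝ) 1, ∀ δ > 0,
      Disjoint (tri σ (x + r • (y - x)) ((1 - r) • (y - x)) n δ) P.boundary →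
      ∃ τ, τ ∈ Ioo 0 δ ∧ τ ∈ Ioc (0 : ℝ) 1 ∧
        y + τ • n ∈ tri σ (x + r • (y - x)) ((1 - r) • (y - x)) n δ ∧
        tri σ (x + r • (y - x)) ((1 - r) • (y - x)) n δ ⊆ P.inner := by
    intro r hr δ hδ hd
    obtain ⟨τ, hτ0, hτ⟩ := exists_between (lt_min hδ one_pos)
    obtain ⟨hτδ, hτ1⟩ := lt_min_iff.1 hτ
    have hc' : 0 < area σ ((1 - r) • (y - x)) n := by
      rw [area_smul_left]; exact mul_pos (sub_pos.2 hr.2) hc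
    have hm := mem_tri (a := x + r • (y - x)) hc' (s := 1) ⟨one_pos, le_rfl⟩ ⟨hτ0, hτδ⟩
    have e : x + r • (y - x) + (1 : ℝ) • ((1 - r) • (y - x) + τ • n) = y + τ • n := by module
    rw [e] at hm
    exact ⟨τ, ⟨hτ0, hτδ⟩, ⟨hτ0, hτ1.le⟩, hm, subset_inner (convex_tri _ _ _ _ _).isPreconnected hd
      hm (hin τ ⟨hτ0.le, hτ1.le⟩)⟩
  set B : Set (ZMod P.n) := {i | ∃ l ∈ Ioo (0 : ℝ) 1, P.vtx i = x + l • (y - x) ∧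
    (0 < area σ (y - x) (P.vtx (i + 1) - P.vtx i) ∨
      0 < area σ (y - x) (P.vtx (i - 1) - P.vtx i))} with hB
  have hBne : B.Nonempty := by
    by_contra hcon
    rw [Set.not_nonempty_iff_eq_empty] at hcon
    obtain ⟨δ, hδ, hd⟩ := exists_disjoint_tri_of_no_blocker (r := 0) hxy hyD.2 ⟨le_rfl, one_pos⟩ hc
      (fun i l hl hi => by
        by_contra hn
        have : i ∈ B := ⟨l, hl, hi, by
          by_contra hn'
          push Not at hn'
          exact hn hn'⟩
        rw [hcon] at this
        exact this)
    obtain ⟨τ, hτδ, hτ1, -, hsubD⟩ := htri 0 ⟨le_rfl, one_pos⟩ δ hδ hd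
    refine hHV _ (hyH τ hτ1) ?_
    rw [Visible, segment_eq_image']
    rintro _ ⟨s, ⟨hs0, hs1⟩, rfl⟩
    rcases hs0.eq_or_lt with rfl | hs0
    · simpa using hx
    · have hm := hsubD (mem_tri (by simpa using hc) ⟨hs0, hs1⟩ hτδ)
      have e : x + (0 : ℝ) • (y - x) + s • ((1 - (0 : ℝ)) • (y - x) + τ • n) =
        x + s • (y + τ • n - x) := by module
      rw [e] at hm
      exact hm.1
  obtain ⟨i, hiB, hmin⟩ := Set.exists_min_image B (fun i => dist (P.vtx i) y) B.toFinite hBne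
  obtain ⟨l, hl, hi, hblock⟩ := hiB
  obtain ⟨δ, hδ, hd⟩ := exists_disjoint_tri_of_no_blocker (r := l) hxy hyD.2 ⟨hl.1.le, hl.2⟩ hc
    (fun j l' hl' hj => by
      by_contra hn
      have hjB : j ∈ B := ⟨l', ⟨hl.1.trans hl'.1, hl'.2⟩, hj, by
        by_contra hn'
        push Not at hn'
        exact hn hn'⟩
      have hle := hmin j hjB
      have hf : 0 < ‖y - x‖ := by
        rw [norm_pos_iff]
        intro h
        simp [h, area] at hc
      have ed : ∀ l : ℝ, l < 1 → dist (x + l • (y - x)) y = (1 - l) * ‖y - x‖ := by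
        intro l hl
        rw [dist_comm, dist_eq_norm]
        have : y - (x + l • (y - x)) = (1 - l) • (y - x) := by module
        rw [this, norm_smul, Real.norm_of_nonneg (by linarith)]
      simp only [hi, hj, ed l hl.2, ed l' hl'.2] at hle
      have := le_of_mul_le_mul_right hle hf
      linarith [hl'.1])
  obtain ⟨τ, hτδ, hτ1, hm, hsubD⟩ := htri l ⟨hl.1.le, hl.2⟩ δ hδ hd
  have hl1 : 0 < 1 - l := by linarith [hl.2]
  rw [← hi] at hm hsubD
  refine ⟨σ, i, (1 - l) • (y - x), n, δ, H ∪ tri σ (P.vtx i) ((1 - l) • (y - x)) n δ, ?_, hδ, hsubD,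
    ?_, ?_, ?_, subset_union_right, ?_, ?_, ?_⟩
  · rw [area_smul_left]; positivity
  · exact hHc.union _ (hyH τ hτ1) hm (convex_tri _ _ _ _ _).isPreconnected
  · exact union_subset hHR (hsubD.trans fun z hz => hz.1)
  · exact hTH.trans subset_union_left
  · intro t ht hseg
    rw [Set.disjoint_left]
    intro q hq hqs
    have hqs' := hqs
    rw [segment_eq_ray_image _ _ ht] at hqs'
    obtain ⟨s, hs, hsq⟩ := hqs'
    simp only at hsq
    rcases hq with hq | hq
    · refine hHV q hq ?_
      have hvx : P.Visible x (P.vtx i) :=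
        visible_of_mem_segment (by
          rw [segment_eq_image']; exact ⟨l, ⟨hl.1.le, hl.2.le⟩, hi.symm⟩) hxy
      have hvq : P.Visible (P.vtx i) q := visible_of_mem_segment hqs hseg
      refine visible_trans ?_ hvx hvq
      rw [segment_eq_image']
      have hs1 : 0 ≤ s * (1 - l) := mul_nonneg hs.1 hl1.le
      have hpos : 0 < l + s * (1 - l) := by linarith [hl.1]
      refine ⟨l / (l + s * (1 - l)), ⟨by have := hl.1; positivity, ?_⟩, ?_⟩
      · rw [div_le_one hpos]; linarith
      · have e : q - x = (l + s * (1 - l)) • (y - x) := by rw [← hsq, hi]; module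
        simp only [e, smul_smul]
        rw [div_mul_cancel₀ _ hpos.ne', hi]
    · have := hq.1
      rw [← hsq, add_sub_cancel_left, area_smul_right, area_self, mul_zero] at this
      exact this.false
  · have h0 : ∀ᶠ ε : ℝ in 𝓝[>] 0, ε < l := by
      filter_upwards [Ioo_mem_nhdsGT hl.1] with ε hε using hε.2
    filter_upwards [h0, self_mem_nhdsWithin] with ε hε hε0
    have hε0 : 0 < ε := hε0
    apply hxy
    rw [segment_eq_image']
    refine ⟨l - ε * (1 - l), ⟨?_, ?_⟩, ?_⟩
    · nlinarith [hl.1]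
    · nlinarith [hl.2]
    · simp only [hi]; module
  · simp only [area_smul_left]
    rcases hblock with h | h
    · exact Or.inl (mul_pos hl1 h)
    · exact Or.inr (mul_pos hl1 h)

end SimplePolygon

namespace SimplePolygon

variable {P : SimplePolygon}

/-! ### The pocket behind the window -/

/-- The line of sight `f` grazes the boundary at `v`, where the region is locally the reflex
cosector spanned by `a` and `b`, with `a` and `b` on the same side of the line of sight. -/
structure Notch (P : SimplePolygon) (σ r : ℝ) (v a b f : E2) : Prop where
  radius_pos : 0 < r
  corner_pos : 0 < area σ a b
  left_pos : 0 < area σ f a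
  right_nonneg : 0 ≤ area σ f b
  sector_out : ∀ y ∈ Metric.ball v r, y ∈ sector σ v a b → y ∉ P.region
  cosector_in : ∀ y ∈ Metric.ball v r, y ∈ cosector σ v a b → y ∈ P.inner

theorem eventually_add_smul_mem_ball (v d : E2) {r : ℝ} (hr : 0 < r) :
    ∀ᶠ ε : ℝ in 𝓝[>] 0, v + ε • d ∈ Metric.ball v r :=
  (Corner.tendsto_line v d).eventually (Metric.ball_mem_nhds v hr)

theorem eventually_pos : ∀ᶠ ε : ℝ in 𝓝[>] 0, 0 < ε := self_mem_nhdsWithin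

theorem eventually_lt_of_pos {c : ℝ} (hc : 0 < c) : ∀ᶠ ε : ℝ in 𝓝[>] 0, ε < c := by
  filter_upwards [Ioo_mem_nhdsGT hc] with ε hε using hε.2

theorem exists_notch {σ δ : ℝ} {v a b f n : E2} (harms : P.Arms v a b) (hc : Corner σ a b)
    (hfn : 0 < area σ f n) (hδ : 0 < δ) (htri : tri σ v f n δ ⊆ P.inner)
    (hback : ∀ᶠ ε : ℝ in 𝓝[>] 0, v + ε • (-f) ∈ P.region)
    (hblock : 0 < area σ f a ∨ 0 < area σ f b) : ∃ r, P.Notch σ r v a b f := by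
  have hf : f ≠ 0 := by rintro rfl; simp [area] at hfn
  obtain ⟨r, hr, -, hloc⟩ := harms.local_structure hc
  have hfwd : ∀ τ ∈ Ioo 0 δ, ∃ s > (0 : ℝ), v + s • (f + τ • n) ∈ Metric.ball v r ∧
      v + s • (f + τ • n) ∈ P.inner := by
    intro τ hτ
    obtain ⟨s, h1, h2, h3⟩ := (eventually_pos.and ((eventually_lt_of_pos one_pos).and
      (eventually_add_smul_mem_ball v (f + τ • n) hr))).exists
    exact ⟨s, h1, h3, htri (mem_tri hfn ⟨h1, h2.le⟩ hτ)⟩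
  obtain ⟨ε, hε, hεb, hεR⟩ := (eventually_pos.and
    ((eventually_add_smul_mem_ball v (-f) hr).and hback)).exists
  have small : ∀ p q : ℝ, 0 < p → ∃ τ ∈ Ioo 0 δ, 0 < p + τ * q := by
    intro p q hp
    have ht : Tendsto (fun τ : ℝ => p + τ * q) (𝓝[>] 0) (𝓝 p) := by
      have h : Continuous fun τ : ℝ => p + τ * q := by fun_prop
      have h' := h.tendsto 0
      simp only [zero_mul, add_zero] at h'
      exact h'.mono_left nhdsWithin_le_nhds
    obtain ⟨τ, h1, h2, h3⟩ := (eventually_pos.and ((eventually_lt_of_pos hδ).and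
      (ht.eventually (lt_mem_nhds hp)))).exists
    exact ⟨τ, ⟨h1, h2⟩, h3⟩
  by_cases ha : 0 < area σ f a
  · obtain ⟨τ, hτ, hτ'⟩ := small (area σ f a) (area σ n a) ha
    obtain ⟨s, hs, hsb, hsD⟩ := hfwd τ hτ
    have hcos : v + s • (f + τ • n) ∈ cosector σ v a b := by
      right
      rw [add_sub_cancel_left, area_swap, area_smul_left, area_add_left, area_smul_left]
      have := mul_pos hs hτ'
      linarith
    have hloc : ∀ y ∈ Metric.ball v r, (y ∈ sector σ v a b → y ∉ P.region) ∧
        (y ∈ cosector σ v a b → y ∈ P.inner) :=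
      hloc.resolve_left fun h => (h _ hsb).2 hcos hsD.1
    have hb : 0 ≤ area σ f b := by
      by_contra hb
      push Not at hb
      refine (hloc _ hεb).1 ⟨?_, ?_⟩ hεR
      · rw [add_sub_cancel_left, area_smul_left, area_neg_left]
        exact mul_pos hε (by linarith)
      · rw [add_sub_cancel_left, area_smul_right, area_neg_right, area_swap, neg_neg]
        exact mul_pos hε ha
    refine ⟨r, hr, ?_, ha, hb, fun y hy => (hloc y hy).1, fun y hy => (hloc y hy).2⟩
    refine lt_of_le_of_ne hc.nonneg fun h0 => ?_
    obtain ⟨k, hk, rfl⟩ := hc.opposite h0.symm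
    rw [area_neg_right, area_smul_right] at hb
    nlinarith
  · exfalso
    have hb := hblock.resolve_left ha
    push Not at ha
    have hcos : v + ε • (-f) ∈ cosector σ v a b := by
      left
      rw [add_sub_cancel_left, area_smul_left, area_neg_left]
      nlinarith
    have hloc : ∀ y ∈ Metric.ball v r, (y ∈ sector σ v a b → y ∉ P.region) ∧
        (y ∈ cosector σ v a b → y ∈ P.inner) :=
      hloc.resolve_left fun h => (h _ hεb).2 hcos hεR
    obtain ⟨τ, hτ, hτb, hτa⟩ : ∃ τ ∈ Ioo 0 δ, 0 < area σ f b + τ * area σ n b ∧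
        0 < -area σ f a + τ * area σ a n := by
      rcases ha.lt_or_eq with ha | ha
      · obtain ⟨τ, hτ, h1⟩ := small (area σ f b) (area σ n b) hb
        obtain ⟨τ', hτ', h2⟩ := small (-area σ f a) (area σ a n) (by linarith)
        refine ⟨min τ τ', ⟨lt_min hτ.1 hτ'.1, (min_le_left _ _).trans_lt hτ.2⟩, ?_, ?_⟩
        · rcases le_or_gt 0 (area σ n b) with h | h
          · have := lt_min hτ.1 hτ'.1
            have := mul_nonneg this.le h
            linarith
          · have := mul_le_mul_of_nonpos_right (min_le_left τ τ') h.le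
            linarith
        · rcases le_or_gt 0 (area σ a n) with h | h
          · have := lt_min hτ.1 hτ'.1
            have := mul_nonneg this.le h
            linarith
          · have := mul_le_mul_of_nonpos_right (min_le_right τ τ') h.le
            linarith
      · obtain ⟨k, hk⟩ := exists_smul_of_area_eq_zero hc.orient hf ha
        have hk0 : 0 < k := by
          have h1 := hc.nonneg
          rw [hk, area_smul_left] at h1
          refine lt_of_le_of_ne (nonneg_of_mul_nonneg_left h1 hb) ?_
          rintro rfl
          exact hc.left_ne (by simpa using hk)
        obtain ⟨τ, hτ, h1⟩ := small (area σ f b) (area σ n b) hb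
        refine ⟨τ, hτ, h1, ?_⟩
        rw [ha, neg_zero, zero_add, hk, area_smul_left]
        have := hτ.1
        positivity
    obtain ⟨s, hs, hsb, hsD⟩ := hfwd τ hτ
    refine (hloc _ hsb).1 ⟨?_, ?_⟩ hsD.1
    · rw [add_sub_cancel_left, area_smul_left, area_add_left, area_smul_left]
      positivity
    · rw [add_sub_cancel_left, area_smul_right, area_add_right, area_smul_right, area_swap a f]
      positivity

theorem mem_iff_of_separation {S A T : Set E2}
    (hA : ∀ z ∈ P.region \ S, ∀ᶠ y in 𝓝 z, y ∈ P.region → (y ∈ A ↔ z ∈ A))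
    (hT : IsPreconnected T) (hTS : T ⊆ P.region \ S) {p q : E2} (hp : p ∈ T) (hq : q ∈ T) :
    p ∈ A ↔ q ∈ A := by
  rcases hT.subset_or_disjoint_of_locally_const (A := A) (fun z hz => by
    filter_upwards [hA z (hTS hz)] with y hy hyT using hy (hTS hyT).1) with h | h
  · exact iff_of_true (h hp) (h hq)
  · exact iff_of_false (Set.disjoint_left.1 h hp) (Set.disjoint_left.1 h hq)

theorem isPreconnected_ray (v d : E2) (t : ℝ) :
    IsPreconnected ((fun s : ℝ => v + s • d) '' Ioc 0 t) :=
  isPreconnected_Ioc.image _ (by fun_prop)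

namespace Notch

variable {σ r : ℝ} {v a b f : E2}

/-- The half disc on the far side of the line through `b`. -/
theorem side_subset (h : P.Notch σ r v a b f) :
    {y | area σ (y - v) b < 0} ∩ Metric.ball v r ⊆ P.region :=
  fun _ hy => (h.cosector_in _ hy.2 (Or.inl hy.1)).1

theorem isPreconnected_side : IsPreconnected ({y | area σ (y - v) b < 0} ∩ Metric.ball v r) :=
  ((convex_area_left_neg b v).inter (convex_ball v r)).isPreconnected

/-- The end of the arm `b` is on the same side of a separating set as the half disc below the
line through `b`. -/
theorem arm_notMem (h : P.Notch σ r v a b f) {S A : Set E2}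
    (hA : ∀ z ∈ P.region \ S, ∀ᶠ y in 𝓝 z, y ∈ P.region → (y ∈ A ↔ z ∈ A))
    (harm : ∀ l ∈ Ioc (0 : ℝ) 1, v + l • b ∈ P.region \ S)
    (hdisj : Disjoint {y | area σ (y - v) b < 0} S) {q : E2}
    (hq : q ∈ {y | area σ (y - v) b < 0} ∩ Metric.ball v r) (hqA : q ∉ A) : v + b ∉ A := by
  obtain ⟨l, hl0, hl1, hlb⟩ := (eventually_pos.and ((eventually_lt_of_pos one_pos).and
    (eventually_add_smul_mem_ball v b h.radius_pos))).exists
  have hl : l ∈ Ioc (0 : ℝ) 1 := ⟨hl0, hl1.le⟩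
  obtain ⟨ε, hε, hεb, hεA⟩ := (eventually_pos.and
    (((Corner.tendsto_line (v + l • b) (-a)).eventually (Metric.isOpen_ball.mem_nhds hlb)).and
    ((Corner.tendsto_line (v + l • b) (-a)).eventually (hA _ (harm l hl))))).exists
  have hmem : v + l • b + ε • (-a) ∈ {y | area σ (y - v) b < 0} ∩ Metric.ball v r := by
    refine ⟨?_, hεb⟩
    change area σ (v + l • b + ε • (-a) - v) b < 0
    have e : v + l • b + ε • (-a) - v = l • b + (-ε) • a := by module
    rw [e, area_add_left, area_smul_left, area_smul_left, area_self]
    have := mul_pos hε h.corner_pos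
    linarith
  have h1 := mem_iff_of_separation hA (isPreconnected_side (σ := σ) (b := b))
    (fun y hy => ⟨h.side_subset hy, Set.disjoint_left.1 hdisj hy.1⟩) hmem hq
  have h2 := hεA (h.side_subset hmem)
  have h3 := mem_iff_of_separation hA (isPreconnected_ray v b 1)
    (by rintro _ ⟨s, hs, rfl⟩; exact harm s hs) ⟨l, hl, rfl⟩ ⟨1, ⟨one_pos, le_rfl⟩, rfl⟩
  simp only [one_smul] at h3
  rw [← h3, ← h2, h1]
  exact hqA

/-- The lower half disc lies in the region. -/
theorem below_subset (h : P.Notch σ r v a b f) :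
    {y | area σ f (y - v) < 0} ∩ Metric.ball v r ⊆ P.region := by
  rintro y ⟨hy, hyb⟩
  refine (h.cosector_in y hyb ?_).1
  by_contra hn
  simp only [cosector, Set.mem_ofPred_eq, not_or, not_lt] at hn
  have hy : area σ f (y - v) < 0 := hy
  have := plucker σ a b f (y - v)
  rw [area_swap b (y - v)] at this
  nlinarith [mul_nonneg hn.2 h.right_nonneg, mul_nonneg h.left_pos.le hn.1,
    mul_pos_of_neg_of_neg hy (neg_lt_zero.2 h.corner_pos)]

theorem isPreconnected_below : IsPreconnected ({y | area σ f (y - v) < 0} ∩ Metric.ball v r) :=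
  ((convex_area_right_neg f v).inter (convex_ball v r)).isPreconnected

end Notch

end SimplePolygon

namespace SimplePolygon

variable {P : SimplePolygon}

theorem openSegment_subset_inner {v d : E2} {t : ℝ} (ht : 0 < t)
    (hin : ∀ s ∈ Ioo 0 t, v + s • d ∈ P.inner) : openSegment ℝ v (v + t • d) ⊆ P.inner := by
  rw [openSegment_eq_image']
  rintro _ ⟨s, hs, rfl⟩
  simp only [add_sub_cancel_left, smul_smul]
  exact hin _ ⟨mul_pos hs.1 ht, by nlinarith [hs.2]⟩

theorem ray_subset_region {v d : E2} {t : ℝ} (hend : v + t • d ∈ P.boundary)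
    (hin : ∀ s ∈ Ioo 0 t, v + s • d ∈ P.inner) {s : ℝ} (hs : s ∈ Ioc 0 t) :
    v + s • d ∈ P.region := by
  rcases hs.2.lt_or_eq with h | rfl
  · exact (hin s ⟨hs.1, h⟩).1
  · exact boundary_subset_region hend

theorem segment_subset_region {v d : E2} {t : ℝ} (ht : 0 < t) (hv : v ∈ P.boundary)
    (hend : v + t • d ∈ P.boundary) (hin : ∀ s ∈ Ioo 0 t, v + s • d ∈ P.inner) :
    segment ℝ v (v + t • d) ⊆ P.region := by
  rw [segment_eq_ray_image _ _ ht.le]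
  rintro _ ⟨s, hs, rfl⟩
  rcases hs.1.eq_or_lt with rfl | h
  · simpa using boundary_subset_region hv
  · exact ray_subset_region hend hin ⟨h, hs.2⟩

theorem exists_separation_ray {i : ZMod P.n} {d : E2} {t s σ : ℝ} (hσ : σ ≠ 0)
    (hend : P.vtx i + t • d ∈ P.boundary) (hin : ∀ s ∈ Ioo 0 t, P.vtx i + s • d ∈ P.inner)
    (hs : s ∈ Ioo 0 t) :
    ∃ A : Set E2, (∀ z ∈ P.region \ segment ℝ (P.vtx i) (P.vtx i + t • d), ∀ᶠ y in 𝓝 z,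
        y ∈ P.region → (y ∈ A ↔ z ∈ A)) ∧
      ∀ᶠ y in 𝓝 (P.vtx i + s • d), (0 < area σ d (y - P.vtx i) → y ∈ A) ∧
        (area σ d (y - P.vtx i) < 0 → y ∉ A) := by
  have ht : 0 < t := hs.1.trans hs.2
  have hm : P.vtx i + s • d ∈ openSegment ℝ (P.vtx i) (P.vtx i + t • d) := by
    rw [openSegment_eq_image']
    refine ⟨s / t, ⟨div_pos hs.1 ht, (div_lt_one ht).2 hs.2⟩, ?_⟩
    simp only [add_sub_cancel_left, smul_smul, div_mul_cancel₀ _ ht.ne']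
  obtain ⟨A, hA, hA'⟩ := exists_separation hend (openSegment_subset_inner ht hin) hm hσ
  refine ⟨A, hA, ?_⟩
  filter_upwards [hA'] with y hy
  rw [add_sub_cancel_left, area_smul_left] at hy
  exact ⟨fun h => hy.1 (mul_pos ht h), fun h => hy.2 (mul_neg_of_pos_of_neg ht h)⟩

namespace Notch

variable {σ r : ℝ} {a b f : E2} {i : ZMod P.n}

/-- The component behind a cut avoids the line of sight. -/
theorem component_disjoint (h : P.Notch σ r (P.vtx i) a b f) (hfb : 0 < area σ f b)
    (harm : ∀ l ∈ Ioc (0 : ℝ) 1, P.vtx i + l • b ∈ P.region) {t tf : ℝ} (ht : 0 < t)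
    (htf : 0 < tf)
    (hend : P.vtx i + t • (-b) ∈ P.boundary)
    (hin : ∀ s ∈ Ioo 0 t, P.vtx i + s • (-b) ∈ P.inner)
    (hendf : P.vtx i + tf • f ∈ P.boundary) (hinf : ∀ s ∈ Ioo 0 tf, P.vtx i + s • f ∈ P.inner) :
    Disjoint (connectedComponentIn (P.region \ segment ℝ (P.vtx i) (P.vtx i + t • (-b)))
      (P.vtx i + b)) (segment ℝ (P.vtx i) (P.vtx i + tf • f)) := by
  set v := P.vtx i with hv
  set S := segment ℝ v (v + t • (-b)) with hS
  have hσ : σ ≠ 0 := by rintro rfl; simp [area] at hfb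
  have hSmem : ∀ y ∈ S, ∃ s ∈ Icc 0 t, y - v = (-s) • b := by
    intro y hy
    rw [hS, segment_eq_ray_image _ _ ht.le] at hy
    obtain ⟨s, hs, rfl⟩ := hy
    exact ⟨s, hs, by module⟩
  have hSb : ∀ y ∈ S, area σ (y - v) b = 0 := by
    intro y hy
    obtain ⟨s, -, e⟩ := hSmem y hy
    rw [e, area_smul_left, area_self, mul_zero]
  obtain ⟨s, hs0, hst, hsb⟩ := (eventually_pos.and ((eventually_lt_of_pos ht).and
    (eventually_add_smul_mem_ball v (-b) h.radius_pos))).exists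
  obtain ⟨A, hA, hA'⟩ := exists_separation_ray hσ hend hin ⟨hs0, hst⟩
  -- points on either side of the cut
  obtain ⟨ε, hε, ⟨hεA, -⟩, hεb⟩ := (eventually_pos.and
    (((Corner.tendsto_line (v + s • (-b)) a).eventually hA').and
    ((Corner.tendsto_line (v + s • (-b)) a).eventually (Metric.isOpen_ball.mem_nhds hsb)))).exists
  obtain ⟨η, hη, ⟨-, hηA⟩, hηb⟩ := (eventually_pos.and
    (((Corner.tendsto_line (v + s • (-b)) (-a)).eventually hA').and
    ((Corner.tendsto_line (v + s • (-b)) (-a)).eventually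
      (Metric.isOpen_ball.mem_nhds hsb)))).exists
  have e1 : v + s • (-b) + ε • a - v = (-s) • b + ε • a := by module
  have e2 : v + s • (-b) + η • (-a) - v = (-s) • b + (-η) • a := by module
  have hc := h.corner_pos
  have hc' : area σ b a = -area σ a b := area_swap _ _
  have hup : v + s • (-b) + ε • a ∈ A := by
    apply hεA
    rw [e1, area_neg_left, area_add_right, area_smul_right, area_smul_right, area_self, hc']
    have := mul_pos hε hc
    linarith
  have hdown : v + s • (-b) + η • (-a) ∉ A := by
    apply hηA
    rw [e2, area_neg_left, area_add_right, area_smul_right, area_smul_right, area_self, hc']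
    have := mul_pos hη hc
    linarith
  have harmS : ∀ l ∈ Ioc (0 : ℝ) 1, v + l • b ∈ P.region \ S := by
    refine fun l hl => ⟨harm l hl, fun hlS => ?_⟩
    obtain ⟨s', hs', e⟩ := hSmem _ hlS
    rw [add_sub_cancel_left] at e
    have := congrArg (area σ a) e
    rw [area_smul_right, area_smul_right] at this
    have h1 := mul_pos hl.1 hc
    have h2 := mul_nonneg hs'.1 hc.le
    linarith
  have hu : v + b ∉ A := by
    refine h.arm_notMem hA harmS ?_ ⟨?_, hηb⟩ hdown
    · rw [Set.disjoint_left]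
      intro y hy hyS
      have hy : area σ (y - v) b < 0 := hy
      linarith [hSb y hyS]
    · change area σ (v + s • (-b) + η • (-a) - v) b < 0
      rw [e2, area_add_left, area_smul_left, area_smul_left, area_self]
      have := mul_pos hη hc
      linarith
  have huR : v + b ∈ P.region \ S := by simpa using harmS 1 ⟨one_pos, le_rfl⟩
  have hf2 : area σ a f < 0 := by rw [area_swap]; linarith [h.left_pos]
  have hray : ∀ s ∈ Ioc 0 tf, v + s • f ∈ P.region \ S := by
    intro s hs
    refine ⟨ray_subset_region hendf hinf hs, fun hS' => ?_⟩
    have := hSb _ hS'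
    rw [add_sub_cancel_left, area_smul_left] at this
    exact (mul_pos hs.1 hfb).ne' this
  set N := {y | 0 < area σ (y - v) b} ∩ {y | area σ a (y - v) < 0} ∩ Metric.ball v r with hN
  have hNc : IsPreconnected N := (((convex_area_left_pos b v).inter
    (convex_area_right_neg a v)).inter (convex_ball v r)).isPreconnected
  have hNR : N ⊆ P.region \ S := by
    rintro y ⟨⟨h1, h2⟩, h3⟩
    refine ⟨(h.cosector_in y h3 (Or.inr h2)).1, fun hS' => ?_⟩
    have h1 : 0 < area σ (y - v) b := h1
    linarith [hSb y hS']
  have hfA : ∀ s ∈ Ioc 0 tf, v + s • f ∈ A := by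
    obtain ⟨l, hl0, hl1, hlb⟩ := (eventually_pos.and ((eventually_lt_of_pos htf).and
      (eventually_add_smul_mem_ball v f h.radius_pos))).exists
    have hlN : v + l • f ∈ N := by
      refine ⟨⟨?_, ?_⟩, hlb⟩
      · change 0 < area σ (v + l • f - v) b
        rw [add_sub_cancel_left, area_smul_left]; positivity
      · change area σ a (v + l • f - v) < 0
        rw [add_sub_cancel_left, area_smul_right]; nlinarith
    have hpN : v + s • (-b) + ε • a ∈ N := by
      refine ⟨⟨?_, ?_⟩, hεb⟩
      · change 0 < area σ (v + s • (-b) + ε • a - v) b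
        rw [e1, area_add_left, area_smul_left, area_smul_left, area_self]
        have := mul_pos hε hc
        linarith
      · change area σ a (v + s • (-b) + ε • a - v) < 0
        rw [e1, area_add_right, area_smul_right, area_smul_right, area_self]
        have := mul_pos hs0 hc
        linarith
    have hlA : v + l • f ∈ A := (mem_iff_of_separation hA hNc hNR hlN hpN).2 hup
    intro s hs
    exact (mem_iff_of_separation hA (isPreconnected_ray v f tf)
      (by rintro _ ⟨s, hs, rfl⟩; exact hray s hs) ⟨s, hs, rfl⟩ ⟨l, ⟨hl0, hl1.le⟩, rfl⟩).2 hlA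
  rw [Set.disjoint_left]
  intro q hq hqW
  rw [segment_eq_ray_image _ _ htf.le] at hqW
  obtain ⟨s', hs', rfl⟩ := hqW
  simp only at hq
  rcases hs'.1.eq_or_lt with rfl | hs0'
  · rw [zero_smul, add_zero] at hq
    exact (connectedComponentIn_subset _ _ hq).2 (left_mem_segment _ _ _)
  · have hqA := hfA s' ⟨hs0', hs'.2⟩
    exact hu ((mem_iff_of_separation hA isPreconnected_connectedComponentIn
      (connectedComponentIn_subset _ _) hq (mem_connectedComponentIn huR)).1 hqA)

/-- A connected set which avoids the line of sight beyond the notch, and which contains a thin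
triangle above it, avoids the pocket of the cut along `b`. -/
theorem disjoint_pocket (h : P.Notch σ r (P.vtx i) a b f) {n : E2} {δ : ℝ} {Z : Set E2}
    (hfn : 0 < area σ f n) (hδ : 0 < δ) (hZc : IsPreconnected Z) (hZR : Z ⊆ P.region)
    (hZtri : tri σ (P.vtx i) f n δ ⊆ Z)
    (harm : ∀ l ∈ Ioc (0 : ℝ) 1, P.vtx i + l • b ∈ P.region) {t tf : ℝ} (ht : 0 < t)
    (htf : 0 < tf)
    (hend : P.vtx i + t • (-b) ∈ P.boundary)
    (hin : ∀ s ∈ Ioo 0 t, P.vtx i + s • (-b) ∈ P.inner)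
    (hendf : P.vtx i + tf • f ∈ P.boundary) (hinf : ∀ s ∈ Ioo 0 tf, P.vtx i + s • f ∈ P.inner)
    (hZf : Disjoint Z (segment ℝ (P.vtx i) (P.vtx i + tf • f)))
    (hdeg : area σ f b = 0 → P.vtx i + t • (-b) = P.vtx i + tf • f) :
    Disjoint Z (P.pocketOfSeg (segment ℝ (P.vtx i) (P.vtx i + t • (-b))) (P.vtx i + b)) := by
  set v := P.vtx i with hv
  set W := segment ℝ v (v + tf • f) with hW
  set S := segment ℝ v (v + t • (-b)) with hS
  set Q := connectedComponentIn (P.region \ S) (v + b) with hQ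
  have hσ : σ ≠ 0 := by rintro rfl; simp [area] at hfn
  have hWmem : ∀ y ∈ W, ∃ s ∈ Icc 0 tf, y - v = s • f := by
    intro y hy
    rw [hW, segment_eq_ray_image _ _ htf.le] at hy
    obtain ⟨s, hs, rfl⟩ := hy
    exact ⟨s, hs, by module⟩
  have hWf : ∀ y ∈ W, area σ f (y - v) = 0 := by
    intro y hy
    obtain ⟨s, -, e⟩ := hWmem y hy
    rw [e, area_smul_right, area_self, mul_zero]
  have hvW : v ∈ W := left_mem_segment _ _ _
  obtain ⟨s, hs0, hs1, hst, hsb⟩ := (eventually_pos.and ((eventually_lt_of_pos one_pos).and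
    ((eventually_lt_of_pos htf).and (eventually_add_smul_mem_ball v f h.radius_pos)))).exists
  obtain ⟨A, hA, hA'⟩ := exists_separation_ray hσ hendf hinf ⟨hs0, hst⟩
  have hZW : Z ⊆ P.region \ W := fun z hz => ⟨hZR hz, Set.disjoint_left.1 hZf hz⟩
  have hZA : Z ⊆ A := by
    obtain ⟨ε, hε, ⟨hεA, -⟩, hεt⟩ := (eventually_pos.and
      (((Corner.tendsto_line (v + s • f) n).eventually hA').and
      ((Corner.tendsto_line (v + s • f) n).eventually
        (eventually_mem_tri hfn hδ ⟨hs0, hs1⟩)))).exists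
    have hpos : 0 < area σ f (v + s • f + ε • n - v) := by
      have e : v + s • f + ε • n - v = s • f + ε • n := by module
      rw [e, area_add_right, area_smul_right, area_smul_right, area_self, mul_zero, zero_add]
      positivity
    intro z hz
    exact (mem_iff_of_separation hA hZc hZW hz (hZtri (hεt hpos))).2 (hεA hpos)
  -- the lower half disc
  have hbelow : {y | area σ f (y - v) < 0} ∩ Metric.ball v r ⊆ P.region \ W := by
    intro y hy
    refine ⟨h.below_subset hy, fun hyW => ?_⟩
    have h1 : area σ f (y - v) < 0 := hy.1
    linarith [hWf y hyW]
  have hbelowA : ∀ y ∈ {y | area σ f (y - v) < 0} ∩ Metric.ball v r, y ∉ A := by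
    obtain ⟨ε, hε, ⟨-, hεA⟩, hεb⟩ := (eventually_pos.and
      (((Corner.tendsto_line (v + s • f) (-n)).eventually hA').and
      ((Corner.tendsto_line (v + s • f) (-n)).eventually
        (Metric.isOpen_ball.mem_nhds hsb)))).exists
    have hneg : area σ f (v + s • f + ε • (-n) - v) < 0 := by
      have e : v + s • f + ε • (-n) - v = s • f + (-ε) • n := by module
      rw [e, area_add_right, area_smul_right, area_smul_right, area_self, mul_zero, zero_add]
      nlinarith
    intro y hy
    rw [mem_iff_of_separation hA isPreconnected_below hbelow hy ⟨hneg, hεb⟩]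
    exact hεA hneg
  have hc := h.corner_pos
  have harmW : ∀ l ∈ Ioc (0 : ℝ) 1, v + l • b ∈ P.region \ W := by
    refine fun l hl => ⟨harm l hl, fun hlW => ?_⟩
    obtain ⟨s', hs', e⟩ := hWmem _ hlW
    rw [add_sub_cancel_left] at e
    have := congrArg (area σ a) e
    rw [area_smul_right, area_smul_right, area_swap a f] at this
    have h1 := mul_pos hl.1 hc
    have h2 := mul_nonneg hs'.1 h.left_pos.le
    linarith
  have hu : v + b ∉ A := by
    obtain ⟨ε, hε, hεb⟩ := (eventually_pos.and
      (eventually_add_smul_mem_ball v (-a) h.radius_pos)).exists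
    refine h.arm_notMem hA harmW ?_ (q := v + ε • (-a)) ⟨?_, hεb⟩ (hbelowA _ ⟨?_, hεb⟩)
    · rw [Set.disjoint_left]
      intro y hy hyW
      have hy : area σ (y - v) b < 0 := hy
      obtain ⟨s', hs', e⟩ := hWmem y hyW
      rw [e, area_smul_left] at hy
      have := mul_nonneg hs'.1 h.right_nonneg
      linarith
    · change area σ (v + ε • (-a) - v) b < 0
      rw [add_sub_cancel_left, area_smul_left, area_neg_left]
      nlinarith
    · change area σ f (v + ε • (-a) - v) < 0
      rw [add_sub_cancel_left, area_smul_right, area_neg_right]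
      nlinarith [h.left_pos]
  have hQS : Q ⊆ P.region \ S := connectedComponentIn_subset _ _
  have hQW : Q ⊆ P.region \ W := by
    intro q hq
    refine ⟨(hQS hq).1, ?_⟩
    rcases h.right_nonneg.eq_or_lt with h0 | hfb
    · rw [hW, ← hdeg h0.symm]
      exact (hQS hq).2
    · exact Set.disjoint_left.1 (h.component_disjoint hfb harm ht htf hend hin hendf hinf) hq
  have hQA : ∀ q ∈ Q, q ∉ A := by
    intro q hq hqA
    have huQ : v + b ∈ Q := by
      refine mem_connectedComponentIn ?_
      by_contra hn
      rw [hQ, connectedComponentIn_eq_empty hn] at hq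
      exact hq
    exact hu ((mem_iff_of_separation hA isPreconnected_connectedComponentIn hQW hq huQ).1 hqA)
  have hSZ : Disjoint Z S := by
    rcases h.right_nonneg.eq_or_lt with h0 | hfb
    · rw [hS, hdeg h0.symm]
      exact hZf
    rw [Set.disjoint_left]
    intro z hz hzS
    rw [hS, segment_eq_ray_image _ _ ht.le] at hzS
    obtain ⟨s', hs', rfl⟩ := hzS
    simp only at hz
    rcases hs'.1.eq_or_lt with rfl | hs0'
    · rw [zero_smul, add_zero] at hz
      exact Set.disjoint_left.1 hZf hz hvW
    · obtain ⟨l, hl0, hl1, hlb⟩ := (eventually_pos.and ((eventually_lt_of_pos ht).and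
        (eventually_add_smul_mem_ball v (-b) h.radius_pos))).exists
      have hneg : ∀ l > (0 : ℝ), area σ f (v + l • (-b) - v) < 0 := by
        intro l hl
        rw [add_sub_cancel_left, area_smul_right, area_neg_right]
        nlinarith
      refine hbelowA _ ⟨hneg l hl0, hlb⟩ ((mem_iff_of_separation hA (isPreconnected_ray v (-b) t) ?_
        ⟨l, ⟨hl0, hl1.le⟩, rfl⟩ ⟨s', ⟨hs0', hs'.2⟩, rfl⟩).2 (hZA hz))
      rintro _ ⟨l', hl', rfl⟩
      refine ⟨ray_subset_region hend hin hl', fun hW' => ?_⟩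
      have := hneg l' hl'.1
      have h0 := hWf _ hW'
      simp only at h0
      linarith
  rw [Set.disjoint_left]
  rintro z hz (hzQ | hzS)
  · obtain ⟨y, hy, hyQ⟩ := (mem_closure_iff_frequently.1 hzQ).and_eventually (hA z (hZW hz)) |>.exists
    exact hQA y hy ((hyQ (hQS hy).1).2 (hZA hz))
  · exact Set.disjoint_left.1 hSZ hz hzS

end Notch

end SimplePolygon

namespace SimplePolygon

variable {P : SimplePolygon}

/-! ### Cuts -/

theorem Cut.ext_index {C C' : P.Cut} (hi : C.i = C'.i) (hj : C.j = C'.j) : C = C' := by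
  obtain ⟨i, j, adj, reflex, t, t_pos, hits, first_hit, inside⟩ := C
  obtain ⟨i', j', adj', reflex', t', t_pos', hits', first_hit', inside'⟩ := C'
  obtain rfl : i = i' := hi
  obtain rfl : j = j' := hj
  obtain rfl : t = t' := by
    rcases lt_trichotomy t t' with h | h | h
    · exact (first_hit' t ⟨t_pos, h⟩ hits).elim
    · exact h
    · exact (first_hit t' ⟨t_pos', h⟩ hits').elim
  rfl

instance : Finite P.Cut := by
  have : NeZero P.n := ⟨by have := P.three_le; omega⟩
  refine Finite.of_injective (fun C : P.Cut => (C.i, C.j)) fun C C' h => ?_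
  exact Cut.ext_index (congrArg Prod.fst h) (congrArg Prod.snd h)

theorem Cut.exists_nonredundant (C : P.Cut) : ∃ C' : P.Cut, C'.Nonredundant ∧
    C'.pocket ⊆ C.pocket := by
  obtain ⟨_, hle, ⟨C', rfl⟩, hmin⟩ :=
    (Set.finite_range (Cut.pocket (P := P))).exists_le_minimal (mem_range_self C)
  refine ⟨C', ?_, hle⟩
  rintro ⟨C'', h⟩
  exact h.2 (hmin (mem_range_self C'') h.1)

theorem exists_cut_disjoint {σ δ : ℝ} {i j k : ZMod P.n} {f n : E2} {Z : Set E2}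
    (hjk : j = i + 1 ∧ k = i - 1 ∨ j = i - 1 ∧ k = i + 1)
    (harms : P.Arms (P.vtx i) (P.vtx k - P.vtx i) (P.vtx j - P.vtx i))
    (hnn : 0 ≤ area σ (P.vtx k - P.vtx i) (P.vtx j - P.vtx i))
    (hfn : 0 < area σ f n) (hδ : 0 < δ) (htri : tri σ (P.vtx i) f n δ ⊆ P.inner)
    (hZc : IsPreconnected Z) (hZR : Z ⊆ P.region) (hZtri : tri σ (P.vtx i) f n δ ⊆ Z)
    (hZf : ∀ t : ℝ, 0 ≤ t → segment ℝ (P.vtx i) (P.vtx i + t • f) ⊆ P.region →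
      Disjoint Z (segment ℝ (P.vtx i) (P.vtx i + t • f)))
    (hback : ∀ᶠ ε : ℝ in 𝓝[>] 0, P.vtx i + ε • (-f) ∈ P.region)
    (hblock : 0 < area σ f (P.vtx k - P.vtx i) ∨ 0 < area σ f (P.vtx j - P.vtx i)) :
    ∃ C : P.Cut, Disjoint Z C.pocket := by
  have hσ : σ ≠ 0 := by rintro rfl; simp [area] at hfn
  have hf : f ≠ 0 := by rintro rfl; simp [area] at hfn
  obtain ⟨r, h⟩ := exists_notch harms (harms.corner hσ hnn) hfn hδ htri hback hblock
  set v := P.vtx i with hv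
  set a := P.vtx k - v with ha
  set b := P.vtx j - v with hb
  have hvb : v ∈ P.boundary := vtx_mem_boundary i
  have hbv : v + b = P.vtx j := by rw [hb]; abel
  have hnb : v - P.vtx j = -b := by rw [hb]; abel
  have hedge : segment ℝ v (v + b) ⊆ P.boundary := by
    rw [hbv]
    rcases hjk with ⟨rfl, -⟩ | ⟨rfl, -⟩
    · exact fun z hz => mem_boundary.2 ⟨i, hz⟩
    · intro z hz
      refine mem_boundary.2 ⟨i - 1, ?_⟩
      rw [edge, sub_add_cancel, segment_symm]
      exact hz
  have harm : ∀ l ∈ Ioc (0 : ℝ) 1, v + l • b ∈ P.region := by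
    intro l hl
    apply boundary_subset_region
    apply hedge
    rw [segment_eq_image']
    exact ⟨l, ⟨hl.1.le, hl.2⟩, by simp⟩
  have hreflex : P.IsReflex i := by
    obtain ⟨ε₀, hε₀, hε⟩ := mem_nhdsGT_iff_exists_Ioo_subset.1
      (eventually_add_smul_mem_ball v ((1 / 2 : ℝ) • (a + b)) h.radius_pos)
    refine ⟨ε₀, hε₀, fun ε hε' => ?_⟩
    have e : midpoint ℝ (P.vtx i + ε • (P.vtx (i - 1) - P.vtx i))
        (P.vtx i + ε • (P.vtx (i + 1) - P.vtx i)) = v + ε • ((1 / 2 : ℝ) • (a + b)) := by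
      rw [midpoint_eq_smul_add, ha, hb, invOf_eq_inv]
      rcases hjk with ⟨rfl, rfl⟩ | ⟨rfl, rfl⟩ <;> rw [← hv] <;> module
    rw [e]
    refine h.sector_out _ (hε hε') ⟨?_, ?_⟩
    · rw [add_sub_cancel_left, area_smul_left, area_smul_left, area_add_left, area_self]
      have := mul_pos hε'.1 h.corner_pos
      linarith
    · rw [add_sub_cancel_left, area_smul_right, area_smul_right, area_add_right, area_self]
      have := mul_pos hε'.1 h.corner_pos
      linarith
  have hdir : ∀ d : E2, area σ a d < 0 → ∀ᶠ s : ℝ in 𝓝[>] 0, v + s • d ∈ P.inner := by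
    intro d hd
    filter_upwards [eventually_pos, eventually_add_smul_mem_ball v d h.radius_pos] with s hs hsb
    refine h.cosector_in _ hsb (Or.inr ?_)
    rw [add_sub_cancel_left, area_smul_right]
    nlinarith
  have haf : area σ a f < 0 := by rw [area_swap]; linarith [h.left_pos]
  obtain ⟨t, ht, hend, hin⟩ := exists_chord hvb
    (hdir (-b) (by rw [area_neg_right]; linarith [h.corner_pos]))
  obtain ⟨tf, htf, hendf, hinf, hdeg⟩ : ∃ tf > (0 : ℝ), v + tf • f ∈ P.boundary ∧
      (∀ s ∈ Ioo 0 tf, v + s • f ∈ P.inner) ∧ (area σ f b = 0 → v + t • (-b) = v + tf • f) := by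
    by_cases h0 : area σ f b = 0
    · obtain ⟨c, hc⟩ := exists_smul_of_area_eq_zero hσ hf h0
      have hc0 : 0 < -c := by
        have := h.corner_pos
        rw [hc, area_smul_right] at this
        nlinarith
      have e : ∀ s : ℝ, v + s • (-b) = v + (s * (-c)) • f := by intro s; rw [hc]; module
      refine ⟨t * (-c), mul_pos ht hc0, by rw [← e]; exact hend, fun s hs => ?_, fun _ => e t⟩
      have := hin (s / (-c)) ⟨div_pos hs.1 hc0, (div_lt_iff₀ hc0).2 hs.2⟩
      rwa [e, div_mul_cancel₀ _ hc0.ne'] at this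
    · obtain ⟨tf, h1, h2, h3⟩ := exists_chord hvb (hdir f haf)
      exact ⟨tf, h1, h2, h3, fun h => absurd h h0⟩
  refine ⟨⟨i, j, hjk.imp And.left And.left, hreflex, t, ht, ?_, ?_, ?_⟩, ?_⟩
  · rwa [hnb]
  · intro s hs
    rw [hnb]
    exact (hin s hs).2
  · rw [hnb]
    exact segment_subset_region ht hvb hend hin
  · have := h.disjoint_pocket hfn hδ hZc hZR hZtri harm ht htf hend hin hendf hinf
      (hZf tf htf.le (segment_subset_region htf hvb hendf hinf)) hdeg
    rw [hbv] at this
    simpa only [Cut.pocket, Cut.seg, Cut.v, Cut.w, Cut.u, ← hv, hnb] using this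

end SimplePolygon

/-- A connected curve inside `P` intersecting every nonredundant cut
of `P` is a visibility path: every point of `P` is visible from some point of it. -/
theorem meets_all_nonredundant_cuts_implies_visibility_path
    (P : SimplePolygon) (Pth : Set E2) (hsub : Pth ⊆ P.region) (hconn : IsConnected Pth)
    (hcuts : ∀ C : P.Cut, C.Nonredundant → (Pth ∩ C.seg).Nonempty) :
    ∀ x ∈ P.region, ∃ p ∈ Pth, P.Visible x p := by
  intro x hx
  by_contra hvis
  push Not at hvis
  obtain ⟨σ, i, f, n, δ, Z, hfn, hδ, htri, hZc, hZR, hPZ, hZtri, hZf, hback, hblock⟩ :=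
    SimplePolygon.exists_window hx hconn hsub hvis
  have harms := SimplePolygon.arms_vtx (P := P) i
  obtain ⟨C, hC⟩ : ∃ C : P.Cut, Disjoint Z C.pocket := by
    rcases le_total 0 (area σ (P.vtx (i + 1) - P.vtx i) (P.vtx (i - 1) - P.vtx i)) with h | h
    · exact SimplePolygon.exists_cut_disjoint (Or.inr ⟨rfl, rfl⟩) harms h hfn hδ htri hZc hZR hZtri
        hZf hback hblock
    · rw [area_swap] at h
      exact SimplePolygon.exists_cut_disjoint (Or.inl ⟨rfl, rfl⟩) harms.swap (by linarith) hfn hδ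
        htri hZc hZR hZtri hZf hback hblock.symm
  obtain ⟨C', hC', hle⟩ := C.exists_nonredundant
  obtain ⟨p, hp, hps⟩ := hcuts C' hC'
  exact Set.disjoint_left.1 hC (hPZ hp) (hle (Or.inr hps))
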